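/- Let Q be of finite or affine type. The map sending a finitely generated wide subcategory A of rep Q to cox(A) is an order-preserving bijection from the poset W_Q of finitely generated wide subcategories ordered by inclusion onto the poset NC_Q of noncrossing partitions; in fact it is a poset isomorphism. In particular, for every finitely generated wide subcategory A, cox(A) ∈ NC_Q, and if A ⊆ B then cox(A) ≤ cox(B) in absolute order. -/

import Mathlib

open CategoryTheory CategoryTheory.Limits ZeroObject

attribute [local instance] CategoryTheory.Abelian.hasFiniteBiproducts

noncomputable section

namespace NCPaper

/-- A finite quiver without oriented cycles. -/
structure FinQuiver : Type 1 where
  V : Type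
  [quiver : Quiver.{0} V]
  [fintypeV : Fintype V]
  [fintypeArr : ∀ a b : V, Fintype (a ⟶ b)]
  acyclic : ∀ (v : V) (p : Quiver.Path v v), p = Quiver.Path.nil

attribute [instance] FinQuiver.quiver FinQuiver.fintypeV FinQuiver.fintypeArr

variable (k : Type) [Field k] (Q : FinQuiver)

/-- The ambient abelian category of all `k`-linear representations of `Q`;
finite-dimensional representations are singled out by the predicate `FinDim`. -/
abbrev RepC : Type 1 := Paths Q.V ⥤ ModuleCat.{0} k

variable {k Q}

/-- `M` is a finite-dimensional representation, i.e. an object of `rep Q`. -/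
def FinDim (M : RepC k Q) : Prop :=
  ∀ v : Q.V, FiniteDimensional k (M.obj ((Paths.of Q.V).obj v))

section Cat

variable {C : Type*} [Category C] [Abelian C]

/-- `X` is a direct summand of `A`. -/
def IsSummand (X A : C) : Prop := ∃ (i : X ⟶ A) (r : A ⟶ X), i ≫ r = 𝟙 X

/-- The additive closure of a set of objects: direct summands of finite direct sums. -/
def addSet (S : Set C) : Set C :=
  { X | ∃ (n : ℕ) (f : Fin n → C), (∀ i, f i ∈ S) ∧ IsSummand X (⨁ f) }

/-- `Gen S`: all quotients of objects of the additive closure of `S`. -/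
def gen (S : Set C) : Set C := { X | ∃ A ∈ addSet S, ∃ p : A ⟶ X, Epi p }

/-- All morphisms from `A` to `B` vanish. -/
def HomZero (A B : C) : Prop := ∀ f : A ⟶ B, f = 0

/-- `Ext¹(A, B) = 0`, expressed by the splitting of all short exact sequences
`0 ⟶ B ⟶ E ⟶ A ⟶ 0`. -/
def Ext1Zero (A B : C) : Prop :=
  ∀ (E : C) (i : B ⟶ E) (p : E ⟶ A) (w : i ≫ p = 0),
    (ShortComplex.mk i p w).ShortExact → ∃ r : E ⟶ B, i ≫ r = 𝟙 B

/-- An indecomposable object. -/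
def Indec (X : C) : Prop :=
  ¬ IsZero X ∧ ∀ (A B : C), (X ≅ A ⊞ B) → IsZero A ∨ IsZero B

/-- A torsion class: a full subcategory (identified with its set of objects) closed under
direct sums, direct summands, quotients and extensions. -/
structure IsTorsionClass (T : Set C) : Prop where
  zero_mem : (0 : C) ∈ T
  sum_mem : ∀ X ∈ T, ∀ Y ∈ T, (X ⊞ Y : C) ∈ T
  summand_mem : ∀ X ∈ T, ∀ Y : C, IsSummand Y X → Y ∈ T
  quot_mem : ∀ X ∈ T, ∀ (Y : C) (p : X ⟶ Y), Epi p → Y ∈ T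
  ext_mem : ∀ S : ShortComplex C, S.ShortExact → S.X₁ ∈ T → S.X₃ ∈ T → S.X₂ ∈ T

/-- A wide subcategory: a full subcategory (closed under direct sums and summands)
which is exact abelian (closed under kernels and cokernels) and closed under extensions. -/
structure IsWide (A : Set C) : Prop where
  zero_mem : (0 : C) ∈ A
  sum_mem : ∀ X ∈ A, ∀ Y ∈ A, (X ⊞ Y : C) ∈ A
  summand_mem : ∀ X ∈ A, ∀ Y : C, IsSummand Y X → Y ∈ A
  ker_mem : ∀ X ∈ A, ∀ Y ∈ A, ∀ f : X ⟶ Y, (kernel f : C) ∈ A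
  coker_mem : ∀ X ∈ A, ∀ Y ∈ A, ∀ f : X ⟶ Y, (cokernel f : C) ∈ A
  ext_mem : ∀ S : ShortComplex C, S.ShortExact → S.X₁ ∈ A → S.X₃ ∈ A → S.X₂ ∈ A

/-- `P` is split projective in the subcategory `T`: every epimorphism onto `P`
from an object of `T` splits. -/
def SplitProjIn (T : Set C) (P : C) : Prop :=
  P ∈ T ∧ ∀ X ∈ T, ∀ p : X ⟶ P, Epi p → ∃ s : P ⟶ X, s ≫ p = 𝟙 P

/-- `P` is Ext-projective in the subcategory `T`. -/
def ExtProjIn (T : Set C) (P : C) : Prop := P ∈ T ∧ ∀ X ∈ T, Ext1Zero P X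

/-- The subcategory `a(T)` associated to a torsion class `T`. -/
def aSet (T : Set C) : Set C :=
  { B | B ∈ T ∧ ∀ Y ∈ T, ∀ g : Y ⟶ B, (kernel g : C) ∈ T }

/-- A subcategory is finitely generated if it is generated by a single object of it. -/
def IsFinGen (T : Set C) : Prop := ∃ U ∈ T, T ⊆ gen {U}

/-- `U` is a generator of the subcategory `T`. -/
def IsGenerator (T : Set C) (U : C) : Prop := U ∈ T ∧ T ⊆ gen {U}

/-- `X` is a subquotient of `M`. -/
def IsSubquotient (X M : C) : Prop := ∃ (N : C) (i : N ⟶ M) (p : N ⟶ X), Mono i ∧ Epi p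

/-- The support of `M` is contained in the support of `C0`: every simple subquotient
(composition factor) of `M` is a composition factor of `C0`. -/
def SuppLE (M C0 : C) : Prop := ∀ S : C, Simple S → IsSubquotient S M → IsSubquotient S C0

/-- A partial tilting object of a hereditary category. -/
def IsPartialTilting (T : C) : Prop := Ext1Zero T T

/-- `T` is a tilting object of the full subcategory `A`: it is self-orthogonal and every
(split) projective object of `A` admits a coresolution `0 ⟶ P ⟶ T' ⟶ T'' ⟶ 0` with
`T', T'' ∈ add T`. For `A` the subcategory of representations supported on `supp T`,
this says exactly that `T` is a tilting `kQ/ann T`-module. -/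
def TiltingIn (A : Set C) (T : C) : Prop :=
  T ∈ A ∧ Ext1Zero T T ∧
    ∀ P : C, SplitProjIn A P →
      ∃ (T' T'' : C) (_ : T' ∈ addSet {T}) (_ : T'' ∈ addSet {T})
        (i : P ⟶ T') (p : T' ⟶ T'') (w : i ≫ p = 0),
        (ShortComplex.mk i p w).ShortExact


/-- `U` is the direct sum of one representative of each isomorphism class of
indecomposable Ext-projective objects of `T`. -/
def IsExtProjSum (T : Set C) (U : C) : Prop :=
  ∃ (n : ℕ) (f : Fin n → C),
    (∀ i, Indec (f i) ∧ ExtProjIn T (f i)) ∧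
    (∀ i j, Nonempty (f i ≅ f j) → i = j) ∧
    (∀ P : C, Indec P → ExtProjIn T P → ∃ i, Nonempty (P ≅ f i)) ∧
    Nonempty (U ≅ ⨁ f)

/-- A basic object: a direct sum of pairwise non-isomorphic indecomposables. -/
def IsBasic (U : C) : Prop :=
  ∃ (n : ℕ) (f : Fin n → C), (∀ i, Indec (f i)) ∧
    (∀ i j, Nonempty (f i ≅ f j) → i = j) ∧ Nonempty (U ≅ ⨁ f)

end Cat

/-- A support tilting object of `rep Q`: partial tilting, and tilting as a
`kQ/ann T`-module, i.e. tilting in the subcategory of all finite-dimensional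
representations supported on the support of `T`. -/
def IsSupportTilting {k : Type} [Field k] {Q : FinQuiver} (T : RepC k Q) : Prop :=
  IsPartialTilting T ∧ TiltingIn { M : RepC k Q | FinDim M ∧ SuppLE M T } T

section Comb

/-- The dimension vector of a representation. -/
def dimVec {k : Type} [Field k] {Q : FinQuiver} (M : RepC k Q) : Q.V → ℤ :=
  fun v => (Module.finrank k (M.obj ((Paths.of Q.V).obj v)) : ℤ)

/-- The Euler form of the quiver `Q`. -/
def euler (Q : FinQuiver) {R : Type} [CommRing R] (α β : Q.V → R) : R :=
  (∑ v : Q.V, α v * β v) - ∑ a : (Σ x : Q.V, Σ y : Q.V, x ⟶ y), α a.1 * β a.2.1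

/-- The symmetrized Euler form of the quiver `Q`. -/
def symEuler (Q : FinQuiver) {R : Type} [CommRing R] (α β : Q.V → R) : R :=
  euler Q α β + euler Q β α

/-- The reflection in the vector `v`: `s_v(w) = w - (v, w)·v`. -/
def reflV (Q : FinQuiver) (v : Q.V → ℤ) : (Q.V → ℤ) → (Q.V → ℤ) :=
  fun w => w - symEuler Q v w • v

/-- The composition (product, written from left to right) of a finite sequence of
linear transformations. -/
def comps (Q : FinQuiver) {m : ℕ} (g : Fin m → ((Q.V → ℤ) → (Q.V → ℤ))) :
    (Q.V → ℤ) → (Q.V → ℤ) :=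
  (List.ofFn g).foldr (· ∘ ·) id

open scoped Classical in
/-- The simple root at a vertex. -/
def simRoot (Q : FinQuiver) (v : Q.V) : Q.V → ℤ := fun w => if w = v then 1 else 0

/-- The simple reflection at a vertex. -/
def sref (Q : FinQuiver) (v : Q.V) : (Q.V → ℤ) → (Q.V → ℤ) := reflV Q (simRoot Q v)

/-- An enumeration of the vertices is compatible with the arrows of `Q` if sources
of arrows come before targets. -/
def OrdCompatible (Q : FinQuiver) (ord : Fin (Fintype.card Q.V) ≃ Q.V) : Prop :=
  ∀ (x y : Q.V), (x ⟶ y) → ord.symm x < ord.symm y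

/-- The Coxeter element `cox(Q)`: the product of the simple reflections from left to
right in an order compatible with the arrows of `Q`. -/
def coxeter (Q : FinQuiver) (ord : Fin (Fintype.card Q.V) ≃ Q.V) :
    (Q.V → ℤ) → (Q.V → ℤ) :=
  comps Q fun i => sref Q (ord i)

/-- The product of the simple reflections indexed by a word (a list of vertices). -/
def wordProd (Q : FinQuiver) (l : List Q.V) : (Q.V → ℤ) → (Q.V → ℤ) :=
  (l.map (sref Q)).foldr (· ∘ ·) id

/-- Membership in the Coxeter group `W` (realized faithfully on the root lattice). -/
def InW (Q : FinQuiver) (w : (Q.V → ℤ) → (Q.V → ℤ)) : Prop :=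
  ∃ l : List Q.V, w = wordProd Q l

/-- The reflections of `W`: the conjugates of the simple reflections. -/
def IsRefl (Q : FinQuiver) (t : (Q.V → ℤ) → (Q.V → ℤ)) : Prop :=
  ∃ (l : List Q.V) (i : Q.V), t = wordProd Q l ∘ sref Q i ∘ wordProd Q l.reverse

/-- The absolute length: the least length of an expression as a product of reflections. -/
def ellT (Q : FinQuiver) (w : (Q.V → ℤ) → (Q.V → ℤ)) : ℕ :=
  sInf { m | ∃ f : Fin m → ((Q.V → ℤ) → (Q.V → ℤ)), (∀ i, IsRefl Q (f i)) ∧ w = comps Q f }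

/-- The absolute order on `W`. -/
def absLe (Q : FinQuiver) : ((Q.V → ℤ) → (Q.V → ℤ)) → ((Q.V → ℤ) → (Q.V → ℤ)) → Prop :=
  Relation.ReflTransGen fun u v => ∃ t, IsRefl Q t ∧ v = u ∘ t ∧ ellT Q v = ellT Q u + 1

/-- The noncrossing partitions `NC_Q`: the interval `[e, cox(Q)]` in absolute order. -/
def NCSet (Q : FinQuiver) (ord : Fin (Fintype.card Q.V) ≃ Q.V) :
    Set ((Q.V → ℤ) → (Q.V → ℤ)) :=
  { w | InW Q w ∧ absLe Q w (coxeter Q ord) }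

/-- `Q` is of finite (Dynkin) type: the symmetrized Euler form is positive definite. -/
def FiniteType (Q : FinQuiver) : Prop :=
  ∀ α : Q.V → ℚ, α ≠ 0 → 0 < symEuler Q α α

/-- `Q` is of affine (extended Dynkin) type: the symmetrized Euler form is positive
semidefinite with nontrivial radical. -/
def AffineType (Q : FinQuiver) : Prop :=
  (∀ α : Q.V → ℚ, 0 ≤ symEuler Q α α) ∧ ∃ α : Q.V → ℚ, α ≠ 0 ∧ symEuler Q α α = 0

end Comb

section Statement16

variable {k : Type} [Field k] {Q : FinQuiver}

/-- `S` is a simple object of the full subcategory `A`. -/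
def SimpleIn {C : Type*} [Category C] [Abelian C] (A : Set C) (S : C) : Prop :=
  S ∈ A ∧ ¬ IsZero S ∧ ∀ X ∈ A, ∀ i : X ⟶ S, Mono i → IsZero X ∨ IsIso i

/-- `w = cox(A)`: the product of the reflections corresponding to the simple objects
of the wide subcategory `A`, taken in an order making them an exceptional sequence. -/
def IsCoxOf (A : Set (RepC k Q)) (w : (Q.V → ℤ) → (Q.V → ℤ)) : Prop :=
  ∃ (r : ℕ) (S : Fin r → RepC k Q),
    (∀ i, SimpleIn A (S i)) ∧
    (∀ i j, Nonempty (S i ≅ S j) → i = j) ∧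
    (∀ X : RepC k Q, SimpleIn A X → ∃ i, Nonempty (X ≅ S i)) ∧
    (∀ i j, i < j → HomZero (S j) (S i) ∧ Ext1Zero (S j) (S i)) ∧
    w = comps Q fun i => reflV Q (dimVec (S i))

/-- The vector space of a representation at a vertex. -/
abbrev ob (M : RepC k Q) (v : Q.V) : ModuleCat.{0} k := M.obj ((Paths.of Q.V).obj v)

/-- The linear map of an arrow. -/
abbrev mp (M : RepC k Q) {x y : Q.V} (a : x ⟶ y) : ob M x →ₗ[k] ob M y :=
  (M.map ((Paths.of Q.V).map a)).hom

/-- component -/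
abbrev cm {M N : RepC k Q} (f : M ⟶ N) (v : Q.V) : ob M v →ₗ[k] ob N v :=
  (f.app ((Paths.of Q.V).obj v)).hom

abbrev Arr (Q : FinQuiver) := (Σ x : Q.V, Σ y : Q.V, x ⟶ y)

abbrev C0 (M N : RepC k Q) := ∀ v : Q.V, ob M v →ₗ[k] ob N v
abbrev C1 (M N : RepC k Q) := ∀ a : Arr Q, ob M a.1 →ₗ[k] ob N a.2.1

lemma cm_nat {M N : RepC k Q} (f : M ⟶ N) {x y : Q.V} (a : x ⟶ y) :
    cm f y ∘ₗ mp M a = mp N a ∘ₗ cm f x := by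
  have := f.naturality ((Paths.of Q.V).map a)
  exact congrArg ModuleCat.Hom.hom this

lemma cm_ext {M N : RepC k Q} {f g : M ⟶ N} (h : ∀ v, cm f v = cm g v) : f = g := by
  ext v x
  exact congrArg (fun t => t x) (h v)

lemma toHom_nat {M N : RepC k Q} (f : C0 M N)
    (hf : ∀ (x y : Q.V) (a : x ⟶ y), f y ∘ₗ mp M a = mp N a ∘ₗ f x) {x y : Q.V}
    (p : Quiver.Path x y) :
    M.map (X := (Paths.of Q.V).obj x) (Y := (Paths.of Q.V).obj y) p ≫ ModuleCat.ofHom (f y) =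
      ModuleCat.ofHom (f x) ≫
        N.map (X := (Paths.of Q.V).obj x) (Y := (Paths.of Q.V).obj y) p := by
  induction p with
  | nil =>
    have h1 := M.map_id ((Paths.of Q.V).obj x)
    have h2 := N.map_id ((Paths.of Q.V).obj x)
    erw [h1, h2, Category.id_comp]
  | cons p a ih =>
    have h1 := M.map_comp (X := (Paths.of Q.V).obj x) p ((Paths.of Q.V).map a)
    have h2 := N.map_comp (X := (Paths.of Q.V).obj x) p ((Paths.of Q.V).map a)
    have h3 : M.map ((Paths.of Q.V).map a) ≫ ModuleCat.ofHom (f _) =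
        ModuleCat.ofHom (f _) ≫ N.map ((Paths.of Q.V).map a) := by
      ext1
      exact hf _ _ a
    refine (congrArg (fun t => t ≫ ModuleCat.ofHom (f _)) h1).trans (Eq.trans ?_
      (congrArg (fun t => ModuleCat.ofHom (f x) ≫ t) h2).symm)
    exact (Category.assoc _ _ _).trans ((congrArg (fun t => _ ≫ t) h3).trans
      ((Category.assoc _ _ _).symm.trans ((congrArg (fun t => t ≫ _) ih).trans
        (Category.assoc _ _ _))))

def toHom {M N : RepC k Q} (f : C0 M N)
    (hf : ∀ (x y : Q.V) (a : x ⟶ y), f y ∘ₗ mp M a = mp N a ∘ₗ f x) : M ⟶ N where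
  app v := ModuleCat.ofHom (f v)
  naturality := fun _ _ p => toHom_nat f hf p

lemma cm_toHom {M N : RepC k Q} (f : C0 M N) (hf) (v : Q.V) : cm (toHom f hf) v = f v := rfl

def Phi (M N : RepC k Q) : C0 M N →ₗ[k] C1 M N where
  toFun f := fun a => f a.2.1 ∘ₗ mp M a.2.2 - mp N a.2.2 ∘ₗ f a.1
  map_add' f g := by
    funext a; simp only [Pi.add_apply, LinearMap.add_comp, LinearMap.comp_add]; abel
  map_smul' c f := by
    funext a; simp only [Pi.smul_apply, LinearMap.smul_comp, LinearMap.comp_smul, smul_sub, RingHom.id_apply]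

def homEquiv (M N : RepC k Q) : (M ⟶ N) ≃ₗ[k] LinearMap.ker (Phi M N) where
  toFun f := ⟨fun v => cm f v, by
    rw [LinearMap.mem_ker]; funext a; exact sub_eq_zero.2 (cm_nat f a.2.2)⟩
  map_add' f g := by ext; rfl
  map_smul' c f := by ext; rfl
  invFun f := toHom f.1 (fun x y a => by
    have := congrFun (LinearMap.mem_ker.1 f.2) ⟨x, y, a⟩
    exact sub_eq_zero.1 this)
  left_inv f := rfl
  right_inv f := rfl

instance fd_ob (M : RepC k Q) [h : Fact (FinDim M)] (v : Q.V) : FiniteDimensional k (ob M v) := h.out v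

def hom (M N : RepC k Q) : ℕ := Module.finrank k (M ⟶ N)
def ext (M N : RepC k Q) : ℕ := Module.finrank k (C1 M N ⧸ LinearMap.range (Phi M N))

lemma fd_hom {M N : RepC k Q} (hM : FinDim M) (hN : FinDim N) : FiniteDimensional k (M ⟶ N) := by
  have := Fact.mk hM
  have := Fact.mk hN
  exact (homEquiv M N).symm.finiteDimensional

lemma hom_sub_ext {M N : RepC k Q} (hM : FinDim M) (hN : FinDim N) :
    (hom M N : ℤ) - ext M N = euler Q (dimVec M) (dimVec N) := by
  have := Fact.mk hM
  have := Fact.mk hN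
  have h1 := (Phi M N).finrank_range_add_finrank_ker
  have h2 := (LinearMap.range (Phi M N)).finrank_quotient_add_finrank
  have h3 : hom M N = Module.finrank k (LinearMap.ker (Phi M N)) := (homEquiv M N).finrank_eq
  have h4 : (Module.finrank k (C0 M N) : ℤ) = ∑ v : Q.V, dimVec M v * dimVec N v := by
    rw [Module.finrank_pi_fintype]; simp [Module.finrank_linearMap, dimVec]
  have h5 : (Module.finrank k (C1 M N) : ℤ) = ∑ a : Arr Q, dimVec M a.1 * dimVec N a.2.1 := by
    rw [Module.finrank_pi_fintype]; simp [Module.finrank_linearMap, dimVec]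
  unfold euler ext
  rw [← h4, ← h5, h3]
  omega

structure Ses {A B C : RepC k Q} (i : A ⟶ B) (p : B ⟶ C) : Prop where
  w : i ≫ p = 0
  se : (ShortComplex.mk i p w).ShortExact

lemma mono_iff_cm {A B : RepC k Q} (f : A ⟶ B) : Mono f ↔ ∀ v, Function.Injective (cm f v) := by
  rw [NatTrans.mono_iff_mono_app]
  exact ⟨fun h v => (ModuleCat.mono_iff_injective _).1 (h v),
    fun h v => (ModuleCat.mono_iff_injective _).2 (h v)⟩

lemma epi_iff_cm {A B : RepC k Q} (f : A ⟶ B) : Epi f ↔ ∀ v, Function.Surjective (cm f v) := by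
  rw [NatTrans.epi_iff_epi_app]
  exact ⟨fun h v => (ModuleCat.epi_iff_surjective _).1 (h v),
    fun h v => (ModuleCat.epi_iff_surjective _).2 (h v)⟩

namespace Ses
variable {A B C : RepC k Q} {i : A ⟶ B} {p : B ⟶ C}

lemma mono (h : Ses i p) : Mono i := h.se.mono_f
lemma epi (h : Ses i p) : Epi p := h.se.epi_g
lemma inj (h : Ses i p) (v : Q.V) : Function.Injective (cm i v) := (mono_iff_cm i).1 h.mono v
lemma surj (h : Ses i p) (v : Q.V) : Function.Surjective (cm p v) := (epi_iff_cm p).1 h.epi v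

lemma zz (h : Ses i p) (v : Q.V) : cm p v ∘ₗ cm i v = 0 := by
  have := congrArg (fun f => cm f v) h.w
  exact this

lemma ker (h : Ses i p) (v : Q.V) : LinearMap.ker (cm p v) = LinearMap.range (cm i v) := by
  have := (h.se.map_of_exact ((evaluation _ _).obj ((Paths.of Q.V).obj v))).exact
  have := this.moduleCat_range_eq_ker
  exact this.symm

lemma exists_lift (h : Ses i p) {X : RepC k Q} (f : X ⟶ B) (hf : f ≫ p = 0) :
    ∃ g : X ⟶ A, g ≫ i = f :=
  ⟨h.se.fIsKernel.lift (KernelFork.ofι f hf), h.se.fIsKernel.fac _ WalkingParallelPair.zero⟩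

lemma exists_desc (h : Ses i p) {X : RepC k Q} (f : B ⟶ X) (hf : i ≫ f = 0) :
    ∃ g : C ⟶ X, p ≫ g = f :=
  ⟨h.se.gIsCokernel.desc (CokernelCofork.ofπ f hf),
    h.se.gIsCokernel.fac _ WalkingParallelPair.one⟩

lemma section_of_retraction (h : Ses i p) (r : B ⟶ A) (hr : i ≫ r = 𝟙 A) :
    ∃ s : C ⟶ B, s ≫ p = 𝟙 C :=
  ⟨_, (ShortComplex.Splitting.ofExactOfRetraction _ h.se.exact r hr h.epi).s_g⟩

lemma retraction_of_section (h : Ses i p) (s : C ⟶ B) (hs : s ≫ p = 𝟙 C) :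
    ∃ r : B ⟶ A, i ≫ r = 𝟙 A :=
  ⟨_, (ShortComplex.Splitting.ofExactOfSection _ h.se.exact s hs h.mono).f_r⟩

lemma of_pointwise (h1 : ∀ v, Function.Injective (cm i v)) (h2 : ∀ v, Function.Surjective (cm p v))
    (h3 : ∀ v, LinearMap.ker (cm p v) = LinearMap.range (cm i v)) : Ses i p := by
  have w : i ≫ p = 0 := by
    apply cm_ext
    intro v
    ext x
    have : cm i v x ∈ LinearMap.ker (cm p v) := by rw [h3]; exact ⟨x, rfl⟩
    exact this
  have hm : Mono i := (mono_iff_cm i).2 h1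
  have he : Epi p := (epi_iff_cm p).2 h2
  have key : ∀ {X : RepC k Q} (f : X ⟶ B) (_ : f ≫ p = 0), ∃ g : X ⟶ A, g ≫ i = f := by
    intro X f hf
    have hmem : ∀ v x, cm f v x ∈ LinearMap.range (cm i v) := by
      intro v x
      rw [← h3, LinearMap.mem_ker]
      have := congrArg (fun f => cm f v x) hf
      exact this
    let g : C0 X A := fun v => (LinearEquiv.ofInjective (cm i v) (h1 v)).symm.toLinearMap ∘ₗ
      (LinearMap.codRestrict _ (cm f v) (hmem v))
    have hg : ∀ v x, cm i v (g v x) = cm f v x := by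
      intro v x
      have := congrArg Subtype.val ((LinearEquiv.ofInjective (cm i v) (h1 v)).apply_symm_apply
        (LinearMap.codRestrict _ (cm f v) (hmem v) x))
      exact this
    refine ⟨toHom g ?_, ?_⟩
    · intro x y a
      ext t
      apply h1
      have e1 := congrArg (fun f => f (g x t)) (cm_nat i a)
      have e2 := congrArg (fun f => f t) (cm_nat f a)
      simp only [LinearMap.comp_apply] at e1 e2 ⊢
      rw [hg, e2, e1, hg]
    · apply cm_ext
      intro v
      ext x
      exact hg v x
  refine ⟨w, ShortComplex.ShortExact.mk' ?_ hm he⟩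
  apply ShortComplex.exact_of_f_is_kernel
  exact KernelFork.IsLimit.ofι' i w (fun f hf => ⟨(key f hf).choose, (key f hf).choose_spec⟩)

lemma dim (h : Ses i p) (hB : FinDim B) : dimVec B = dimVec A + dimVec C := by
  funext v
  have := Fact.mk hB
  have h1 := (cm p v).finrank_range_add_finrank_ker
  rw [h.ker, LinearMap.finrank_range_of_inj (h.inj v),
    LinearMap.range_eq_top.2 (h.surj v), finrank_top] at h1
  simp only [dimVec, Pi.add_apply]
  have : (Module.finrank k (ob C v) : ℤ) + Module.finrank k (ob A v) = Module.finrank k (ob B v) := by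
    exact_mod_cast h1
  linarith

lemma fd_left (h : Ses i p) (hB : FinDim B) : FinDim A := fun v => by
  have := Fact.mk hB
  exact FiniteDimensional.of_injective (cm i v) (h.inj v)

lemma fd_right (h : Ses i p) (hB : FinDim B) : FinDim C := fun v => by
  have := Fact.mk hB
  exact Module.Finite.of_surjective (cm p v) (h.surj v)

lemma fd_mid (h : Ses i p) (hA : FinDim A) (hC : FinDim C) : FinDim B := fun v => by
  have := Fact.mk hA
  have := Fact.mk hC
  have h1 : FiniteDimensional k (LinearMap.range (cm p v)) := inferInstance
  have h2 : FiniteDimensional k (LinearMap.ker (cm p v)) := by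
    rw [h.ker]; infer_instance
  have h3 := Module.Finite.equiv (cm p v).quotKerEquivRange.symm
  exact Module.Finite.of_submodule_quotient (LinearMap.ker (cm p v))

end Ses

namespace Ses
variable {A B C : RepC k Q} {i : A ⟶ B} {p : B ⟶ C}

lemma rank_cov (h : Ses i p) {M : RepC k Q} (hM : FinDim M) (hB : FinDim B) :
    Module.finrank k (LinearMap.range (Linear.rightComp k M p)) + hom M A = hom M B := by
  have := fd_hom hM hB
  have h1 := (Linear.rightComp k M p).finrank_range_add_finrank_ker
  have h2 : LinearMap.ker (Linear.rightComp k M p) = LinearMap.range (Linear.rightComp k M i) := by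
    ext f
    constructor
    · intro hf
      obtain ⟨g, hg⟩ := h.exists_lift f hf
      exact ⟨g, hg⟩
    · rintro ⟨g, rfl⟩
      change (g ≫ i) ≫ p = 0
      rw [Category.assoc, h.w, comp_zero]
  have h3 : Function.Injective (Linear.rightComp k M i) := by
    intro f g hfg
    have := h.mono
    exact (cancel_mono i).1 hfg
  rw [h2, LinearMap.finrank_range_of_inj h3] at h1
  exact h1

lemma rank_con (h : Ses i p) {M : RepC k Q} (hM : FinDim M) (hB : FinDim B) :
    Module.finrank k (LinearMap.range (Linear.leftComp k M i)) + hom C M = hom B M := by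
  have := fd_hom hB hM
  have h1 := (Linear.leftComp k M i).finrank_range_add_finrank_ker
  have h2 : LinearMap.ker (Linear.leftComp k M i) = LinearMap.range (Linear.leftComp k M p) := by
    ext f
    constructor
    · intro hf
      obtain ⟨g, hg⟩ := h.exists_desc f hf
      exact ⟨g, hg⟩
    · rintro ⟨g, rfl⟩
      change i ≫ (p ≫ g) = 0
      rw [← Category.assoc, h.w, zero_comp]
  have h3 : Function.Injective (Linear.leftComp k M p) := by
    intro f g hfg
    have := h.epi
    exact (cancel_epi p).1 hfg
  rw [h2, LinearMap.finrank_range_of_inj h3] at h1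
  exact h1

end Ses

lemma ext_le_of_epi {B C : RepC k Q} (p : B ⟶ C) [Epi p] {M : RepC k Q} (hM : FinDim M)
    (hB : FinDim B) : ext M C ≤ ext M B := by
  have := Fact.mk hM
  have := Fact.mk hB
  let P : C1 M B →ₗ[k] C1 M C :=
    { toFun := fun f a => cm p a.2.1 ∘ₗ f a
      map_add' := fun f g => by funext a; simp [LinearMap.comp_add]
      map_smul' := fun c f => by funext a; simp [LinearMap.comp_smul] }
  have hP : Function.Surjective P := by
    intro g
    have : ∀ a : Arr Q, ∃ h : ob M a.1 →ₗ[k] ob B a.2.1, cm p a.2.1 ∘ₗ h = g a := by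
      intro a
      obtain ⟨s, hs⟩ := (cm p a.2.1).exists_rightInverse_of_surjective
        (LinearMap.range_eq_top.2 ((epi_iff_cm p).1 inferInstance a.2.1))
      refine ⟨s ∘ₗ g a, ?_⟩
      rw [← LinearMap.comp_assoc, hs, LinearMap.id_comp]
    choose h hh using this
    exact ⟨h, funext hh⟩
  have hr : LinearMap.range (Phi M B) ≤ (LinearMap.range (Phi M C)).comap P := by
    rintro _ ⟨f, rfl⟩
    refine ⟨fun v => cm p v ∘ₗ f v, ?_⟩
    funext a
    have e := cm_nat p a.2.2
    change (cm p a.2.1 ∘ₗ f a.2.1) ∘ₗ mp M a.2.2 - mp C a.2.2 ∘ₗ (cm p a.1 ∘ₗ f a.1) =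
      cm p a.2.1 ∘ₗ (f a.2.1 ∘ₗ mp M a.2.2 - mp B a.2.2 ∘ₗ f a.1)
    rw [LinearMap.comp_sub, LinearMap.comp_assoc, ← LinearMap.comp_assoc _ _ (mp C _), ← e,
      LinearMap.comp_assoc]
  exact LinearMap.finrank_le_finrank_of_surjective (f := Submodule.mapQ _ _ P hr)
    (by
      intro y
      obtain ⟨y, rfl⟩ := Submodule.Quotient.mk_surjective _ y
      obtain ⟨x, rfl⟩ := hP y
      exact ⟨Submodule.Quotient.mk x, rfl⟩)

lemma ext_le_of_mono {A B : RepC k Q} (i : A ⟶ B) [Mono i] {M : RepC k Q} (hM : FinDim M)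
    (hB : FinDim B) : ext A M ≤ ext B M := by
  have := Fact.mk hM
  have := Fact.mk hB
  let P : C1 B M →ₗ[k] C1 A M :=
    { toFun := fun f a => f a ∘ₗ cm i a.1
      map_add' := fun f g => by funext a; simp [LinearMap.add_comp]
      map_smul' := fun c f => by funext a; simp [LinearMap.smul_comp] }
  have hP : Function.Surjective P := by
    intro g
    have : ∀ a : Arr Q, ∃ h : ob B a.1 →ₗ[k] ob M a.2.1, h ∘ₗ cm i a.1 = g a := by
      intro a
      obtain ⟨s, hs⟩ := (cm i a.1).exists_leftInverse_of_injective
        (LinearMap.ker_eq_bot.2 ((mono_iff_cm i).1 inferInstance a.1))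
      refine ⟨g a ∘ₗ s, ?_⟩
      rw [LinearMap.comp_assoc, hs, LinearMap.comp_id]
    choose h hh using this
    exact ⟨h, funext hh⟩
  have hr : LinearMap.range (Phi B M) ≤ (LinearMap.range (Phi A M)).comap P := by
    rintro _ ⟨f, rfl⟩
    refine ⟨fun v => f v ∘ₗ cm i v, ?_⟩
    funext a
    have e := cm_nat i a.2.2
    change (f a.2.1 ∘ₗ cm i a.2.1) ∘ₗ mp A a.2.2 - mp M a.2.2 ∘ₗ (f a.1 ∘ₗ cm i a.1) =
      (f a.2.1 ∘ₗ mp B a.2.2 - mp M a.2.2 ∘ₗ f a.1) ∘ₗ cm i a.1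
    rw [LinearMap.sub_comp, LinearMap.comp_assoc, e, LinearMap.comp_assoc, LinearMap.comp_assoc]
  exact LinearMap.finrank_le_finrank_of_surjective (f := Submodule.mapQ _ _ P hr)
    (by
      intro y
      obtain ⟨y, rfl⟩ := Submodule.Quotient.mk_surjective _ y
      obtain ⟨x, rfl⟩ := hP y
      exact ⟨Submodule.Quotient.mk x, rfl⟩)

lemma euler_add_left {R : Type} [CommRing R] (a b c : Q.V → R) :
    euler Q (a + b) c = euler Q a c + euler Q b c := by
  simp only [euler, Pi.add_apply, add_mul, Finset.sum_add_distrib]; ring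
lemma euler_add_right {R : Type} [CommRing R] (a b c : Q.V → R) :
    euler Q a (b + c) = euler Q a b + euler Q a c := by
  simp only [euler, Pi.add_apply, mul_add, Finset.sum_add_distrib]; ring
lemma euler_smul_left {R : Type} [CommRing R] (r : R) (a c : Q.V → R) :
    euler Q (r • a) c = r * euler Q a c := by
  simp only [euler, Pi.smul_apply, smul_eq_mul, mul_assoc, ← Finset.mul_sum]; ring
lemma euler_smul_right {R : Type} [CommRing R] (r : R) (a c : Q.V → R) :
    euler Q a (r • c) = r * euler Q a c := by
  simp only [euler, Pi.smul_apply, smul_eq_mul, mul_left_comm _ r, ← Finset.mul_sum]; ring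
lemma euler_neg_left {R : Type} [CommRing R] (a c : Q.V → R) :
    euler Q (-a) c = - euler Q a c := by
  have := euler_smul_left (Q := Q) (-1 : R) a c; simpa using this
lemma euler_neg_right {R : Type} [CommRing R] (a c : Q.V → R) :
    euler Q a (-c) = - euler Q a c := by
  have := euler_smul_right (Q := Q) (-1 : R) a c; simpa using this
lemma euler_sub_left {R : Type} [CommRing R] (a b c : Q.V → R) :
    euler Q (a - b) c = euler Q a c - euler Q b c := by
  rw [sub_eq_add_neg, euler_add_left, euler_neg_left]; ring
lemma euler_sub_right {R : Type} [CommRing R] (a b c : Q.V → R) :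
    euler Q a (b - c) = euler Q a b - euler Q a c := by
  rw [sub_eq_add_neg, euler_add_right, euler_neg_right]; ring
lemma euler_zero_left {R : Type} [CommRing R] (c : Q.V → R) : euler Q 0 c = 0 := by
  simp [euler]
lemma euler_zero_right {R : Type} [CommRing R] (c : Q.V → R) : euler Q c 0 = 0 := by
  simp [euler]

namespace Ses
variable {A B C : RepC k Q} {i : A ⟶ B} {p : B ⟶ C}

/-- long exact sequence, numerically, covariant -/
lemma les_cov (h : Ses i p) {M : RepC k Q} (hM : FinDim M) (hB : FinDim B) :
    ((hom M A : ℤ) - hom M B + hom M C = ext M A - ext M B + ext M C) ∧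
    hom M A ≤ hom M B ∧ hom M B ≤ hom M A + hom M C ∧ ext M C ≤ ext M B ∧
      ext M B ≤ ext M A + ext M C := by
  have hA := h.fd_left hB
  have hC := h.fd_right hB
  have e1 := hom_sub_ext hM hA
  have e2 := hom_sub_ext hM hB
  have e3 := hom_sub_ext hM hC
  rw [h.dim hB, euler_add_right] at e2
  have := h.rank_cov hM hB
  have := fd_hom hM hC
  have hle : Module.finrank k (LinearMap.range (Linear.rightComp k M p)) ≤ hom M C :=
    Submodule.finrank_le _
  have := h.epi
  have := ext_le_of_epi p hM hB
  refine ⟨by linarith, by omega, by omega, this, by omega⟩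

lemma les_con (h : Ses i p) {M : RepC k Q} (hM : FinDim M) (hB : FinDim B) :
    ((hom C M : ℤ) - hom B M + hom A M = ext C M - ext B M + ext A M) ∧
    hom C M ≤ hom B M ∧ hom B M ≤ hom C M + hom A M ∧ ext A M ≤ ext B M ∧
      ext B M ≤ ext C M + ext A M := by
  have hA := h.fd_left hB
  have hC := h.fd_right hB
  have e1 := hom_sub_ext hA hM
  have e2 := hom_sub_ext hB hM
  have e3 := hom_sub_ext hC hM
  rw [h.dim hB, euler_add_left] at e2
  have := h.rank_con hM hB
  have := fd_hom hA hM
  have hle : Module.finrank k (LinearMap.range (Linear.leftComp k M i)) ≤ hom A M :=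
    Submodule.finrank_le _
  have := h.mono
  have := ext_le_of_mono i hM hB
  refine ⟨by linarith, by omega, by omega, this, by omega⟩

/-- if `ext M A = 0` then maps `M ⟶ C` lift. -/
lemma lift_of_ext (h : Ses i p) {M : RepC k Q} (hM : FinDim M) (hB : FinDim B)
    (h0 : ext M A = 0) (f : M ⟶ C) : ∃ g : M ⟶ B, g ≫ p = f := by
  obtain ⟨e1, e2, e3, e4, e5⟩ := h.les_cov hM hB
  have := h.rank_cov hM hB
  have := fd_hom hM (h.fd_right hB)
  have hfr : Module.finrank k (LinearMap.range (Linear.rightComp k M p)) = Module.finrank k (M ⟶ C) := by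
    have hle : Module.finrank k (LinearMap.range (Linear.rightComp k M p)) ≤ hom M C :=
      Submodule.finrank_le _
    change _ = hom M C
    omega
  have := Submodule.eq_top_of_finrank_eq hfr
  exact LinearMap.range_eq_top.1 this f

lemma desc_of_ext (h : Ses i p) {M : RepC k Q} (hM : FinDim M) (hB : FinDim B)
    (h0 : ext C M = 0) (f : A ⟶ M) : ∃ g : B ⟶ M, i ≫ g = f := by
  obtain ⟨e1, e2, e3, e4, e5⟩ := h.les_con hM hB
  have := h.rank_con hM hB
  have := fd_hom (h.fd_left hB) hM
  have hfr : Module.finrank k (LinearMap.range (Linear.leftComp k M i)) = Module.finrank k (A ⟶ M) := by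
    have hle : Module.finrank k (LinearMap.range (Linear.leftComp k M i)) ≤ hom A M :=
      Submodule.finrank_le _
    change _ = hom A M
    omega
  have := Submodule.eq_top_of_finrank_eq hfr
  exact LinearMap.range_eq_top.1 this f

end Ses

section ext
variable {A B : RepC k Q} (θ : C1 A B)

/-- the extension given by a cocycle -/
def extQ : Q.V ⥤q ModuleCat.{0} k where
  obj v := ModuleCat.of k (ob B v × ob A v)
  map {x y} a := ModuleCat.ofHom
    ((mp B a ∘ₗ LinearMap.fst k _ _ + θ ⟨x, y, a⟩ ∘ₗ LinearMap.snd k _ _).prod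
      (mp A a ∘ₗ LinearMap.snd k _ _))

def extObj : RepC k Q := Paths.lift (extQ θ)

lemma mp_extObj {x y : Q.V} (a : x ⟶ y) : mp (extObj θ) a =
    ((mp B a ∘ₗ LinearMap.fst k _ _ + θ ⟨x, y, a⟩ ∘ₗ LinearMap.snd k _ _).prod
      (mp A a ∘ₗ LinearMap.snd k _ _)) :=
  congrArg ModuleCat.Hom.hom (Paths.lift_toPath (extQ θ) a)

def extI : B ⟶ extObj θ := toHom (fun v => LinearMap.inl k (ob B v) (ob A v)) (by
  intro x y a
  rw [mp_extObj]
  apply LinearMap.ext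
  intro t
  have h0 : (θ ⟨x, y, a⟩) 0 = 0 := map_zero _
  have h1 : mp A a 0 = 0 := map_zero _
  have h2 : ∀ u w : ob B y, w = 0 → u = u + w := fun u w h => by rw [h, add_zero]
  exact Prod.ext (h2 _ _ h0) h1.symm)

def extP : extObj θ ⟶ A := toHom (fun v => LinearMap.snd k (ob B v) (ob A v)) (by
  intro x y a
  rw [mp_extObj]
  apply LinearMap.ext
  rintro ⟨s, t⟩
  rfl)

lemma ext_ses : Ses (extI θ) (extP θ) := by
  apply Ses.of_pointwise
  · intro v; exact LinearMap.inl_injective (R := k) (M := ob B v) (M₂ := ob A v)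
  · intro v; exact LinearMap.snd_surjective (R := k) (M := ob B v) (M₂ := ob A v)
  · intro v; exact (LinearMap.range_inl k (ob B v) (ob A v)).symm

lemma mem_range_of_section (s : A ⟶ extObj θ) (hs : s ≫ extP θ = 𝟙 A) :
    θ ∈ LinearMap.range (Phi A B) := by
  refine ⟨fun v => LinearMap.fst k (ob B v) (ob A v) ∘ₗ cm s v, ?_⟩
  funext a
  obtain ⟨x, y, a⟩ := a
  have e := cm_nat s a
  have e2 : ∀ t, (cm s x t : ob B x × ob A x).2 = t := fun t =>
    congrArg (fun f => cm f x t) hs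
  rw [mp_extObj] at e
  apply LinearMap.ext
  intro t
  have e3 := congrArg (fun f => (f t : ob B y × ob A y).1) e
  simp only [LinearMap.comp_apply] at e3
  have e4 : (cm s y (mp A a t) : ob B y × ob A y).1 =
    mp B a (cm s x t : ob B x × ob A x).1 + θ ⟨x, y, a⟩ (cm s x t : ob B x × ob A x).2 := e3
  rw [e2] at e4
  have h2 : ∀ u v w : ob B y, u = v + w → u - v = w := fun u v w h => by
    rw [h, add_sub_cancel_left]
  exact h2 _ _ _ e4

end ext

lemma exists_nonsplit {A B : RepC k Q} (h : ext A B ≠ 0) :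
    ∃ (E : RepC k Q) (i : B ⟶ E) (p : E ⟶ A), Ses i p ∧ ∀ s : A ⟶ E, s ≫ p ≠ 𝟙 A := by
  have : ∃ θ : C1 A B, θ ∉ LinearMap.range (Phi A B) := by
    by_contra hcon
    push Not at hcon
    have : LinearMap.range (Phi A B) = ⊤ := by
      ext x; simp [hcon x]
    apply h
    unfold ext
    rw [this]
    exact Module.finrank_zero_of_subsingleton
  obtain ⟨θ, hθ⟩ := this
  exact ⟨_, _, _, ext_ses θ, fun s hs => hθ (mem_range_of_section θ s hs)⟩

lemma ext1Zero_iff {A B : RepC k Q} (hA : FinDim A) (hB : FinDim B) :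
    Ext1Zero A B ↔ ext A B = 0 := by
  constructor
  · intro h
    by_contra hne
    obtain ⟨E, i, p, hs, hn⟩ := exists_nonsplit hne
    obtain ⟨r, hr⟩ := h E i p hs.w hs.se
    obtain ⟨s, hs'⟩ := hs.section_of_retraction r hr
    exact hn s hs'
  · intro h E i p w hse
    have hs : Ses i p := ⟨w, hse⟩
    exact hs.desc_of_ext hB (hs.fd_mid hB hA) h (𝟙 B)

lemma homZero_iff {A B : RepC k Q} (hA : FinDim A) (hB : FinDim B) :
    HomZero A B ↔ hom A B = 0 := by
  have := fd_hom hA hB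
  unfold hom
  rw [Module.finrank_zero_iff]
  exact ⟨fun h => ⟨fun f g => (h f).trans (h g).symm⟩, fun h f => Subsingleton.elim _ _⟩

lemma fd_of_mono {A B : RepC k Q} (i : A ⟶ B) [Mono i] (hB : FinDim B) : FinDim A := fun v => by
  have := Fact.mk hB
  exact FiniteDimensional.of_injective (cm i v) ((mono_iff_cm i).1 inferInstance v)

lemma fd_of_epi {A B : RepC k Q} (i : A ⟶ B) [Epi i] (hB : FinDim A) : FinDim B := fun v => by
  have := Fact.mk hB
  exact Module.Finite.of_surjective (cm i v) ((epi_iff_cm i).1 inferInstance v)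

lemma ses_of_mono {A B : RepC k Q} (i : A ⟶ B) [Mono i] : Ses i (cokernel.π i) :=
  ⟨cokernel.condition i, ShortComplex.ShortExact.mk' (ShortComplex.exact_cokernel i)
    inferInstance (inferInstanceAs (Epi (cokernel.π i)))⟩

lemma ses_of_epi {A B : RepC k Q} (p : A ⟶ B) [Epi p] : Ses (kernel.ι p) p :=
  ⟨kernel.condition p, ShortComplex.ShortExact.mk' (ShortComplex.exact_kernel p)
    (inferInstanceAs (Mono (kernel.ι p))) inferInstance⟩

lemma ses_biprod (A B : RepC k Q) : Ses (biprod.inl : A ⟶ A ⊞ B) (biprod.snd : A ⊞ B ⟶ B) := by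
  refine ⟨biprod.inl_snd, ?_⟩
  have : (ShortComplex.mk (biprod.inl : A ⟶ A ⊞ B) biprod.snd biprod.inl_snd).Splitting :=
    { r := biprod.fst, s := biprod.inr, f_r := by simp, s_g := by simp, id := by simp }
  exact this.shortExact

/-- image factorization data -/
structure ImFac {A B : RepC k Q} (f : A ⟶ B) (I : RepC k Q) (e : A ⟶ I) (m : I ⟶ B) : Prop where
  fac : e ≫ m = f
  epi : Epi e
  mono : Mono m
  ses1 : Ses (kernel.ι f) e
  ses2 : Ses m (cokernel.π f)

lemma imFac {A B : RepC k Q} (f : A ⟶ B) :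
    ImFac f (kernel (cokernel.π f)) (Abelian.factorThruImage f) (kernel.ι (cokernel.π f)) := by
  have h0 : Abelian.factorThruImage f ≫ kernel.ι (cokernel.π f) = f := Abelian.image.fac f
  have w : kernel.ι f ≫ Abelian.factorThruImage f = 0 := by
    rw [← cancel_mono (kernel.ι (cokernel.π f)), Category.assoc, h0, kernel.condition, zero_comp]
  refine ⟨h0, inferInstance, inferInstance, ⟨w, ?_⟩, ses_of_epi _⟩
  refine ShortComplex.ShortExact.mk' ?_ (inferInstanceAs (Mono (kernel.ι f)))
    (inferInstanceAs (Epi (Abelian.factorThruImage f)))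
  apply ShortComplex.exact_of_f_is_kernel
  refine KernelFork.IsLimit.ofι' (kernel.ι f) w (fun g hg => ⟨kernel.lift f g ?_, kernel.lift_ι _ _ _⟩)
  rw [← h0, ← Category.assoc, hg, zero_comp]

def tdim (M : RepC k Q) : ℕ := ∑ v : Q.V, Module.finrank k (ob M v)

lemma tdim_eq (M : RepC k Q) : (tdim M : ℤ) = ∑ v : Q.V, dimVec M v := by
  simp [tdim, dimVec]

lemma dimVec_nonneg (M : RepC k Q) (v : Q.V) : 0 ≤ dimVec M v := by simp [dimVec]

lemma Ses.tdim {A B C : RepC k Q} {i : A ⟶ B} {p : B ⟶ C} (h : Ses i p) (hB : FinDim B) :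
    tdim B = tdim A + tdim C := by
  have := h.dim hB
  zify
  rw [tdim_eq, tdim_eq, tdim_eq, this]
  simp [Finset.sum_add_distrib]

lemma isZero_of_tdim {M : RepC k Q} (hM : FinDim M) (h : tdim M = 0) : IsZero M := by
  rw [IsZero.iff_id_eq_zero]
  apply cm_ext
  intro v
  have := Fact.mk hM
  have h1 : Module.finrank k (ob M v) = 0 := by
    unfold tdim at h
    rw [Finset.sum_eq_zero_iff] at h
    exact h v (Finset.mem_univ v)
  have := Module.finrank_zero_iff.1 h1
  ext x
  exact Subsingleton.elim _ _

lemma dimVec_of_iso {M N : RepC k Q} (e : M ≅ N) : dimVec M = dimVec N := by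
  funext v
  have e' := (((evaluation _ _).obj ((Paths.of Q.V).obj v)).mapIso e).toLinearEquiv
  exact congrArg Nat.cast e'.finrank_eq

lemma tdim_of_iso {M N : RepC k Q} (e : M ≅ N) : tdim M = tdim N := by
  zify; rw [tdim_eq, tdim_eq, dimVec_of_iso e]

lemma tdim_zero {M : RepC k Q} (h : IsZero M) : tdim M = 0 := by
  unfold tdim
  apply Finset.sum_eq_zero
  intro v _
  have : Subsingleton (ob M v) := by
    constructor
    intro x y
    have hx : ∀ x : ob M v, x = 0 := fun x => congrArg (fun f => cm f v x) (h.eq_of_src (𝟙 M) 0)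
    rw [hx x, hx y]
  exact Module.finrank_zero_of_subsingleton

lemma dimVec_zero {M : RepC k Q} (h : IsZero M) : dimVec M = 0 := by
  have := tdim_zero h
  funext v
  unfold tdim at this
  rw [Finset.sum_eq_zero_iff] at this
  exact congrArg Nat.cast (this v (Finset.mem_univ v))

lemma tdim_pos {M : RepC k Q} (hM : FinDim M) (h : ¬ IsZero M) : 0 < tdim M := by
  by_contra hc
  exact h (isZero_of_tdim hM (by omega))

lemma isIso_of_mono_tdim {A B : RepC k Q} (i : A ⟶ B) [Mono i] (hB : FinDim B)
    (h : tdim B ≤ tdim A) : IsIso i := by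
  have hs := ses_of_mono i
  have := hs.tdim hB
  have hz := isZero_of_tdim (hs.fd_right hB) (by omega)
  have : Epi i := by
    apply Preadditive.epi_of_cokernel_zero
    exact hz.eq_of_tgt _ _
  exact isIso_of_mono_of_epi i

lemma isIso_of_epi_tdim {A B : RepC k Q} (i : A ⟶ B) [Epi i] (hA : FinDim A)
    (h : tdim A ≤ tdim B) : IsIso i := by
  have hs := ses_of_epi i
  have := hs.tdim hA
  have hz := isZero_of_tdim (hs.fd_left hA) (by omega)
  have : Mono i := by
    apply Preadditive.mono_of_kernel_zero
    exact hz.eq_of_src _ _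
  exact isIso_of_mono_of_epi i

lemma hom_iso_left {M N X : RepC k Q} (e : M ≅ N) : hom M X = hom N X :=
  (Linear.homCongr k e (Iso.refl X)).finrank_eq
lemma hom_iso_right {M N X : RepC k Q} (e : M ≅ N) : hom X M = hom X N :=
  (Linear.homCongr k (Iso.refl X) e).finrank_eq
lemma ext_iso_left {M N X : RepC k Q} (e : M ≅ N) (hM : FinDim M) (hX : FinDim X) :
    ext M X = ext N X :=
  le_antisymm (ext_le_of_mono e.hom hX (fd_of_mono e.inv hM)) (ext_le_of_mono e.inv hX hM)
lemma ext_iso_right {M N X : RepC k Q} (e : M ≅ N) (hM : FinDim M) (hX : FinDim X) :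
    ext X M = ext X N :=
  le_antisymm (ext_le_of_epi e.inv hX (fd_of_mono e.inv hM)) (ext_le_of_epi e.hom hX hM)

lemma hom_zero_of_isZero {M X : RepC k Q} (h : IsZero M ∨ IsZero X) : hom M X = 0 := by
  unfold hom
  have : Subsingleton (M ⟶ X) := by
    rcases h with h | h
    · exact ⟨fun f g => h.eq_of_src f g⟩
    · exact ⟨fun f g => h.eq_of_tgt f g⟩
  exact Module.finrank_zero_of_subsingleton

lemma hom_eq_zero_iff {A B : RepC k Q} (hA : FinDim A) (hB : FinDim B) :
    hom A B = 0 ↔ ∀ f : A ⟶ B, f = 0 := (homZero_iff hA hB).symm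

lemma ext_zero_of_isZero {M X : RepC k Q} (hM : FinDim M) (hX : FinDim X)
    (h : IsZero M ∨ IsZero X) : ext M X = 0 := by
  have h1 := hom_sub_ext hM hX
  rw [hom_zero_of_isZero h] at h1
  have h2 : euler Q (dimVec M) (dimVec X) = 0 := by
    rcases h with h | h
    · rw [dimVec_zero h, euler_zero_left]
    · rw [dimVec_zero h, euler_zero_right]
  omega

/-- exceptional objects -/
structure Exc (M : RepC k Q) : Prop where
  fd : FinDim M
  hom1 : hom M M = 1
  ext0 : ext M M = 0

namespace Exc
variable {M : RepC k Q}

lemma not_isZero (h : Exc M) : ¬ IsZero M := fun hz => by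
  have := h.hom1
  rw [hom_zero_of_isZero (Or.inl hz)] at this
  omega

lemma scalar (h : Exc M) (f : M ⟶ M) : ∃ c : k, f = c • 𝟙 M := by
  have h1 : 𝟙 M ≠ 0 := fun h0 => h.not_isZero ((IsZero.iff_id_eq_zero M).2 h0)
  obtain ⟨c, hc⟩ := (finrank_eq_one_iff_of_nonzero' (𝟙 M) h1).1 h.hom1 f
  exact ⟨c, hc.symm⟩

lemma isIso_of_ne (h : Exc M) (f : M ⟶ M) (hf : f ≠ 0) : IsIso f := by
  obtain ⟨c, rfl⟩ := h.scalar f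
  have hc : c ≠ 0 := by rintro rfl; simp at hf
  exact ⟨c⁻¹ • 𝟙 M, by simp [smul_smul, hc], by simp [smul_smul, hc]⟩

lemma q (h : Exc M) : euler Q (dimVec M) (dimVec M) = 1 := by
  rw [← hom_sub_ext h.fd h.fd, h.hom1, h.ext0]; rfl

lemma iso {N : RepC k Q} (h : Exc M) (e : M ≅ N) : Exc N :=
  ⟨fd_of_mono e.inv h.fd, by rw [← hom_iso_left e, ← hom_iso_right e]; exact h.hom1, by
    rw [← ext_iso_left e h.fd (fd_of_mono e.inv h.fd), ← ext_iso_right e h.fd h.fd]; exact h.ext0⟩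

lemma ext_q {N : RepC k Q} (hM : Exc M) (hN : Exc N) (h : dimVec M = dimVec N) : Nonempty (M ≅ N) := by
  have e1 := hom_sub_ext hM.fd hN.fd
  rw [← h, hM.q] at e1
  have hne : hom M N ≠ 0 := by omega
  rw [Ne, hom_eq_zero_iff hM.fd hN.fd] at hne
  push Not at hne
  obtain ⟨f, hf⟩ := hne
  have hI := imFac f
  set I := kernel (cokernel.π f)
  have := hI.epi
  have := hI.mono
  have fdI : FinDim I := fd_of_epi (Abelian.factorThruImage f) hM.fd
  have e2 : ext M I ≤ ext M M := ext_le_of_epi (Abelian.factorThruImage f) hM.fd hM.fd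
  rw [hM.ext0] at e2
  have e3 := hom_sub_ext hM.fd fdI
  have e4 := hom_sub_ext hN.fd fdI
  have e5 : hom M I ≠ 0 := by
    rw [Ne, hom_eq_zero_iff hM.fd fdI]
    intro h0
    apply hf
    rw [← hI.fac, h0 (Abelian.factorThruImage f), zero_comp]
  rw [← h] at e4
  have e6 : hom N I ≠ 0 := by omega
  rw [Ne, hom_eq_zero_iff hN.fd fdI] at e6
  push Not at e6
  obtain ⟨g, hg⟩ := e6
  have h7 : g ≫ kernel.ι (cokernel.π f) ≠ 0 := fun h0 => hg (by
    rw [← cancel_mono (kernel.ι (cokernel.π f)), h0, zero_comp])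
  have := hN.isIso_of_ne _ h7
  have : Epi (kernel.ι (cokernel.π f)) := epi_of_epi g _
  have : Epi f := by rw [← hI.fac]; exact epi_comp _ _
  have ht : tdim M = tdim N := by zify; rw [tdim_eq, tdim_eq, h]
  have := isIso_of_epi_tdim f hM.fd ht.le
  exact ⟨asIso f⟩

end Exc

structure WF (A : Set (RepC k Q)) : Prop where
  wide : IsWide A
  fd : ∀ X ∈ A, FinDim X

namespace WF
variable {A : Set (RepC k Q)}

lemma iso (h : WF A) {X Y : RepC k Q} (hX : X ∈ A) (e : X ≅ Y) : Y ∈ A :=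
  h.wide.summand_mem X hX Y ⟨e.inv, e.hom, by simp⟩

lemma zero (h : WF A) {X : RepC k Q} (hX : IsZero X) : X ∈ A :=
  h.iso h.wide.zero_mem ((isZero_zero _).iso hX)

lemma mid (h : WF A) {X Y Z : RepC k Q} {i : X ⟶ Y} {p : Y ⟶ Z} (hs : Ses i p) (hX : X ∈ A)
    (hZ : Z ∈ A) : Y ∈ A := h.wide.ext_mem _ hs.se hX hZ

lemma left (h : WF A) {X Y Z : RepC k Q} {i : X ⟶ Y} {p : Y ⟶ Z} (hs : Ses i p) (hX : Y ∈ A)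
    (hZ : Z ∈ A) : X ∈ A :=
  h.iso (h.wide.ker_mem Y hX Z hZ p)
    ((kernelIsKernel p).conePointUniqueUpToIso hs.se.fIsKernel)

lemma right (h : WF A) {X Y Z : RepC k Q} {i : X ⟶ Y} {p : Y ⟶ Z} (hs : Ses i p) (hX : X ∈ A)
    (hZ : Y ∈ A) : Z ∈ A :=
  h.iso (h.wide.coker_mem X hX Y hZ i)
    ((cokernelIsCokernel i).coconePointUniqueUpToIso hs.se.gIsCokernel)

lemma im (h : WF A) {X Y : RepC k Q} (hX : X ∈ A) (hY : Y ∈ A) (f : X ⟶ Y) :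
    (kernel (cokernel.π f) : RepC k Q) ∈ A :=
  h.wide.ker_mem _ hY _ (h.wide.coker_mem _ hX _ hY f) _

end WF

namespace SimpleIn
variable {A : Set (RepC k Q)}

lemma epi_of_ne (hA : WF A) {X T : RepC k Q} (hT : SimpleIn A T) (hX : X ∈ A) (f : X ⟶ T)
    (hf : f ≠ 0) : Epi f := by
  have hI := imFac f
  have := hI.epi
  have := hI.mono
  rcases hT.2.2 _ (hA.im hX hT.1 f) (kernel.ι (cokernel.π f)) inferInstance with h | h
  · exact absurd (by rw [← hI.fac, h.eq_of_tgt (Abelian.factorThruImage f) 0, zero_comp]) hf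
  · rw [← hI.fac]; exact epi_comp _ _

lemma mono_of_ne (hA : WF A) {X T : RepC k Q} (hT : SimpleIn A T) (hX : X ∈ A) (f : T ⟶ X)
    (hf : f ≠ 0) : Mono f := by
  rcases hT.2.2 _ (hA.wide.ker_mem _ hT.1 _ hX f) (kernel.ι f) inferInstance with h | h
  · exact Preadditive.mono_of_kernel_zero (h.eq_of_src _ _)
  · exact absurd (by rw [← cancel_epi (kernel.ι f), kernel.condition, comp_zero]) hf

lemma iso_of_ne (hA : WF A) {S T : RepC k Q} (hS : SimpleIn A S) (hT : SimpleIn A T) (f : S ⟶ T)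
    (hf : f ≠ 0) : IsIso f := by
  have := epi_of_ne hA hT hS.1 f hf
  have := mono_of_ne hA hS hT.1 f hf
  exact isIso_of_mono_of_epi f

lemma hom_zero (hA : WF A) {S T : RepC k Q} (hS : SimpleIn A S) (hT : SimpleIn A T)
    (h : ¬ Nonempty (S ≅ T)) : hom S T = 0 := by
  rw [hom_eq_zero_iff (hA.fd _ hS.1) (hA.fd _ hT.1)]
  intro f
  by_contra hf
  have := iso_of_ne hA hS hT f hf
  exact h ⟨asIso f⟩

lemma id_ne {S : RepC k Q} (hS : SimpleIn A S) : 𝟙 S ≠ 0 := fun h0 =>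
  hS.2.1 ((IsZero.iff_id_eq_zero S).2 h0)

lemma hom_one [IsAlgClosed k] (hA : WF A) {S : RepC k Q} (hS : SimpleIn A S) : hom S S = 1 := by
  have := fd_hom (hA.fd _ hS.1) (hA.fd _ hS.1)
  apply finrank_endomorphism_eq_one k
  intro f
  constructor
  · intro hf h0
    subst h0
    apply hS.id_ne
    rw [← IsIso.hom_inv_id (0 : S ⟶ S), zero_comp]
  · exact iso_of_ne hA hS hS f

end SimpleIn

lemma WF.exists_simple {A : Set (RepC k Q)} (hA : WF A) {X : RepC k Q} (hX : X ∈ A)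
    (h0 : ¬ IsZero X) : ∃ (S : RepC k Q) (i : S ⟶ X), SimpleIn A S ∧ Mono i := by
  classical
  have hex : ∃ n : ℕ, ∃ (S : RepC k Q) (i : S ⟶ X), S ∈ A ∧ ¬ IsZero S ∧ Mono i ∧ tdim S = n :=
    ⟨_, X, 𝟙 X, hX, h0, inferInstance, rfl⟩
  obtain ⟨S, i, hS, hS0, hi, hn⟩ := Nat.find_spec hex
  refine ⟨S, i, ⟨hS, hS0, fun Y hY j hj => ?_⟩, hi⟩
  by_contra hc
  push Not at hc
  have hlt : tdim Y < tdim S := by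
    by_contra hle
    exact hc.2 (isIso_of_mono_tdim j (hA.fd _ hS) (by omega))
  rw [hn] at hlt
  exact Nat.find_min hex hlt ⟨Y, j ≫ i, hY, hc.1, mono_comp _ _, rfl⟩

theorem WF.induct {A : Set (RepC k Q)} (hA : WF A) (P : RepC k Q → Prop)
    (zero : ∀ X, IsZero X → P X)
    (step : ∀ (S X Y : RepC k Q) (i : S ⟶ X) (p : X ⟶ Y), SimpleIn A S → X ∈ A → Y ∈ A →
      Ses i p → P Y → P X) : ∀ X ∈ A, P X := by
  have : ∀ n : ℕ, ∀ X ∈ A, tdim X = n → P X := by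
    intro n
    induction n using Nat.strong_induction_on with
    | _ n ih =>
      intro X hX hn
      by_cases h0 : IsZero X
      · exact zero X h0
      obtain ⟨S, i, hS, hi⟩ := hA.exists_simple hX h0
      have hs := ses_of_mono i
      have hC := hA.wide.coker_mem _ hS.1 _ hX i
      have hd := hs.tdim (hA.fd _ hX)
      have hp := tdim_pos (hA.fd _ hS.1) hS.2.1
      exact step S X _ i _ hS hX hC hs (ih _ (by omega) _ hC rfl)
  exact fun X hX => this _ X hX rfl

def Gens (U : RepC k Q) (A : Set (RepC k Q)) : Prop :=
  ∀ Y ∈ A, ∀ (Z : RepC k Q) (h : Y ⟶ Z), (∀ f : U ⟶ Y, f ≫ h = 0) → h = 0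

lemma fg_iff {A : Set (RepC k Q)} (hA : WF A) : IsFinGen A ↔ ∃ U ∈ A, Gens U A := by
  constructor
  · rintro ⟨U, hU, hg⟩
    refine ⟨U, hU, fun Y hY Z h hz => ?_⟩
    obtain ⟨X, ⟨n, f, hf, i, r, hir⟩, p, hp⟩ := hg hY
    rw [← cancel_epi p, comp_zero]
    have h1 : r ≫ p ≫ h = 0 := by
      apply biproduct.hom_ext'
      intro j
      have hj : f j = U := hf j
      have : ∀ (V : RepC k Q) (_ : V = U) (g : V ⟶ Y), g ≫ h = 0 := by
        rintro V rfl g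
        exact hz g
      have := this _ hj (biproduct.ι f j ≫ r ≫ p)
      simpa using this
    calc p ≫ h = i ≫ (r ≫ p ≫ h) := by rw [← Category.assoc, hir, Category.id_comp]
      _ = 0 := by rw [h1, comp_zero]
  · rintro ⟨U, hU, hg⟩
    refine ⟨U, hU, fun Y hY => ?_⟩
    have := fd_hom (hA.fd _ hU) (hA.fd _ hY)
    let b := Module.finBasis k (U ⟶ Y)
    refine ⟨⨁ (fun _ : Fin (Module.finrank k (U ⟶ Y)) => U),
      ⟨_, _, fun _ => rfl, 𝟙 _, 𝟙 _, by simp⟩, biproduct.desc (fun j => b j), ?_⟩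
    apply Preadditive.epi_of_cancel_zero
    intro Z h hz
    apply hg Y hY
    intro f
    have h1 : ∀ j, b j ≫ h = 0 := by
      intro j
      have := congrArg (fun t => biproduct.ι _ j ≫ t) hz
      simpa using this
    have h2 : Linear.rightComp k U h = 0 := b.ext (fun j => h1 j)
    exact congrArg (fun t => t f) h2

section fg
variable {A : Set (RepC k Q)} {U : RepC k Q}

lemma simples_bound_aux (hA : WF A) (hU : U ∈ A) (hg : Gens U A) (Ts : List (RepC k Q))
    (hT : ∀ T ∈ Ts, SimpleIn A T) (hp : Ts.Pairwise (fun X Y => ¬ Nonempty (X ≅ Y))) :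
    ∃ K ∈ A, ∃ i : K ⟶ U, Mono i ∧ tdim K + Ts.length ≤ tdim U ∧
      ∀ T, SimpleIn A T → (∀ T' ∈ Ts, ¬ Nonempty (T' ≅ T)) → ∀ f : U ⟶ T, i ≫ f = 0 → f = 0 := by
  induction Ts with
  | nil => exact ⟨U, hU, 𝟙 U, inferInstance, by simp, fun T _ _ f h => by simpa using h⟩
  | cons T0 Ts ih =>
    rw [List.pairwise_cons] at hp
    obtain ⟨K, hK, i, hi, hd, hf⟩ := ih (fun T h => hT T (by simp [h])) hp.2
    have hT0 := hT T0 (by simp)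
    obtain ⟨f0, hf0⟩ : ∃ f : U ⟶ T0, f ≠ 0 := by
      by_contra hc
      push Not at hc
      exact hT0.id_ne (hg T0 hT0.1 _ (𝟙 T0) (fun f => by simp [hc f]))
    have h1 : i ≫ f0 ≠ 0 := fun h => hf0 (hf T0 hT0 (fun T' h' ⟨e⟩ => hp.1 T' h' ⟨e.symm⟩) f0 h)
    have := SimpleIn.epi_of_ne hA hT0 hK _ h1
    have hs := ses_of_epi (i ≫ f0)
    have hd2 := hs.tdim (hA.fd _ hK)
    have hpos := tdim_pos (hA.fd _ hT0.1) hT0.2.1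
    refine ⟨_, hA.left hs hK hT0.1, kernel.ι (i ≫ f0) ≫ i, mono_comp _ _, by
      simp only [List.length_cons]; omega, ?_⟩
    intro T hTs hni f h0
    rw [Category.assoc] at h0
    obtain ⟨g, hg'⟩ := hs.exists_desc (i ≫ f) h0
    have := (hom_eq_zero_iff (hA.fd _ hT0.1) (hA.fd _ hTs.1)).1
      (SimpleIn.hom_zero hA hT0 hTs (hni T0 (by simp))) g
    rw [this, comp_zero] at hg'
    exact hf T hTs (fun T' h' => hni T' (by simp [h'])) f hg'.symm

lemma exists_simple_list (hA : WF A) (hU : U ∈ A) (hg : Gens U A) :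
    ∃ Ts : List (RepC k Q), (∀ T ∈ Ts, SimpleIn A T) ∧
      Ts.Pairwise (fun X Y => ¬ Nonempty (X ≅ Y)) ∧
      ∀ X, SimpleIn A X → ∃ T ∈ Ts, Nonempty (X ≅ T) := by
  classical
  let P : ℕ → Prop := fun n => ∃ Ts : List (RepC k Q), (∀ T ∈ Ts, SimpleIn A T) ∧
      Ts.Pairwise (fun X Y => ¬ Nonempty (X ≅ Y)) ∧ Ts.length = n
  have hb : ∀ n, P n → n ≤ tdim U := by
    rintro n ⟨Ts, h1, h2, rfl⟩
    obtain ⟨K, _, _, _, hd, _⟩ := simples_bound_aux hA hU hg Ts h1 h2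
    omega
  have h0 : P 0 := ⟨[], by simp, by simp, rfl⟩
  obtain ⟨Ts, h1, h2, h3⟩ := Nat.findGreatest_spec (P := P) (Nat.zero_le (tdim U)) h0
  refine ⟨Ts, h1, h2, fun X hX => ?_⟩
  by_contra hc
  push Not at hc
  have hP : P (Nat.findGreatest P (tdim U) + 1) := by
    refine ⟨X :: Ts, ?_, ?_, by simp [h3]⟩
    · simp only [List.mem_cons]; rintro T (rfl | h)
      · exact hX
      · exact h1 T h
    · rw [List.pairwise_cons]
      exact ⟨fun T hT => not_nonempty_iff.2 (hc T hT), h2⟩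
  have := Nat.le_findGreatest (hb _ hP) hP
  omega

lemma chain_step (hA : WF A) {T' X : RepC k Q} (hT' : SimpleIn A T') (hX : X ∈ A)
    {Z : RepC k Q} (h : X ⟶ Z) (h0 : h ≠ 0)
    (hl : ∀ Y ∈ A, ∀ g : Y ⟶ X, ¬ Epi g → g ≫ h = 0) (he : ext X T' ≠ 0) :
    ∃ X' ∈ A, ∃ (Z' : RepC k Q) (h' : X' ⟶ Z'), h' ≠ 0 ∧
      (∀ Y ∈ A, ∀ g : Y ⟶ X', ¬ Epi g → g ≫ h' = 0) ∧ (∃ i : T' ⟶ X', Mono i) ∧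
      tdim X + 1 ≤ tdim X' := by
  obtain ⟨X', i, p, hs, hn⟩ := exists_nonsplit he
  have hX' := hA.mid hs hT'.1 hX
  have := hs.epi
  refine ⟨X', hX', Z, p ≫ h, fun hz => h0 ?_, ?_, ⟨i, hs.mono⟩, ?_⟩
  · rw [← cancel_epi p, hz, comp_zero]
  · intro Y hY g hg
    by_contra hne
    have hgp : Epi (g ≫ p) := by
      by_contra hne'
      exact hne (by rw [← Category.assoc]; exact hl Y hY _ hne')
    have hC := hA.wide.coker_mem _ hY _ hX' g
    have hepi : Epi (i ≫ cokernel.π g) := by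
      apply Preadditive.epi_of_cancel_zero
      intro W u hu
      rw [Category.assoc] at hu
      obtain ⟨u', hu'⟩ := hs.exists_desc _ hu
      have : (g ≫ p) ≫ u' = 0 := by
        rw [Category.assoc, hu', ← Category.assoc, cokernel.condition, zero_comp]
      have hu0 : u' = 0 := by rw [← cancel_epi (g ≫ p), this, comp_zero]
      rw [hu0, comp_zero] at hu'
      rw [← cancel_epi (cokernel.π g), ← hu', comp_zero]
    have hne2 : i ≫ cokernel.π g ≠ 0 := by
      intro hz
      apply hg
      apply Preadditive.epi_of_cokernel_zero
      have : ∀ W (u : cokernel g ⟶ W), u = 0 := fun W u => by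
        rw [← cancel_epi (i ≫ cokernel.π g), hz, zero_comp, zero_comp]
      rw [← Category.comp_id (cokernel.π g), this _ (𝟙 _), comp_zero]
    have := SimpleIn.mono_of_ne hA hT' hC _ hne2
    have hiso := isIso_of_mono_of_epi (i ≫ cokernel.π g)
    obtain ⟨s, hs'⟩ := hs.section_of_retraction (cokernel.π g ≫ inv (i ≫ cokernel.π g)) (by
      rw [← Category.assoc, IsIso.hom_inv_id])
    exact hn s hs'
  · have := hs.tdim (hA.fd _ hX')
    have := tdim_pos (hA.fd _ hT'.1) hT'.2.1
    omega

lemma no_chain (hA : WF A) (hU : U ∈ A) (hg : Gens U A) (T : ℕ → RepC k Q)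
    (hT : ∀ m, SimpleIn A (T m)) (he : ∀ m, ext (T m) (T (m + 1)) ≠ 0) : False := by
  have key : ∀ m, ∃ X ∈ A, ∃ (Z : RepC k Q) (h : X ⟶ Z), h ≠ 0 ∧
      (∀ Y ∈ A, ∀ g : Y ⟶ X, ¬ Epi g → g ≫ h = 0) ∧ (∃ i : T m ⟶ X, Mono i) ∧
      m + 1 ≤ tdim X := by
    intro m
    induction m with
    | zero =>
      refine ⟨T 0, (hT 0).1, T 0, 𝟙 _, (hT 0).id_ne, ?_, ⟨𝟙 _, inferInstance⟩,
        tdim_pos (hA.fd _ (hT 0).1) (hT 0).2.1⟩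
      intro Y hY g hne
      by_contra h0
      rw [Category.comp_id] at h0
      exact hne (SimpleIn.epi_of_ne hA (hT 0) hY g h0)
    | succ m ih =>
      obtain ⟨X, hX, Z, h, h0, hl, ⟨i, hi⟩, hd⟩ := ih
      have h1 := ext_le_of_mono i (hA.fd _ (hT (m + 1)).1) (hA.fd _ hX)
      have h2 := he m
      obtain ⟨X', hX', Z', h', h0', hl', hi', hd'⟩ := chain_step hA (hT (m + 1)) hX h h0 hl (by omega)
      exact ⟨X', hX', Z', h', h0', hl', hi', by omega⟩
  obtain ⟨X, hX, Z, h, h0, hl, _, hd⟩ := key (tdim U)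
  have : ∃ f : U ⟶ X, f ≫ h ≠ 0 := by
    by_contra hc
    push Not at hc
    exact h0 (hg X hX Z h hc)
  obtain ⟨f, hf⟩ := this
  have : Epi f := by
    by_contra hne
    exact hf (hl U hU f hne)
  have := (ses_of_epi f).tdim (hA.fd _ hU)
  omega

lemma exists_last (hA : WF A) (hU : U ∈ A) (hg : Gens U A) (Ts : List (RepC k Q))
    (hT : ∀ T ∈ Ts, SimpleIn A T) (hne : Ts ≠ []) :
    ∃ T ∈ Ts, ∀ T' ∈ Ts, ext T T' = 0 := by
  by_contra hc
  push Not at hc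
  choose! f hf using hc
  obtain ⟨T0, hT0⟩ := List.exists_mem_of_ne_nil Ts hne
  have hm : ∀ m, (f^[m] T0) ∈ Ts := by
    intro m
    induction m with
    | zero => exact hT0
    | succ m ih => rw [Function.iterate_succ_apply']; exact (hf _ ih).1
  exact no_chain hA hU hg (fun m => f^[m] T0) (fun m => hT _ (hm m)) (fun m => by
    rw [Function.iterate_succ_apply']; exact (hf _ (hm m)).2)

end fg

def ExcList (l : List (RepC k Q)) : Prop :=
  (∀ M ∈ l, Exc M) ∧ l.Pairwise (fun X Y => hom Y X = 0 ∧ ext Y X = 0)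

lemma exists_sorted [IsAlgClosed k] {A : Set (RepC k Q)} {U : RepC k Q} (hA : WF A) (hU : U ∈ A)
    (hg : Gens U A) (n : ℕ) : ∀ (Ts : List (RepC k Q)), Ts.length = n →
    (∀ T ∈ Ts, SimpleIn A T) → (Ts.Pairwise (fun X Y => ¬ Nonempty (X ≅ Y))) →
    ∃ Ts', Ts'.Perm Ts ∧ ExcList Ts' := by
  induction n with
  | zero =>
    intro Ts h _ _
    rw [List.length_eq_zero_iff] at h
    subst h
    exact ⟨[], List.Perm.refl _, by simp [ExcList]⟩
  | succ n ih =>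
    intro Ts h hT hp
    obtain ⟨T, hTm, hlast⟩ := exists_last hA hU hg Ts hT (by rintro rfl; simp at h)
    obtain ⟨l1, l2, rfl⟩ := List.append_of_mem hTm
    have hperm : (l1 ++ T :: l2).Perm (T :: (l1 ++ l2)) := List.perm_middle
    have hp' : (T :: (l1 ++ l2)).Pairwise (fun X Y => ¬ Nonempty (X ≅ Y)) :=
      hperm.pairwise hp (fun {X Y} h ⟨e⟩ => h ⟨e.symm⟩)
    rw [List.pairwise_cons] at hp'
    obtain ⟨Ts', hperm', hexc⟩ := ih (l1 ++ l2) (by simp at h ⊢; omega)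
      (fun S hS => hT S (by simp at hS ⊢; tauto)) hp'.2
    have hmem : ∀ S ∈ Ts', S ∈ l1 ++ l2 := fun S hS => hperm'.mem_iff.1 hS
    have hTs := hT T hTm
    refine ⟨Ts' ++ [T], ?_, ?_, ?_⟩
    · exact (List.perm_append_singleton T Ts').trans ((hperm'.cons T).trans hperm.symm)
    · intro M hM
      rw [List.mem_append, List.mem_singleton] at hM
      rcases hM with hM | rfl
      · exact hexc.1 M hM
      · exact ⟨hA.fd _ hTs.1, SimpleIn.hom_one hA hTs, hlast _ hTm⟩
    · rw [List.pairwise_append]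
      refine ⟨hexc.2, by simp, ?_⟩
      intro S hS T' hT'
      rw [List.mem_singleton] at hT'
      subst hT'
      have hS' := hmem S hS
      have hS'' : S ∈ l1 ++ T' :: l2 := by simp at hS' ⊢; tauto
      exact ⟨SimpleIn.hom_zero hA hTs (hT S hS'') (hp'.1 S hS'), hlast S hS''⟩

theorem exists_excList [IsAlgClosed k] {A : Set (RepC k Q)} (hA : WF A) (hfg : IsFinGen A) :
    ∃ l : List (RepC k Q), (∀ S ∈ l, SimpleIn A S) ∧ ExcList l ∧
      ∀ X, SimpleIn A X → ∃ S ∈ l, Nonempty (X ≅ S) := by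
  obtain ⟨U, hU, hg⟩ := (fg_iff hA).1 hfg
  obtain ⟨Ts, h1, h2, h3⟩ := exists_simple_list hA hU hg
  obtain ⟨Ts', hperm, hexc⟩ := exists_sorted hA hU hg _ Ts rfl h1 h2
  exact ⟨Ts', fun S hS => h1 S (hperm.mem_iff.1 hS), hexc, fun X hX => by
    obtain ⟨T, hT, e⟩ := h3 X hX
    exact ⟨T, hperm.mem_iff.2 hT, e⟩⟩

lemma hom_le_of_mono {A B : RepC k Q} (i : A ⟶ B) [Mono i] {M : RepC k Q} (hM : FinDim M)
    (hB : FinDim B) : hom M A ≤ hom M B := ((ses_of_mono i).les_cov hM hB).2.1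

lemma hom_le_of_epi {A B : RepC k Q} (p : A ⟶ B) [Epi p] {M : RepC k Q} (hM : FinDim M)
    (hA : FinDim A) : hom B M ≤ hom A M := ((ses_of_epi p).les_con hM hA).2.1

/-- two out of three property -/
structure TwoThree (B : Set (RepC k Q)) (P : RepC k Q → Prop) : Prop where
  left : ∀ {X Y Z : RepC k Q} {i : X ⟶ Y} {p : Y ⟶ Z}, Ses i p → X ∈ B → Y ∈ B → Z ∈ B →
    P Y → P Z → P X
  mid : ∀ {X Y Z : RepC k Q} {i : X ⟶ Y} {p : Y ⟶ Z}, Ses i p → X ∈ B → Y ∈ B → Z ∈ B →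
    P X → P Z → P Y
  right : ∀ {X Y Z : RepC k Q} {i : X ⟶ Y} {p : Y ⟶ Z}, Ses i p → X ∈ B → Y ∈ B → Z ∈ B →
    P X → P Y → P Z

lemma WF.sub {B : Set (RepC k Q)} (hB : WF B) (P : RepC k Q → Prop) (h23 : TwoThree B P)
    (h0 : ∀ X, IsZero X → P X)
    (him : ∀ (X I Y : RepC k Q) (e : X ⟶ I) (m : I ⟶ Y), Epi e → Mono m → X ∈ B → I ∈ B → Y ∈ B →
      P X → P Y → P I) : WF {X | X ∈ B ∧ P X} where
  fd X hX := hB.fd X hX.1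
  wide :=
    { zero_mem := ⟨hB.wide.zero_mem, h0 _ (isZero_zero _)⟩
      sum_mem := fun X hX Y hY =>
        ⟨hB.wide.sum_mem X hX.1 Y hY.1, h23.mid (ses_biprod X Y) hX.1
          (hB.wide.sum_mem X hX.1 Y hY.1) hY.1 hX.2 hY.2⟩
      summand_mem := by
        rintro X hX Y ⟨i, r, h⟩
        have hY := hB.wide.summand_mem X hX.1 Y ⟨i, r, h⟩
        have : IsSplitMono i := ⟨⟨⟨r, h⟩⟩⟩
        have : IsSplitEpi r := ⟨⟨⟨i, h⟩⟩⟩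
        exact ⟨hY, him X Y X r i inferInstance inferInstance hX.1 hY hX.1 hX.2 hX.2⟩
      ker_mem := fun X hX Y hY f => by
        have hI := imFac f
        have hk := hB.wide.ker_mem X hX.1 Y hY.1 f
        have hIm := hB.im hX.1 hY.1 f
        have hPI := him _ _ _ _ _ hI.epi hI.mono hX.1 hIm hY.1 hX.2 hY.2
        exact ⟨hk, h23.left hI.ses1 hk hX.1 hIm hX.2 hPI⟩
      coker_mem := fun X hX Y hY f => by
        have hI := imFac f
        have hk := hB.wide.coker_mem X hX.1 Y hY.1 f
        have hIm := hB.im hX.1 hY.1 f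
        have hPI := him _ _ _ _ _ hI.epi hI.mono hX.1 hIm hY.1 hX.2 hY.2
        exact ⟨hk, h23.right hI.ses2 hIm hY.1 hk hPI hY.2⟩
      ext_mem := fun S hS h1 h3 => by
        have hm := hB.wide.ext_mem S hS h1.1 h3.1
        have hs : Ses S.f S.g := ⟨S.zero, hS⟩
        exact ⟨hm, h23.mid hs h1.1 hm h3.1 h1.2 h3.2⟩ }

def rperp (M : RepC k Q) (B : Set (RepC k Q)) : Set (RepC k Q) :=
  {X | X ∈ B ∧ (hom M X = 0 ∧ ext M X = 0)}
def lperp (M : RepC k Q) (B : Set (RepC k Q)) : Set (RepC k Q) :=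
  {X | X ∈ B ∧ (hom X M = 0 ∧ ext X M = 0)}

lemma rperp_wf {B : Set (RepC k Q)} (hB : WF B) {M : RepC k Q} (hM : FinDim M) : WF (rperp M B) := by
  refine WF.sub hB (fun X => hom M X = 0 ∧ ext M X = 0) ⟨?_, ?_, ?_⟩ ?_ ?_
  · intro X Y Z i p hs hX hY hZ h1 h2
    have := hs.les_cov hM (hB.fd _ hY); omega
  · intro X Y Z i p hs hX hY hZ h1 h2
    have := hs.les_cov hM (hB.fd _ hY); omega
  · intro X Y Z i p hs hX hY hZ h1 h2
    have := hs.les_cov hM (hB.fd _ hY); omega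
  · intro X hX
    exact ⟨hom_zero_of_isZero (Or.inr hX),
      ext_zero_of_isZero hM (hB.fd _ (hB.zero hX)) (Or.inr hX)⟩
  · intro X I Y e m he hm hX hI hY h1 h2
    have := hom_le_of_mono m hM (hB.fd _ hY)
    have := ext_le_of_epi e hM (hB.fd _ hX)
    omega

lemma lperp_wf {B : Set (RepC k Q)} (hB : WF B) {M : RepC k Q} (hM : FinDim M) : WF (lperp M B) := by
  refine WF.sub hB (fun X => hom X M = 0 ∧ ext X M = 0) ⟨?_, ?_, ?_⟩ ?_ ?_
  · intro X Y Z i p hs hX hY hZ h1 h2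
    have := hs.les_con hM (hB.fd _ hY); omega
  · intro X Y Z i p hs hX hY hZ h1 h2
    have := hs.les_con hM (hB.fd _ hY); omega
  · intro X Y Z i p hs hX hY hZ h1 h2
    have := hs.les_con hM (hB.fd _ hY); omega
  · intro X hX
    exact ⟨hom_zero_of_isZero (Or.inl hX),
      ext_zero_of_isZero (hB.fd _ (hB.zero hX)) hM (Or.inl hX)⟩
  · intro X I Y e m he hm hX hI hY h1 h2
    have := hom_le_of_epi e hM (hB.fd _ hX)
    have := ext_le_of_mono m hM (hB.fd _ hY)
    omega

section rmain
variable {B : Set (RepC k Q)} {M : RepC k Q} {P : RepC k Q → Prop}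

lemma rperp_build (hB : WF B) (hM : Exc M) (hMB : M ∈ B) (h23 : TwoThree B P) (hPM : P M)
    (hP : ∀ Y ∈ rperp M B, P Y) {X : RepC k Q} (l : List (M ⟶ X)) :
    ∃ (N : RepC k Q) (g : N ⟶ X), N ∈ B ∧ P N ∧ ext M N = 0 ∧ hom M N = l.length ∧
      (∀ f ∈ l, ∃ h, h ≫ g = f) ∧ ∀ Y ∈ rperp M B, hom N Y = 0 := by
  induction l with
  | nil =>
    have hz := (rperp_wf hB hM.fd).wide.zero_mem
    exact ⟨0, 0, hz.1, hP _ hz, hz.2.2, hz.2.1, by simp, fun Y _ =>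
      hom_zero_of_isZero (Or.inl (isZero_zero _))⟩
  | cons f l ih =>
    obtain ⟨N, g, hN, hPN, he, hh, hf, hY⟩ := ih
    have hs := ses_biprod N M
    have hm := hB.mid hs hN hMB
    refine ⟨N ⊞ M, biprod.desc g f, hm, h23.mid hs hN hm hMB hPN hPM, ?_, ?_, ?_, ?_⟩
    · have := hs.les_cov hM.fd (hB.fd _ hm)
      have := hM.ext0
      omega
    · have := hs.les_cov hM.fd (hB.fd _ hm)
      have := hM.ext0
      have := hM.hom1
      simp only [List.length_cons]
      omega
    · intro f' hf'
      rw [List.mem_cons] at hf'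
      rcases hf' with rfl | hf'
      · exact ⟨biprod.inr, by simp⟩
      · obtain ⟨h, hh⟩ := hf f' hf'
        exact ⟨h ≫ biprod.inl, by simp [hh]⟩
    · intro Y hY'
      have := hs.les_con (hB.fd _ hY'.1) (hB.fd _ hm)
      have := hY Y hY'
      have := hY'.2
      omega

lemma rperp_main (hB : WF B) (hM : Exc M) (hMB : M ∈ B) (h23 : TwoThree B P) (hPM : P M)
    (hP : ∀ Y ∈ rperp M B, P Y) (n : ℕ) : ∀ X ∈ B, ext M X = n → (P X ∧ 
      ∃ X' ∈ rperp M B, ∃ η : X ⟶ X', ∀ Y ∈ rperp M B, ∀ u : X ⟶ Y, ∃ u', η ≫ u' = u) := by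
  induction n with
  | zero =>
    intro X hX hext
    have hfdX := hB.fd _ hX
    have := fd_hom hM.fd hfdX
    let b := Module.finBasis k (M ⟶ X)
    obtain ⟨N, g, hN, hPN, he, hh, hf, hYN⟩ := rperp_build hB hM hMB h23 hPM hP (List.ofFn b)
    have hfdN := hB.fd _ hN
    have := fd_hom hM.fd hfdN
    rw [List.length_ofFn] at hh
    have hsurj : Function.Surjective (Linear.rightComp k M g) := by
      rw [← LinearMap.range_eq_top, ← top_le_iff, ← b.span_eq, Submodule.span_le]
      rintro _ ⟨j, rfl⟩
      obtain ⟨h, hh⟩ := hf (b j) (by simp [List.mem_ofFn])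
      exact ⟨h, hh⟩
    have hinj : Function.Injective (Linear.rightComp k M g) :=
      (LinearMap.injective_iff_surjective_of_finrank_eq_finrank hh).2 hsurj
    have hI := imFac g
    have hK := hB.wide.ker_mem _ hN _ hX g
    have hC := hB.wide.coker_mem _ hN _ hX g
    have hIm := hB.im hN hX g
    have := hI.epi
    have := hI.mono
    have e1 : hom M (kernel g) = 0 := by
      rw [hom_eq_zero_iff hM.fd (hB.fd _ hK)]
      intro f
      have : f ≫ kernel.ι g = 0 := hinj (by
        change (f ≫ kernel.ι g) ≫ g = Linear.rightComp k M g 0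
        rw [Category.assoc, kernel.condition, comp_zero, map_zero])
      rw [← cancel_mono (kernel.ι g), this, zero_comp]
    have s1 := hI.ses1.les_cov hM.fd hfdN
    have s2 := hI.ses2.les_cov hM.fd hfdX
    change hom M N = hom M X at hh
    have mK : kernel g ∈ rperp M B := ⟨hK, by omega, by omega⟩
    have mC : cokernel g ∈ rperp M B := ⟨hC, by omega, by omega⟩
    refine ⟨?_, cokernel g, mC, cokernel.π g, fun Y hY u => ?_⟩
    · have := h23.right hI.ses1 hK hN hIm (hP _ mK) hPN
      exact h23.mid hI.ses2 hIm hX hC this (hP _ mC)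
    · have := (hom_eq_zero_iff hfdN (hB.fd _ hY.1)).1 (hYN Y hY) (g ≫ u)
      exact ⟨cokernel.desc g u this, by simp⟩
  | succ n ih =>
    intro X hX hext
    obtain ⟨X1, i, p, hs, hn⟩ := exists_nonsplit (A := M) (B := X) (by omega)
    have hX1 := hB.mid hs hX hMB
    have r := hs.rank_cov hM.fd (hB.fd _ hX1)
    have hr : LinearMap.range (Linear.rightComp k M p) = ⊥ := by
      rw [LinearMap.range_eq_bot]
      ext1 f
      by_contra hf
      have := hM.isIso_of_ne (f ≫ p) hf
      exact hn (inv (f ≫ p) ≫ f) (by rw [Category.assoc, IsIso.inv_hom_id])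
    rw [hr, finrank_bot] at r
    have s := hs.les_cov hM.fd (hB.fd _ hX1)
    have e0 := hM.ext0
    have e1 := hM.hom1
    obtain ⟨hP1, X', hX', η, hη⟩ := ih X1 hX1 (by omega)
    refine ⟨h23.left hs hX hX1 hMB hP1 hPM, X', hX', i ≫ η, fun Y hY u => ?_⟩
    obtain ⟨u1, hu1⟩ := hs.desc_of_ext (hB.fd _ hY.1) (hB.fd _ hX1) hY.2.2 u
    obtain ⟨u', hu'⟩ := hη Y hY u1
    exact ⟨u', by rw [Category.assoc, hu', hu1]⟩

lemma rperp_P (hB : WF B) (hM : Exc M) (hMB : M ∈ B) (h23 : TwoThree B P) (hPM : P M)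
    (hP : ∀ Y ∈ rperp M B, P Y) : ∀ X ∈ B, P X :=
  fun X hX => (rperp_main hB hM hMB h23 hPM hP _ X hX rfl).1

lemma rperp_fg (hB : WF B) (hM : Exc M) (hMB : M ∈ B) (hfg : IsFinGen B) :
    IsFinGen (rperp M B) := by
  rw [fg_iff (rperp_wf hB hM.fd)]
  obtain ⟨U, hU, hg⟩ := (fg_iff hB).1 hfg
  obtain ⟨-, X', hX', η, hη⟩ := rperp_main (P := fun _ => True) hB hM hMB
    ⟨fun _ _ _ _ _ _ => trivial, fun _ _ _ _ _ _ => trivial, fun _ _ _ _ _ _ => trivial⟩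
    trivial (fun _ _ => trivial) _ U hU rfl
  refine ⟨X', hX', fun Y hY Z h hz => hg Y hY.1 Z h fun f => ?_⟩
  obtain ⟨u', rfl⟩ := hη Y hY f
  rw [Category.assoc, hz, comp_zero]

lemma lperp_build (hB : WF B) (hM : Exc M) (hMB : M ∈ B) (h23 : TwoThree B P) (hPM : P M)
    (hP : ∀ Y ∈ lperp M B, P Y) {X : RepC k Q} (l : List (X ⟶ M)) :
    ∃ (N : RepC k Q) (g : X ⟶ N), N ∈ B ∧ P N ∧ ext N M = 0 ∧ hom N M = l.length ∧
      (∀ f ∈ l, ∃ h, g ≫ h = f) := by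
  induction l with
  | nil =>
    have hz := (lperp_wf hB hM.fd).wide.zero_mem
    exact ⟨0, 0, hz.1, hP _ hz, hz.2.2, hz.2.1, by simp⟩
  | cons f l ih =>
    obtain ⟨N, g, hN, hPN, he, hh, hf⟩ := ih
    have hs := ses_biprod N M
    have hm := hB.mid hs hN hMB
    refine ⟨N ⊞ M, biprod.lift g f, hm, h23.mid hs hN hm hMB hPN hPM, ?_, ?_, ?_⟩
    · have := hs.les_con hM.fd (hB.fd _ hm)
      have := hM.ext0
      omega
    · have := hs.les_con hM.fd (hB.fd _ hm)
      have := hM.ext0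
      have := hM.hom1
      simp only [List.length_cons]
      omega
    · intro f' hf'
      rw [List.mem_cons] at hf'
      rcases hf' with rfl | hf'
      · exact ⟨biprod.snd, by simp⟩
      · obtain ⟨h, hh⟩ := hf f' hf'
        exact ⟨biprod.fst ≫ h, by simp [hh]⟩

lemma lperp_main (hB : WF B) (hM : Exc M) (hMB : M ∈ B) (h23 : TwoThree B P) (hPM : P M)
    (hP : ∀ Y ∈ lperp M B, P Y) (n : ℕ) : ∀ X ∈ B, ext X M = n → P X := by
  induction n with
  | zero =>
    intro X hX hext
    have hfdX := hB.fd _ hX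
    have := fd_hom hfdX hM.fd
    let b := Module.finBasis k (X ⟶ M)
    obtain ⟨N, g, hN, hPN, he, hh, hf⟩ := lperp_build hB hM hMB h23 hPM hP (List.ofFn b)
    have hfdN := hB.fd _ hN
    have := fd_hom hfdN hM.fd
    rw [List.length_ofFn] at hh
    have hsurj : Function.Surjective (Linear.leftComp k M g) := by
      rw [← LinearMap.range_eq_top, ← top_le_iff, ← b.span_eq, Submodule.span_le]
      rintro _ ⟨j, rfl⟩
      obtain ⟨h, hh⟩ := hf (b j) (by simp [List.mem_ofFn])
      exact ⟨h, hh⟩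
    have hinj : Function.Injective (Linear.leftComp k M g) :=
      (LinearMap.injective_iff_surjective_of_finrank_eq_finrank hh).2 hsurj
    have hI := imFac g
    have hK := hB.wide.ker_mem _ hX _ hN g
    have hC := hB.wide.coker_mem _ hX _ hN g
    have hIm := hB.im hX hN g
    have := hI.epi
    have := hI.mono
    have e1 : hom (cokernel g) M = 0 := by
      rw [hom_eq_zero_iff (hB.fd _ hC) hM.fd]
      intro f
      have : cokernel.π g ≫ f = 0 := hinj (by
        change g ≫ (cokernel.π g ≫ f) = Linear.leftComp k M g 0
        rw [← Category.assoc, cokernel.condition, zero_comp, map_zero])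
      rw [← cancel_epi (cokernel.π g), this, comp_zero]
    have s1 := hI.ses1.les_con hM.fd hfdX
    have s2 := hI.ses2.les_con hM.fd hfdN
    change hom N M = hom X M at hh
    have mK : kernel g ∈ lperp M B := ⟨hK, by omega, by omega⟩
    have mC : cokernel g ∈ lperp M B := ⟨hC, by omega, by omega⟩
    have := h23.left hI.ses2 hIm hN hC hPN (hP _ mC)
    exact h23.mid hI.ses1 hK hX hIm (hP _ mK) this
  | succ n ih =>
    intro X hX hext
    obtain ⟨X1, i, p, hs, hn⟩ := exists_nonsplit (A := X) (B := M) (by omega)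
    have hX1 := hB.mid hs hMB hX
    have r := hs.rank_con hM.fd (hB.fd _ hX1)
    have hr : LinearMap.range (Linear.leftComp k M i) = ⊥ := by
      rw [LinearMap.range_eq_bot]
      ext1 f
      by_contra hf
      have := hM.isIso_of_ne (i ≫ f) hf
      obtain ⟨s, hs'⟩ := hs.section_of_retraction (f ≫ inv (i ≫ f)) (by
        rw [← Category.assoc, IsIso.hom_inv_id])
      exact hn s hs'
    rw [hr, finrank_bot] at r
    have s := hs.les_con hM.fd (hB.fd _ hX1)
    have e0 := hM.ext0
    have e1 := hM.hom1
    have hP1 := ih X1 hX1 (by omega)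
    exact h23.right hs hMB hX1 hX hPM hP1

lemma lperp_P (hB : WF B) (hM : Exc M) (hMB : M ∈ B) (h23 : TwoThree B P) (hPM : P M)
    (hP : ∀ Y ∈ lperp M B, P Y) : ∀ X ∈ B, P X :=
  fun X hX => lperp_main hB hM hMB h23 hPM hP _ X hX rfl

end rmain

/-- span of classes -/
def cls (B : Set (RepC k Q)) : Submodule ℤ (Q.V → ℤ) := Submodule.span ℤ (dimVec '' B)

lemma mem_cls {B : Set (RepC k Q)} {X : RepC k Q} (h : X ∈ B) : dimVec X ∈ cls B :=
  Submodule.subset_span ⟨X, h, rfl⟩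

lemma twoThree_cls {B : Set (RepC k Q)} (hB : WF B) (L : Submodule ℤ (Q.V → ℤ)) :
    TwoThree B (fun X => dimVec X ∈ L) where
  left := fun {X Y Z i p} hs _ hY _ h1 h2 => by
    have := hs.dim (hB.fd _ hY)
    have e : dimVec X = dimVec Y - dimVec Z := by rw [this]; abel
    change dimVec X ∈ L
    rw [e]; exact L.sub_mem h1 h2
  mid := fun {X Y Z i p} hs _ hY _ h1 h2 => by
    rw [hs.dim (hB.fd _ hY)]; exact L.add_mem h1 h2
  right := fun {X Y Z i p} hs _ hY _ h1 h2 => by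
    have := hs.dim (hB.fd _ hY)
    have e : dimVec Z = dimVec Y - dimVec X := by rw [this]; abel
    change dimVec Z ∈ L
    rw [e]; exact L.sub_mem h2 h1

lemma cls_rperp_le {B : Set (RepC k Q)} (hB : WF B) {M : RepC k Q} (hM : Exc M) (hMB : M ∈ B)
    {x : Q.V → ℤ} (hx : x ∈ cls B) : ∃ y ∈ cls (rperp M B), ∃ c : ℤ, x = y + c • dimVec M := by
  have h1 : cls B ≤ cls (rperp M B) ⊔ Submodule.span ℤ {dimVec M} := by
    rw [cls, Submodule.span_le]
    rintro _ ⟨X, hX, rfl⟩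
    refine rperp_P (P := fun X => dimVec X ∈ cls (rperp M B) ⊔ Submodule.span ℤ {dimVec M})
      hB hM hMB (twoThree_cls hB _) ?_ ?_ X hX
    · exact Submodule.mem_sup_right (Submodule.mem_span_singleton_self _)
    · exact fun Y hY => Submodule.mem_sup_left (mem_cls hY)
  obtain ⟨y, hy, z, hz, rfl⟩ := Submodule.mem_sup.1 (h1 hx)
  obtain ⟨c, rfl⟩ := Submodule.mem_span_singleton.1 hz
  exact ⟨y, hy, c, rfl⟩

lemma cls_lperp_le {B : Set (RepC k Q)} (hB : WF B) {M : RepC k Q} (hM : Exc M) (hMB : M ∈ B)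
    {x : Q.V → ℤ} (hx : x ∈ cls B) : ∃ y ∈ cls (lperp M B), ∃ c : ℤ, x = y + c • dimVec M := by
  have h1 : cls B ≤ cls (lperp M B) ⊔ Submodule.span ℤ {dimVec M} := by
    rw [cls, Submodule.span_le]
    rintro _ ⟨X, hX, rfl⟩
    refine lperp_P (P := fun X => dimVec X ∈ cls (lperp M B) ⊔ Submodule.span ℤ {dimVec M})
      hB hM hMB (twoThree_cls hB _) ?_ ?_ X hX
    · exact Submodule.mem_sup_right (Submodule.mem_span_singleton_self _)
    · exact fun Y hY => Submodule.mem_sup_left (mem_cls hY)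
  obtain ⟨y, hy, z, hz, rfl⟩ := Submodule.mem_sup.1 (h1 hx)
  obtain ⟨c, rfl⟩ := Submodule.mem_span_singleton.1 hz
  exact ⟨y, hy, c, rfl⟩

/-- the Euler form with fixed left argument -/
def eL (Q : FinQuiver) (x : Q.V → ℤ) : (Q.V → ℤ) →ₗ[ℤ] ℤ where
  toFun y := euler Q x y
  map_add' := euler_add_right x
  map_smul' c y := euler_smul_right c x y

def eR (Q : FinQuiver) (x : Q.V → ℤ) : (Q.V → ℤ) →ₗ[ℤ] ℤ where
  toFun y := euler Q y x
  map_add' := fun a b => euler_add_left a b x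
  map_smul' c y := euler_smul_left c y x

lemma mem_cls_rperp {B : Set (RepC k Q)} (hB : WF B) {M : RepC k Q} (hM : Exc M) (hMB : M ∈ B)
    {x : Q.V → ℤ} : x ∈ cls (rperp M B) ↔ x ∈ cls B ∧ euler Q (dimVec M) x = 0 := by
  have h0 : ∀ y ∈ cls (rperp M B), euler Q (dimVec M) y = 0 := by
    have : cls (rperp M B) ≤ LinearMap.ker (eL Q (dimVec M)) := by
      rw [cls, Submodule.span_le]
      rintro _ ⟨X, hX, rfl⟩
      have := hom_sub_ext hM.fd (hB.fd _ hX.1)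
      rw [hX.2.1, hX.2.2] at this
      exact this.symm
    exact fun y hy => this hy
  constructor
  · intro hx
    exact ⟨Submodule.span_mono (Set.image_mono (fun X hX => hX.1)) hx, h0 x hx⟩
  · rintro ⟨hx, he⟩
    obtain ⟨y, hy, c, rfl⟩ := cls_rperp_le hB hM hMB hx
    rw [euler_add_right, h0 y hy, euler_smul_right, hM.q] at he
    have : c = 0 := by linarith
    subst this
    simpa using hy

lemma mem_cls_lperp {B : Set (RepC k Q)} (hB : WF B) {M : RepC k Q} (hM : Exc M) (hMB : M ∈ B)
    {x : Q.V → ℤ} : x ∈ cls (lperp M B) ↔ x ∈ cls B ∧ euler Q x (dimVec M) = 0 := by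
  have h0 : ∀ y ∈ cls (lperp M B), euler Q y (dimVec M) = 0 := by
    have : cls (lperp M B) ≤ LinearMap.ker (eR Q (dimVec M)) := by
      rw [cls, Submodule.span_le]
      rintro _ ⟨X, hX, rfl⟩
      have := hom_sub_ext (hB.fd _ hX.1) hM.fd
      rw [hX.2.1, hX.2.2] at this
      exact this.symm
    exact fun y hy => this hy
  constructor
  · intro hx
    exact ⟨Submodule.span_mono (Set.image_mono (fun X hX => hX.1)) hx, h0 x hx⟩
  · rintro ⟨hx, he⟩
    obtain ⟨y, hy, c, rfl⟩ := cls_lperp_le hB hM hMB hx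
    rw [euler_add_left, h0 y hy, euler_smul_left, hM.q] at he
    have : c = 0 := by linarith
    subst this
    simpa using hy

def Nondeg (L : Submodule ℤ (Q.V → ℤ)) : Prop :=
  ∀ x ∈ L, (∀ y ∈ L, euler Q x y = 0) → x = 0

lemma finrank_drop {L L' : Submodule ℤ (Q.V → ℤ)} (φ : (Q.V → ℤ) →ₗ[ℤ] ℤ) {m : Q.V → ℤ}
    (hm : m ∈ L) (h1 : φ m = 1) (hL : ∀ x, x ∈ L' ↔ x ∈ L ∧ φ x = 0) :
    Module.finrank ℤ L = Module.finrank ℤ L' + 1 := by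
  have hr : LinearMap.range (φ.domRestrict L) = ⊤ := by
    rw [LinearMap.range_eq_top]
    intro c
    refine ⟨c • ⟨m, hm⟩, ?_⟩
    rw [map_smul]
    change c • φ m = c
    rw [h1]; simp
  have hk : LinearMap.ker (φ.domRestrict L) = L'.comap L.subtype := by
    ext x
    rw [LinearMap.mem_ker, Submodule.mem_comap, hL]
    exact ⟨fun h => ⟨x.2, h⟩, fun h => h.2⟩
  have hle : L' ≤ L := fun x hx => ((hL x).1 hx).1
  have := (LinearMap.ker (φ.domRestrict L)).finrank_quotient_add_finrank
  rw [(φ.domRestrict L).quotKerEquivRange.finrank_eq, hr, hk, finrank_top, Module.finrank_self,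
    (Submodule.comapSubtypeEquivOfLe hle).finrank_eq] at this
  omega

section step
variable {B : Set (RepC k Q)} {M : RepC k Q}

lemma finrank_rperp (hB : WF B) (hM : Exc M) (hMB : M ∈ B) :
    Module.finrank ℤ (cls B) = Module.finrank ℤ (cls (rperp M B)) + 1 :=
  finrank_drop (eL Q (dimVec M)) (mem_cls hMB) hM.q (fun _ => mem_cls_rperp hB hM hMB)

lemma finrank_lperp (hB : WF B) (hM : Exc M) (hMB : M ∈ B) :
    Module.finrank ℤ (cls B) = Module.finrank ℤ (cls (lperp M B)) + 1 :=
  finrank_drop (eR Q (dimVec M)) (mem_cls hMB) hM.q (fun _ => mem_cls_lperp hB hM hMB)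

lemma nondeg_rperp (hB : WF B) (hM : Exc M) (hMB : M ∈ B) (h : Nondeg (cls B)) :
    Nondeg (cls (rperp M B)) := by
  intro x hx h0
  have hx' := (mem_cls_rperp hB hM hMB).1 hx
  have key : x - euler Q x (dimVec M) • dimVec M = 0 := by
    apply h _ ((cls B).sub_mem hx'.1 ((cls B).smul_mem _ (mem_cls hMB)))
    intro y hy
    obtain ⟨y', hy', c, rfl⟩ := cls_rperp_le hB hM hMB hy
    have e2 := ((mem_cls_rperp hB hM hMB).1 hy').2
    rw [euler_sub_left, euler_smul_left, euler_add_right, euler_add_right, h0 y' hy', e2,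
      euler_smul_right, euler_smul_right, hM.q]
    ring
  have e := congrArg (euler Q (dimVec M)) key
  rw [euler_sub_right, euler_smul_right, hM.q, hx'.2, euler_zero_right] at e
  have e' : euler Q x (dimVec M) = 0 := by linarith
  rw [e'] at key
  simpa using key

lemma nondeg_lperp (hB : WF B) (hM : Exc M) (hMB : M ∈ B) (h : Nondeg (cls B)) :
    Nondeg (cls (lperp M B)) := by
  intro x hx h0
  have hx' := (mem_cls_lperp hB hM hMB).1 hx
  apply h x hx'.1
  intro y hy
  obtain ⟨y', hy', c, rfl⟩ := cls_lperp_le hB hM hMB hy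
  rw [euler_add_right, h0 y' hy', euler_smul_right, hx'.2]
  ring

end step

def rp : List (RepC k Q) → Set (RepC k Q) → Set (RepC k Q)
  | [], B => B
  | M :: s, B => rperp M (rp s B)

def lp : List (RepC k Q) → Set (RepC k Q) → Set (RepC k Q)
  | [], B => B
  | M :: s, B => lp s (lperp M B)

lemma mem_rp {s : List (RepC k Q)} {B : Set (RepC k Q)} {X : RepC k Q} :
    X ∈ rp s B ↔ X ∈ B ∧ ∀ M ∈ s, hom M X = 0 ∧ ext M X = 0 := by
  induction s with
  | nil => simp [rp]
  | cons M s ih =>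
    rw [rp]
    change (X ∈ rp s B ∧ _) ↔ _
    rw [ih]
    simp only [List.mem_cons, forall_eq_or_imp]
    tauto

lemma mem_lp {s : List (RepC k Q)} {B : Set (RepC k Q)} {X : RepC k Q} :
    X ∈ lp s B ↔ X ∈ B ∧ ∀ M ∈ s, hom X M = 0 ∧ ext X M = 0 := by
  induction s generalizing B with
  | nil => simp [lp]
  | cons M s ih =>
    rw [lp, ih]
    simp only [List.mem_cons, forall_eq_or_imp]
    change ((X ∈ B ∧ _) ∧ _) ↔ _
    tauto

lemma ExcList.tail {M : RepC k Q} {s : List (RepC k Q)} (h : ExcList (M :: s)) : ExcList s :=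
  ⟨fun N hN => h.1 N (by simp [hN]), (List.pairwise_cons.1 h.2).2⟩

lemma ExcList.head {M : RepC k Q} {s : List (RepC k Q)} (h : ExcList (M :: s)) : Exc M :=
  h.1 M (by simp)

lemma ExcList.head_mem_rp {M : RepC k Q} {s : List (RepC k Q)} (h : ExcList (M :: s))
    {B : Set (RepC k Q)} (hB : M ∈ B) : M ∈ rp s B :=
  mem_rp.2 ⟨hB, (List.pairwise_cons.1 h.2).1⟩

structure RP (B : Set (RepC k Q)) (s : List (RepC k Q)) (B' : Set (RepC k Q)) : Prop where
  wf : WF B'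
  rank : Module.finrank ℤ (cls B) = Module.finrank ℤ (cls B') + s.length
  nondeg : Nondeg (cls B) → Nondeg (cls B')

lemma rp_RP {B : Set (RepC k Q)} (hB : WF B) {s : List (RepC k Q)} (hs : ExcList s)
    (hsB : ∀ M ∈ s, M ∈ B) : RP B s (rp s B) ∧ (IsFinGen B → IsFinGen (rp s B)) ∧
      (∀ x, x ∈ cls (rp s B) ↔ x ∈ cls B ∧ ∀ M ∈ s, euler Q (dimVec M) x = 0) ∧
      (∀ P : RepC k Q → Prop, TwoThree B P → (∀ M ∈ s, P M) → (∀ X ∈ rp s B, P X) → ∀ X ∈ B, P X) := by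
  induction s with
  | nil => exact ⟨⟨hB, rfl, id⟩, id, by simp [rp], fun P _ _ h => h⟩
  | cons M s ih =>
    obtain ⟨h1, h2, h3, h4⟩ := ih hs.tail (fun N hN => hsB N (by simp [hN]))
    have hMB := hsB M (by simp)
    have hM := hs.head_mem_rp hMB
    refine ⟨⟨rperp_wf h1.wf hs.head.fd, ?_, fun h => nondeg_rperp h1.wf hs.head hM (h1.nondeg h)⟩,
      fun h => rperp_fg h1.wf hs.head hM (h2 h), ?_, ?_⟩
    · rw [h1.rank, finrank_rperp h1.wf hs.head hM, List.length_cons, rp]; ring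
    · intro x
      rw [rp, mem_cls_rperp h1.wf hs.head hM, h3]
      simp only [List.mem_cons, forall_eq_or_imp]
      tauto
    · intro P hP hPM hPX
      apply h4 P hP (fun N hN => hPM N (by simp [hN]))
      apply rperp_P h1.wf hs.head hM _ (hPM M (by simp)) hPX
      have sub : ∀ X ∈ rp s B, X ∈ B := fun X hX => (mem_rp.1 hX).1
      exact ⟨fun hs a b c => hP.left hs (sub _ a) (sub _ b) (sub _ c),
        fun hs a b c => hP.mid hs (sub _ a) (sub _ b) (sub _ c),
        fun hs a b c => hP.right hs (sub _ a) (sub _ b) (sub _ c)⟩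

lemma lp_RP {s : List (RepC k Q)} (hs : ExcList s) : ∀ {B : Set (RepC k Q)} (_ : WF B)
    (_ : ∀ M ∈ s, M ∈ B), RP B s (lp s B) ∧
      (∀ x, x ∈ cls (lp s B) ↔ x ∈ cls B ∧ ∀ M ∈ s, euler Q x (dimVec M) = 0) := by
  induction s with
  | nil => exact fun {B} hB _ => ⟨⟨hB, rfl, id⟩, by simp [lp]⟩
  | cons M s ih =>
    intro B hB hsB
    have hMB := hsB M (by simp)
    have hM := hs.head
    have hB' := lperp_wf hB hM.fd
    obtain ⟨h1, h3⟩ := ih hs.tail hB' (fun N hN => ⟨hsB N (by simp [hN]),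
      (List.pairwise_cons.1 hs.2).1 N hN⟩)
    refine ⟨⟨h1.wf, ?_, fun h => h1.nondeg (nondeg_lperp hB hM hMB h)⟩, ?_⟩
    · rw [finrank_lperp hB hM hMB, h1.rank, List.length_cons, lp]; ring
    · intro x
      rw [lp, h3, mem_cls_lperp hB hM hMB]
      simp only [List.mem_cons, forall_eq_or_imp]
      tauto

lemma finrank_zero_eq {L : Submodule ℤ (Q.V → ℤ)} (h : Module.finrank ℤ L = 0) : L = ⊥ := by
  rw [Submodule.finrank_eq_zero] at h
  exact h

lemma rank_one [IsAlgClosed k] (hpsd : ∀ x : Q.V → ℤ, 0 ≤ euler Q x x) {D : Set (RepC k Q)} (hD : WF D)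
    (hn : Nondeg (cls D)) (h1 : Module.finrank ℤ (cls D) = 1) :
    ∃ Z ∈ D, Exc Z ∧ ∀ x ∈ cls D, ∃ c : ℤ, x = c • dimVec Z := by
  have hex : ∃ X ∈ D, ¬ IsZero X := by
    by_contra hc
    push Not at hc
    have : cls D = ⊥ := by
      rw [eq_bot_iff, cls, Submodule.span_le]
      rintro _ ⟨X, hX, rfl⟩
      exact dimVec_zero (hc X hX)
    rw [this, finrank_bot] at h1
    omega
  obtain ⟨X, hX, h0⟩ := hex
  obtain ⟨Z, i, hZ, _⟩ := hD.exists_simple hX h0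
  have hfd := hD.fd _ hZ.1
  have e := hom_sub_ext hfd hfd
  rw [SimpleIn.hom_one hD hZ] at e
  have hq := hpsd (dimVec Z)
  have hz0 : dimVec Z ≠ 0 := fun h => by
    apply hZ.2.1
    apply isZero_of_tdim hfd
    zify
    rw [tdim_eq, h]; simp
  have hne : euler Q (dimVec Z) (dimVec Z) ≠ 0 := by
    intro hq0
    apply hz0
    apply hn _ (mem_cls hZ.1)
    intro y hy
    have hz' : (⟨dimVec Z, mem_cls hZ.1⟩ : cls D) ≠ 0 := fun h => hz0 (congrArg Subtype.val h)
    have hnotli : ¬ LinearIndependent ℤ ![(⟨dimVec Z, mem_cls hZ.1⟩ : cls D), ⟨y, hy⟩] := by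
      intro hli
      have := hli.fintype_card_le_finrank
      rw [h1] at this
      simp at this
    rw [LinearIndependent.pair_iff] at hnotli
    push Not at hnotli
    obtain ⟨s, t, hst, hne⟩ := hnotli
    have hst' : s • dimVec Z + t • y = 0 := congrArg Subtype.val hst
    have ht : t ≠ 0 := by
      rintro rfl
      have hs : s ≠ 0 := fun h => hne h rfl
      rw [zero_smul, add_zero, smul_eq_zero] at hst'
      tauto
    have := congrArg (euler Q (dimVec Z)) hst'
    rw [euler_add_right, euler_smul_right, euler_smul_right, hq0, euler_zero_right, mul_zero,
      zero_add] at this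
    exact (mul_eq_zero.1 this).resolve_left ht
  have hE : Exc Z := ⟨hfd, SimpleIn.hom_one hD hZ, by push_cast at e; omega⟩
  refine ⟨Z, hZ.1, hE, fun x hx => ?_⟩
  obtain ⟨y, hy, c, rfl⟩ := cls_rperp_le hD hE hZ.1 hx
  have := finrank_rperp hD hE hZ.1
  have h2 : cls (rperp Z D) = ⊥ := finrank_zero_eq (by omega)
  rw [h2, Submodule.mem_bot] at hy
  exact ⟨c, by rw [hy, zero_add]⟩

def allF (k : Type) [Field k] (Q : FinQuiver) : Set (RepC k Q) := {X | FinDim X}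

lemma allF_wf : WF (allF k Q) where
  fd X hX := hX
  wide :=
    { zero_mem := fun v => by
        have : Subsingleton (ob (0 : RepC k Q) v) := by
          constructor
          intro x y
          have hx : ∀ x : ob (0 : RepC k Q) v, x = 0 := fun x =>
            congrArg (fun f => cm f v x) ((isZero_zero (RepC k Q)).eq_of_src (𝟙 0) 0)
          rw [hx x, hx y]
        infer_instance
      sum_mem := fun X hX Y hY => (ses_biprod X Y).fd_mid hX hY
      summand_mem := by
        rintro X hX Y ⟨i, r, h⟩
        have : IsSplitMono i := ⟨⟨⟨r, h⟩⟩⟩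
        exact fd_of_mono i hX
      ker_mem := fun X hX Y hY f => fd_of_mono (kernel.ι f) hX
      coker_mem := fun X hX Y hY f => fd_of_epi (cokernel.π f) hY
      ext_mem := fun S hS h1 h3 => (⟨S.zero, hS⟩ : Ses S.f S.g).fd_mid h1 h3 }

/-! simple modules, projective generator -/
def smpQ (k : Type) [Field k] {Q : FinQuiver} (v : Q.V) : Q.V ⥤q ModuleCat.{0} k where
  obj w := ModuleCat.of k (PLift (w = v) → k)
  map _ := 0

def smp (k : Type) [Field k] {Q : FinQuiver} (v : Q.V) : RepC k Q := Paths.lift (smpQ k v)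

lemma mp_smp (v : Q.V) {x y : Q.V} (a : x ⟶ y) : mp (smp k v) a = 0 :=
  congrArg ModuleCat.Hom.hom (Paths.lift_toPath (smpQ k v) a)

lemma smp_fd (v : Q.V) : FinDim (smp k v) := fun w =>
  inferInstanceAs (FiniteDimensional k (PLift (w = v) → k))

open scoped Classical in
lemma dimVec_smp (v : Q.V) : dimVec (smp k v) = simRoot Q v := by
  funext w
  have h : Module.finrank k (ob (smp k v) w) = Fintype.card (PLift (w = v)) :=
    Module.finrank_fintype_fun_eq_card k (η := PLift (w = v))
  rw [dimVec, h, simRoot]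
  split_ifs with h
  · subst h
    simp
  · simp only [Nat.cast_eq_zero, Fintype.card_eq_zero_iff]
    exact ⟨fun t => h t.down⟩

lemma hom_smp (v w : Q.V) : (hom (smp k v) (smp k w) : ℤ) = ∑ u, simRoot Q v u * simRoot Q w u := by
  have := Fact.mk (smp_fd (k := k) v)
  have := Fact.mk (smp_fd (k := k) w)
  have h0 : Phi (smp k v) (smp k w) = 0 := by
    apply LinearMap.ext
    intro f
    funext a
    change f a.2.1 ∘ₗ mp (smp k v) a.2.2 - mp (smp k w) a.2.2 ∘ₗ f a.1 = 0
    rw [mp_smp, mp_smp, LinearMap.comp_zero, LinearMap.zero_comp, sub_zero]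
  have h3 : hom (smp k v) (smp k w) = Module.finrank k (LinearMap.ker (Phi (smp k v) (smp k w))) :=
    (homEquiv _ _).finrank_eq
  rw [h3, h0, LinearMap.ker_zero, finrank_top, Module.finrank_pi_fintype]
  rw [← dimVec_smp (k := k), ← dimVec_smp (k := k)]
  simp [Module.finrank_linearMap, dimVec]

lemma ext_smp (v w : Q.V) : (ext (smp k v) (smp k w) : ℤ) =
    ∑ a : Arr Q, simRoot Q v a.1 * simRoot Q w a.2.1 := by
  have h := hom_sub_ext (smp_fd (k := k) v) (smp_fd (k := k) w)
  rw [hom_smp, dimVec_smp, dimVec_smp, euler] at h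
  linarith

section ordd
variable {ord : Fin (Fintype.card Q.V) ≃ Q.V}

lemma ext_smp_zero (hord : OrdCompatible Q ord) {v w : Q.V} (h : ord.symm w ≤ ord.symm v) :
    ext (smp k v) (smp k w) = 0 := by
  have := ext_smp (k := k) v w
  rw [Finset.sum_eq_zero] at this
  · exact_mod_cast this
  · rintro ⟨x, y, a⟩ -
    simp only [simRoot]
    split_ifs with h1 h2 <;> try simp
    subst h1 h2
    exact absurd (hord _ _ a) (not_lt.2 h)

lemma smp_exc (hord : OrdCompatible Q ord) (v : Q.V) : Exc (smp k v) := by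
  refine ⟨smp_fd v, ?_, ext_smp_zero hord le_rfl⟩
  have := hom_smp (k := k) v v
  classical
  simp [simRoot] at this
  exact_mod_cast this

def smps (k : Type) [Field k] {Q : FinQuiver} (ord : Fin (Fintype.card Q.V) ≃ Q.V) :
    List (RepC k Q) := List.ofFn fun i => smp k (ord i)

lemma smps_exc (hord : OrdCompatible Q ord) : ExcList (smps k ord) := by
  constructor
  · intro M hM
    obtain ⟨i, rfl⟩ := (List.mem_ofFn' _ _).1 hM
    exact smp_exc hord _
  · rw [smps, List.pairwise_ofFn]
    intro i j hij
    refine ⟨?_, ext_smp_zero hord (by simpa using hij.le)⟩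
    have := hom_smp (k := k) (ord j) (ord i)
    rw [Finset.sum_eq_zero] at this
    swap
    · intro u _
      simp only [simRoot]
      split_ifs with h1 h2 <;> try simp
      exact hij.ne' (ord.injective (h1.symm.trans h2))
    exact_mod_cast this

lemma path_finite (hord : OrdCompatible Q ord) (v : Q.V) : ∀ (m : ℕ) (w : Q.V),
    (ord.symm w : ℕ) = m → Finite (Quiver.Path v w) := by
  intro m
  induction m using Nat.strong_induction_on with
  | _ m ih =>
    intro w hw
    have : ∀ a : (Σ x : Q.V, x ⟶ w), Finite (Quiver.Path v a.1) := fun a =>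
      ih _ (by rw [← hw]; exact hord _ _ a.2) a.1 rfl
    let f : (Option (Σ a : (Σ x : Q.V, x ⟶ w), Quiver.Path v a.1)) → Set (Quiver.Path v w)
      | none => {p | ∃ h : v = w, p = h ▸ Quiver.Path.nil}
      | some t => {t.2.cons t.1.2}
    have hf : ∀ t, (f t).Finite := by
      rintro (_ | t)
      · apply Set.Subsingleton.finite
        rintro p ⟨h, rfl⟩ q ⟨h', rfl⟩
        rfl
      · exact Set.finite_singleton _
    have hu : (⋃ t, f t) = Set.univ := by
      rw [Set.eq_univ_iff_forall]
      intro p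
      rw [Set.mem_iUnion]
      cases p with
      | nil => exact ⟨none, rfl, rfl⟩
      | cons p a => exact ⟨some ⟨⟨_, a⟩, p⟩, rfl⟩
    rw [← Set.finite_univ_iff, ← hu]
    exact Set.finite_iUnion hf

end ordd

def prjQ (k : Type) [Field k] (Q : FinQuiver) : Q.V ⥤q ModuleCat.{0} k where
  obj w := ModuleCat.of k ((Σ v : Q.V, Quiver.Path v w) →₀ k)
  map a := ModuleCat.ofHom (Finsupp.lmapDomain k k fun p => ⟨p.1, p.2.cons a⟩)

def prj (k : Type) [Field k] (Q : FinQuiver) : RepC k Q := Paths.lift (prjQ k Q)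

lemma mp_prj {x y : Q.V} (a : x ⟶ y) : mp (prj k Q) a =
    (Finsupp.lmapDomain k k fun p => ⟨p.1, p.2.cons a⟩ :
      ((Σ v : Q.V, Quiver.Path v x) →₀ k) →ₗ[k] ((Σ v : Q.V, Quiver.Path v y) →₀ k)) :=
  congrArg ModuleCat.Hom.hom (Paths.lift_toPath (prjQ k Q) a)

abbrev mpp (M : RepC k Q) {x y : Q.V} (p : Quiver.Path x y) : ob M x →ₗ[k] ob M y :=
  (M.map (X := (Paths.of Q.V).obj x) (Y := (Paths.of Q.V).obj y) p).hom

lemma mpp_cons (M : RepC k Q) {x y z : Q.V} (p : Quiver.Path x y) (a : y ⟶ z) :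
    mpp M (p.cons a) = mp M a ∘ₗ mpp M p :=
  congrArg ModuleCat.Hom.hom (M.map_comp (X := (Paths.of Q.V).obj x) p ((Paths.of Q.V).map a))

lemma mpp_nil (M : RepC k Q) (x : Q.V) : mpp M (Quiver.Path.nil : Quiver.Path x x) = LinearMap.id :=
  congrArg ModuleCat.Hom.hom (M.map_id ((Paths.of Q.V).obj x))

def prjMap (M : RepC k Q) (x : ∀ v : Q.V, ob M v) (w : Q.V) :
    ((Σ v : Q.V, Quiver.Path v w) →₀ k) →ₗ[k] ob M w :=
  Finsupp.linearCombination k (fun p : (Σ v : Q.V, Quiver.Path v w) => mpp M p.2 (x p.1))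

lemma prjMap_single (M : RepC k Q) (x : ∀ v : Q.V, ob M v) {v w : Q.V} (p : Quiver.Path v w) (c : k) :
    prjMap M x w (Finsupp.single ⟨v, p⟩ c) = c • mpp M p (x v) :=
  Finsupp.linearCombination_single k c _

lemma prjMap_nat (M : RepC k Q) (x : ∀ v : Q.V, ob M v) {w y : Q.V} (a : w ⟶ y) :
    prjMap M x y ∘ₗ (Finsupp.lmapDomain k k fun p : (Σ v : Q.V, Quiver.Path v w) =>
    (⟨p.1, p.2.cons a⟩ : (Σ v : Q.V, Quiver.Path v y))) = mp M a ∘ₗ prjMap M x w := by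
  apply Finsupp.lhom_ext
  rintro ⟨v, p⟩ c
  rw [LinearMap.comp_apply, LinearMap.comp_apply, Finsupp.lmapDomain_apply, Finsupp.mapDomain_single,
    prjMap_single, prjMap_single, mpp_cons, map_smul]
  rfl

def prjHom (M : RepC k Q) (x : ∀ v : Q.V, ob M v) : prj k Q ⟶ M :=
  toHom (fun w => prjMap M x w) (by
  intro w y a
  rw [mp_prj]
  exact prjMap_nat M x a)

lemma allF_fg {ord : Fin (Fintype.card Q.V) ≃ Q.V} (hord : OrdCompatible Q ord) : IsFinGen (allF k Q) := by
  rw [fg_iff allF_wf]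
  refine ⟨prj k Q, fun w => ?_, ?_⟩
  · have : ∀ v, Finite (Quiver.Path v w) := fun v => path_finite hord v _ w rfl
    exact inferInstanceAs (FiniteDimensional k ((Σ v : Q.V, Quiver.Path v w) →₀ k))
  · intro Y hY Z h hz
    apply cm_ext
    intro v
    apply LinearMap.ext
    intro y
    classical
    have h1 := congrArg (fun t => cm t v (Finsupp.single (⟨v, Quiver.Path.nil⟩ : (Σ u : Q.V, Quiver.Path u v)) (1 : k)))
      (hz (prjHom Y (Pi.single v y)))
    have h2 : prjMap Y (Pi.single v y) v (Finsupp.single (⟨v, Quiver.Path.nil⟩ : (Σ u : Q.V, Quiver.Path u v)) (1 : k)) = y := by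
      rw [prjMap_single, one_smul, mpp_nil]
      simp
    exact (congrArg (cm h v) h2).symm.trans h1

/-! lattice basics -/
abbrev spn (l : List (Q.V → ℤ)) : Submodule ℤ (Q.V → ℤ) := Submodule.span ℤ {x | x ∈ l}

lemma spn_cons_mem {b x : Q.V → ℤ} {l : List (Q.V → ℤ)} :
    x ∈ spn (b :: l) ↔ ∃ c : ℤ, ∃ y ∈ spn l, x = c • b + y := by
  have : {x | x ∈ b :: l} = insert b {x | x ∈ l} := by ext; simp
  rw [spn, this, Submodule.mem_span_insert]

lemma spn_mono {l l' : List (Q.V → ℤ)} (h : ∀ x ∈ l, x ∈ l') : spn l ≤ spn l' :=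
  Submodule.span_mono h

def EExc (Q : FinQuiver) (l : List (Q.V → ℤ)) : Prop :=
  (∀ b ∈ l, euler Q b b = 1) ∧ l.Pairwise (fun a b => euler Q b a = 0)

lemma EExc.cons_iff {b : Q.V → ℤ} {l : List (Q.V → ℤ)} : EExc Q (b :: l) ↔
    euler Q b b = 1 ∧ (∀ a ∈ l, euler Q a b = 0) ∧ EExc Q l := by
  simp only [EExc, List.mem_cons, forall_eq_or_imp, List.pairwise_cons]
  tauto

lemma euler_spn_left {b y : Q.V → ℤ} {l : List (Q.V → ℤ)} (h : ∀ a ∈ l, euler Q a b = 0)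
    (hy : y ∈ spn l) : euler Q y b = 0 := by
  induction hy using Submodule.span_induction with
  | mem x hx => exact h x hx
  | zero => exact euler_zero_left _
  | add x y _ _ hx hy => rw [euler_add_left, hx, hy, add_zero]
  | smul c x _ hx => rw [euler_smul_left, hx, mul_zero]

lemma EExc.nondeg {l : List (Q.V → ℤ)} (h : EExc Q l) : Nondeg (spn l) := by
  induction l with
  | nil =>
    intro x hx _
    simpa [spn] using hx
  | cons b l ih =>
    rw [EExc.cons_iff] at h
    intro x hx h0
    obtain ⟨c, y, hy, rfl⟩ := spn_cons_mem.1 hx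
    have h1 := h0 b (Submodule.subset_span (by simp))
    rw [euler_add_left, euler_smul_left, h.1, euler_spn_left h.2.1 hy] at h1
    have hc : c = 0 := by linarith
    subst hc
    rw [zero_smul, zero_add] at h0 ⊢
    exact ih h.2.2 y hy (fun z hz => h0 z (spn_mono (by simp +contextual) hz))

lemma EExc.finrank {l : List (Q.V → ℤ)} (h : EExc Q l) : Module.finrank ℤ (spn l) = l.length := by
  induction l with
  | nil => simp [spn]
  | cons b l ih =>
    rw [EExc.cons_iff] at h
    rw [finrank_drop (L' := spn l) (eR Q b) (m := b) (Submodule.subset_span (by simp)) h.1, ih h.2.2]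
    · simp
    · intro x
      constructor
      · intro hx
        exact ⟨spn_mono (by simp +contextual) hx, euler_spn_left h.2.1 hx⟩
      · rintro ⟨hx, h0⟩
        obtain ⟨c, y, hy, rfl⟩ := spn_cons_mem.1 hx
        change euler Q _ b = 0 at h0
        rw [euler_add_left, euler_smul_left, h.1, euler_spn_left h.2.1 hy] at h0
        have hc : c = 0 := by linarith
        subst hc
        rwa [zero_smul, zero_add]

lemma ExcList.eexc {l : List (RepC k Q)} (h : ExcList l) : EExc Q (l.map dimVec) := by
  constructor
  · intro b hb
    obtain ⟨M, hM, rfl⟩ := List.mem_map.1 hb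
    exact (h.1 M hM).q
  · rw [List.pairwise_map]
    refine h.2.imp_of_mem ?_
    intro X Y hX hY hXY
    have := hom_sub_ext (h.1 Y hY).fd (h.1 X hX).fd
    rw [hXY.1, hXY.2] at this
    simpa using this.symm

lemma sum_simRoot (x : Q.V → ℤ) : x = ∑ v, x v • simRoot Q v := by
  classical
  funext w
  simp [simRoot, Finset.sum_apply]

lemma simRoot_span : Submodule.span ℤ (Set.range (simRoot Q)) = ⊤ := by
  rw [eq_top_iff]
  intro x _
  rw [sum_simRoot x]
  exact Submodule.sum_mem _ (fun v _ => Submodule.smul_mem _ _ (Submodule.subset_span ⟨v, rfl⟩))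

def sroots (ord : Fin (Fintype.card Q.V) ≃ Q.V) : List (Q.V → ℤ) :=
  List.ofFn fun i => simRoot Q (ord i)

lemma map_smps (ord : Fin (Fintype.card Q.V) ≃ Q.V) : (smps k ord).map dimVec = sroots ord := by
  rw [smps, sroots, List.map_ofFn]
  congr 1
  funext i
  exact dimVec_smp _

lemma spn_sroots (ord : Fin (Fintype.card Q.V) ≃ Q.V) : spn (sroots ord) = ⊤ := by
  rw [eq_top_iff, ← simRoot_span, Submodule.span_le]
  rintro _ ⟨v, rfl⟩
  exact Submodule.subset_span ((List.mem_ofFn' _ _).2 ⟨ord.symm v, by simp⟩)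

lemma sroots_eexc {ord : Fin (Fintype.card Q.V) ≃ Q.V} (hord : OrdCompatible Q ord) :
    EExc Q (sroots ord) := by
  rw [← map_smps (k := ℚ)]
  exact (smps_exc hord).eexc

lemma nondeg_top {ord : Fin (Fintype.card Q.V) ≃ Q.V} (hord : OrdCompatible Q ord) :
    Nondeg (⊤ : Submodule ℤ (Q.V → ℤ)) := by
  rw [← spn_sroots ord]
  exact (sroots_eexc hord).nondeg

lemma cls_allF : cls (allF k Q) = ⊤ := by
  rw [eq_top_iff, ← simRoot_span, Submodule.span_le]
  rintro _ ⟨v, rfl⟩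
  rw [← dimVec_smp (k := k)]
  exact mem_cls (smp_fd v)

lemma finrank_allF : Module.finrank ℤ (cls (allF k Q)) = Fintype.card Q.V := by
  rw [cls_allF, finrank_top, Module.finrank_fintype_fun_eq_card]

lemma excList_append {p s : List (RepC k Q)} : ExcList (p ++ s) ↔ ExcList p ∧ ExcList s ∧
    ∀ X ∈ p, ∀ Y ∈ s, hom Y X = 0 ∧ ext Y X = 0 := by
  simp only [ExcList, List.mem_append, List.pairwise_append]
  constructor
  · rintro ⟨h1, h2, h3, h4⟩
    exact ⟨⟨fun M h => h1 M (Or.inl h), h2⟩, ⟨fun M h => h1 M (Or.inr h), h3⟩, h4⟩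
  · rintro ⟨⟨h1, h2⟩, ⟨h3, h4⟩, h5⟩
    exact ⟨fun M h => h.elim (h1 M) (h3 M), h2, h4, h5⟩

lemma exc_insert [IsAlgClosed k] {ord : Fin (Fintype.card Q.V) ≃ Q.V} (hord : OrdCompatible Q ord)
    (hpsd : ∀ x : Q.V → ℤ, 0 ≤ euler Q x x) {p s : List (RepC k Q)} (h : ExcList (p ++ s))
    (hn : p.length + s.length + 1 = Fintype.card Q.V) {v : Q.V → ℤ} (hq : euler Q v v = 1)
    (hs : ∀ M ∈ s, euler Q (dimVec M) v = 0) (hp : ∀ M ∈ p, euler Q v (dimVec M) = 0) :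
    ∃ Z, ExcList (p ++ Z :: s) ∧ (dimVec Z = v ∨ dimVec Z = -v) := by
  rw [excList_append] at h
  obtain ⟨hP, hS, hPS⟩ := h
  obtain ⟨r1, -, r3, -⟩ := rp_RP (allF_wf (k := k) (Q := Q)) hS (fun M hM => (hS.1 M hM).fd)
  obtain ⟨l1, l2⟩ := lp_RP hP r1.wf (fun M hM => mem_rp.2 ⟨(hP.1 M hM).fd, hPS M hM⟩)
  have hr := r1.rank
  rw [finrank_allF] at hr
  have hl := l1.rank
  obtain ⟨Z, hZ, hE, hc⟩ := rank_one hpsd l1.wf (l1.nondeg (r1.nondeg (by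
    rw [cls_allF]; exact nondeg_top hord))) (by omega)
  obtain ⟨hZ1, hZ2⟩ := mem_lp.1 hZ
  obtain ⟨hZ3, hZ4⟩ := mem_rp.1 hZ1
  refine ⟨Z, ?_, ?_⟩
  · rw [excList_append]
    refine ⟨hP, ⟨?_, ?_⟩, ?_⟩
    · simpa using ⟨hE, hS.1⟩
    · rw [List.pairwise_cons]; exact ⟨fun M hM => hZ4 M hM, hS.2⟩
    · intro X hX Y hY
      rcases List.mem_cons.1 hY with rfl | hY
      · exact hZ2 X hX
      · exact hPS X hX Y hY
  · obtain ⟨c, rfl⟩ := hc v ((l2 v).2 ⟨(r3 v).2 ⟨by rw [cls_allF]; trivial, hs⟩, hp⟩)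
    rw [euler_smul_left, euler_smul_right, hE.q, mul_one] at hq
    rcases mul_self_eq_one_iff.1 hq with rfl | rfl <;> simp

/-! symmetric form -/
lemma sy_comm (x y : Q.V → ℤ) : symEuler Q x y = symEuler Q y x := add_comm _ _

lemma sy_add_left (x y z : Q.V → ℤ) : symEuler Q (x + y) z = symEuler Q x z + symEuler Q y z := by
  simp only [symEuler, euler_add_left, euler_add_right]; ring
lemma sy_smul_left (c : ℤ) (x z : Q.V → ℤ) : symEuler Q (c • x) z = c * symEuler Q x z := by
  simp only [symEuler, euler_smul_left, euler_smul_right]; ring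
lemma sy_sub_left (x y z : Q.V → ℤ) : symEuler Q (x - y) z = symEuler Q x z - symEuler Q y z := by
  simp only [symEuler, euler_sub_left, euler_sub_right]; ring
lemma sy_neg_left (x z : Q.V → ℤ) : symEuler Q (-x) z = -symEuler Q x z := by
  simp only [symEuler, euler_neg_left, euler_neg_right]; ring
lemma sy_add_right (x y z : Q.V → ℤ) : symEuler Q z (x + y) = symEuler Q z x + symEuler Q z y := by
  simp only [symEuler, euler_add_left, euler_add_right]; ring
lemma sy_smul_right (c : ℤ) (x z : Q.V → ℤ) : symEuler Q z (c • x) = c * symEuler Q z x := by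
  simp only [symEuler, euler_smul_left, euler_smul_right]; ring
lemma sy_sub_right (x y z : Q.V → ℤ) : symEuler Q z (x - y) = symEuler Q z x - symEuler Q z y := by
  simp only [symEuler, euler_sub_left, euler_sub_right]; ring
lemma sy_neg_right (x z : Q.V → ℤ) : symEuler Q z (-x) = -symEuler Q z x := by
  simp only [symEuler, euler_neg_left, euler_neg_right]; ring
lemma sy_zero_left (z : Q.V → ℤ) : symEuler Q 0 z = 0 := by
  simp only [symEuler, euler_zero_left, euler_zero_right]; ring
lemma sy_self (x : Q.V → ℤ) : symEuler Q x x = 2 * euler Q x x := by rw [symEuler]; ring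

def syL (Q : FinQuiver) (x : Q.V → ℤ) : (Q.V → ℤ) →ₗ[ℤ] ℤ where
  toFun y := symEuler Q x y
  map_add' y z := sy_add_right y z x
  map_smul' c y := sy_smul_right c y x

lemma sy_sum (x y : Q.V → ℤ) : symEuler Q x y = ∑ v, y v * symEuler Q x (simRoot Q v) := by
  conv_lhs => rw [sum_simRoot y]
  change syL Q x _ = _
  rw [map_sum]
  simp only [map_smul]
  rfl

lemma q_add (x y : Q.V → ℤ) : euler Q (x + y) (x + y) = euler Q x x + euler Q y y + symEuler Q x y := by
  simp only [symEuler, euler_add_left, euler_add_right]; ring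
lemma q_sub (x y : Q.V → ℤ) : euler Q (x - y) (x - y) = euler Q x x + euler Q y y - symEuler Q x y := by
  simp only [symEuler, euler_sub_left, euler_sub_right]; ring
lemma q_smul (c : ℤ) (x : Q.V → ℤ) : euler Q (c • x) (c • x) = c * c * euler Q x x := by
  simp only [euler_smul_left, euler_smul_right]; ring
lemma q_neg (x : Q.V → ℤ) : euler Q (-x) (-x) = euler Q x x := by
  simp only [euler_neg_left, euler_neg_right]; ring

abbrev PSD (Q : FinQuiver) : Prop := ∀ x : Q.V → ℤ, 0 ≤ euler Q x x

lemma psd_of_type (h : FiniteType Q ∨ AffineType Q) : PSD Q := by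
  have h' : ∀ α : Q.V → ℚ, 0 ≤ symEuler Q α α := by
    rcases h with h | h
    · intro α
      by_cases h0 : α = 0
      · subst h0
        simp [symEuler, euler]
      · exact (h α h0).le
    · exact h.1
  intro x
  have h1 := h' (fun v => (x v : ℚ))
  have h2 : euler Q (fun v => (x v : ℚ)) (fun v => (x v : ℚ)) = ((euler Q x x : ℤ) : ℚ) := by
    simp [euler]
  rw [symEuler, h2] at h1
  have : (0 : ℚ) ≤ ((euler Q x x : ℤ) : ℚ) := by linarith
  exact_mod_cast this

lemma rad_of_q (hp : PSD Q) {x : Q.V → ℤ} (hx : euler Q x x = 0) (y : Q.V → ℤ) : symEuler Q x y = 0 := by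
  by_contra hne
  have key : ∀ m : ℤ, 0 ≤ m * symEuler Q x y + euler Q y y := by
    intro m
    have := hp (m • x + y)
    rw [q_add, q_smul, hx, sy_smul_left] at this
    linarith
  have hy := hp y
  have h1 := key (-(symEuler Q x y) * (euler Q y y + 1))
  have h2 : 0 < symEuler Q x y * symEuler Q x y := mul_self_pos.2 hne
  nlinarith

/-! components -/
abbrev Cmp (Q : FinQuiver) := Quot (fun x y : Q.V => Nonempty (x ⟶ y))
abbrev cl (v : Q.V) : Cmp Q := Quot.mk _ v

lemma cl_arr {x y : Q.V} (a : x ⟶ y) : cl x = cl y := Quot.sound ⟨a⟩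

lemma cl_ind (Z : Q.V → Prop) (h : ∀ x y : Q.V, (x ⟶ y) → (Z x ↔ Z y)) {v w : Q.V} (e : cl v = cl w)
    (hv : Z v) : Z w := by
  have := congrArg (Quot.lift Z (fun a b ⟨f⟩ => propext (h a b f))) e
  exact cast this hv

def Vc (c : Cmp Q) : Submodule ℤ (Q.V → ℤ) where
  carrier := {x | ∀ v, cl v ≠ c → x v = 0}
  add_mem' := fun ha hb v hv => by simp [ha v hv, hb v hv]
  zero_mem' := fun v _ => rfl
  smul_mem' := fun r x hx v hv => by simp [hx v hv]

lemma mem_Vc {c : Cmp Q} {x : Q.V → ℤ} : x ∈ Vc c ↔ ∀ v, cl v ≠ c → x v = 0 := Iff.rfl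

lemma euler_Vc {c c' : Cmp Q} (hc : c ≠ c') {x y : Q.V → ℤ} (hx : x ∈ Vc c) (hy : y ∈ Vc c') :
    euler Q x y = 0 := by
  have h : ∀ v w : Q.V, cl v = cl w → x v * y w = 0 := by
    intro v w e
    by_cases h1 : cl v = c
    · rw [hy w (by rw [← e, h1]; exact hc), mul_zero]
    · rw [hx v h1, zero_mul]
  rw [euler, Finset.sum_eq_zero (fun v _ => h v v rfl),
    Finset.sum_eq_zero (fun a _ => h a.1 a.2.1 (cl_arr a.2.2)), sub_zero]

lemma sy_Vc {c c' : Cmp Q} (hc : c ≠ c') {x y : Q.V → ℤ} (hx : x ∈ Vc c) (hy : y ∈ Vc c') :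
    symEuler Q x y = 0 := by
  rw [symEuler, euler_Vc hc hx hy, euler_Vc hc.symm hy hx, add_zero]

lemma simRoot_Vc (v : Q.V) : simRoot Q v ∈ Vc (cl v) := by
  intro w hw
  simp only [simRoot]
  split_ifs with h
  · subst h; exact absurd rfl hw
  · rfl

lemma simRoot_same (v : Q.V) : simRoot Q v v = 1 := by simp [simRoot]

lemma zero_adj (hp : PSD Q) {x : Q.V → ℤ} (hx : euler Q x x = 0) (h0 : ∀ v, 0 ≤ x v) {w : Q.V}
    (hw : x w = 0) : (∀ y, (w ⟶ y) → x y = 0) ∧ (∀ y, (y ⟶ w) → x y = 0) := by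
  classical
  have h1 := rad_of_q hp hx (simRoot Q w)
  have hs : ∀ v, 0 ≤ simRoot Q w v := fun v => by simp only [simRoot]; split_ifs <;> simp
  have e1 : ∑ v, x v * simRoot Q w v = 0 := by simp [simRoot, hw]
  have e2 : ∑ v, simRoot Q w v * x v = 0 := by simp [simRoot, hw]
  rw [symEuler, euler, euler, e1, e2] at h1
  have n1 : 0 ≤ ∑ a : Arr Q, x a.1 * simRoot Q w a.2.1 :=
    Finset.sum_nonneg (fun a _ => mul_nonneg (h0 _) (hs _))
  have n2 : 0 ≤ ∑ a : Arr Q, simRoot Q w a.1 * x a.2.1 :=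
    Finset.sum_nonneg (fun a _ => mul_nonneg (hs _) (h0 _))
  have z1 : ∑ a : Arr Q, x a.1 * simRoot Q w a.2.1 = 0 := by linarith
  have z2 : ∑ a : Arr Q, simRoot Q w a.1 * x a.2.1 = 0 := by linarith
  rw [Finset.sum_eq_zero_iff_of_nonneg (fun a _ => mul_nonneg (h0 _) (hs _))] at z1
  rw [Finset.sum_eq_zero_iff_of_nonneg (fun a _ => mul_nonneg (hs _) (h0 _))] at z2
  constructor
  · intro y a
    have := z2 ⟨w, y, a⟩ (Finset.mem_univ _)
    simpa [simRoot] using this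
  · intro y a
    have := z1 ⟨y, w, a⟩ (Finset.mem_univ _)
    simpa [simRoot] using this

lemma rad_zero_nonneg (hp : PSD Q) {c : Cmp Q} {x : Q.V → ℤ} (hc : x ∈ Vc c) (hx : euler Q x x = 0)
    (h0 : ∀ v, 0 ≤ x v) {w : Q.V} (hwc : cl w = c) (hw : x w = 0) : x = 0 := by
  funext v
  by_cases hv : cl v = c
  · refine cl_ind (fun v => x v = 0) ?_ (hwc.trans hv.symm) hw
    intro a b f
    exact ⟨fun h => (zero_adj hp hx h0 h).1 b f, fun h => (zero_adj hp hx h0 h).2 a f⟩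
  · exact hc v hv

lemma rad_zero (hp : PSD Q) {c : Cmp Q} {x : Q.V → ℤ} (hc : x ∈ Vc c) (hx : euler Q x x = 0)
    {w : Q.V} (hwc : cl w = c) (hw : x w = 0) : x = 0 := by
  have h1 : euler Q |x| |x| ≤ euler Q x x := by
    simp only [euler, Pi.abs_apply, abs_mul_abs_self]
    apply sub_le_sub_left
    apply Finset.sum_le_sum
    intro a _
    rw [← abs_mul]
    exact le_abs_self _
  have h2 := rad_zero_nonneg hp (x := |x|) (c := c) (fun v hv => by simp [hc v hv])
    (le_antisymm (hx ▸ h1) (hp _)) (fun v => abs_nonneg _) hwc (by simp [hw])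
  funext v
  exact abs_eq_zero.1 (congrFun h2 v)

/-- vectors of norm at most one in a component are sign-coherent -/
lemma coherent (hp : PSD Q) {c : Cmp Q} {x : Q.V → ℤ} (hc : x ∈ Vc c) (hx : euler Q x x ≤ 1) :
    (∀ v, 0 ≤ x v) ∨ (∀ v, x v ≤ 0) := by
  set a : Q.V → ℤ := fun v => max (x v) 0 with ha
  set b : Q.V → ℤ := fun v => max (-x v) 0 with hb
  have ha0 : ∀ v, 0 ≤ a v := fun v => le_max_right _ _
  have hb0 : ∀ v, 0 ≤ b v := fun v => le_max_right _ _
  have hab : ∀ v, a v * b v = 0 := by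
    intro v
    simp only [ha, hb]
    rcases le_total (x v) 0 with h | h
    · rw [max_eq_right h, zero_mul]
    · rw [max_eq_right (a := -x v) (by linarith), mul_zero]
  have hx' : x = a - b := by
    funext v
    simp only [ha, hb, Pi.sub_apply]
    rcases le_total (x v) 0 with h | h
    · rw [max_eq_right h, max_eq_left (by linarith)]; ring
    · rw [max_eq_left h, max_eq_right (by linarith)]; ring
  have hac : a ∈ Vc c := fun v hv => by simp [ha, hc v hv]
  have hbc : b ∈ Vc c := fun v hv => by simp [hb, hc v hv]
  have hsy : symEuler Q a b ≤ 0 := by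
    have h1 : ∑ v, a v * b v = 0 := Finset.sum_eq_zero (fun v _ => hab v)
    have h2 : ∑ v, b v * a v = 0 := Finset.sum_eq_zero (fun v _ => by rw [mul_comm, hab v])
    rw [symEuler, euler, euler, h1, h2]
    have n1 : 0 ≤ ∑ e : Arr Q, a e.1 * b e.2.1 :=
      Finset.sum_nonneg (fun e _ => mul_nonneg (ha0 _) (hb0 _))
    have n2 : 0 ≤ ∑ e : Arr Q, b e.1 * a e.2.1 :=
      Finset.sum_nonneg (fun e _ => mul_nonneg (hb0 _) (ha0 _))
    linarith
  have hq := q_sub a b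
  rw [← hx'] at hq
  have qa := hp a
  have qb := hp b
  have key : ∀ a b : Q.V → ℤ, a ∈ Vc c → b ∈ Vc c → (∀ v, 0 ≤ a v) → (∀ v, a v * b v = 0) → euler Q a a = 0 →
      a = 0 ∨ b = 0 := by
    intro a b hac hbc ha0 hab qa
    by_cases h : a = 0
    · exact Or.inl h
    · right
      funext v
      by_cases hv : cl v = c
      · have : a v ≠ 0 := fun h0 => h (rad_zero_nonneg hp hac qa ha0 hv h0)
        exact (mul_eq_zero.1 (hab v)).resolve_left this
      · exact hbc v hv
  have h3 : a = 0 ∨ b = 0 := by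
    have : euler Q a a = 0 ∨ euler Q b b = 0 := by
      by_contra hcon
      push Not at hcon
      have : 1 ≤ euler Q a a := by have := hcon.1; omega
      have : 1 ≤ euler Q b b := by have := hcon.2; omega
      omega
    rcases this with h | h
    · exact key a b hac hbc ha0 hab h
    · exact (key b a hbc hac hb0 (fun v => by rw [mul_comm, hab v]) h).symm
  rcases h3 with h | h
  · right; intro v
    have : x v = a v - b v := congrFun hx' v
    rw [h] at this
    have := hb0 v
    simp at *; omega
  · left; intro v
    have : x v = a v - b v := congrFun hx' v
    rw [h] at this
    have := ha0 v
    simp at *; omega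

/-! roots and reflections -/
structure RT (b : Q.V → ℤ) : Prop where
  q : euler Q b b = 1
  sup : ∃ c : Cmp Q, b ∈ Vc c

lemma RT.neg {b : Q.V → ℤ} (h : RT b) : RT (-b) :=
  ⟨by rw [q_neg]; exact h.q, h.sup.imp fun _ hc => Submodule.neg_mem _ hc⟩

lemma refl_apply (b x : Q.V → ℤ) : reflV Q b x = x - symEuler Q b x • b := rfl

lemma refl_neg (b : Q.V → ℤ) : reflV Q (-b) = reflV Q b := by
  funext x
  rw [refl_apply, refl_apply, sy_neg_left]; simp

lemma refl_map_neg (b x : Q.V → ℤ) : reflV Q b (-x) = -reflV Q b x := by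
  rw [refl_apply, refl_apply, sy_neg_right]; module

lemma RT.sy {b : Q.V → ℤ} (h : RT b) : symEuler Q b b = 2 := by rw [sy_self, h.q]; rfl

lemma refl_refl {b : Q.V → ℤ} (h : RT b) (x : Q.V → ℤ) : reflV Q b (reflV Q b x) = x := by
  rw [refl_apply, refl_apply, sy_sub_right, sy_smul_right, h.sy]; module

lemma refl_sy {b : Q.V → ℤ} (h : RT b) (x y : Q.V → ℤ) :
    symEuler Q (reflV Q b x) (reflV Q b y) = symEuler Q x y := by
  simp only [refl_apply, sy_sub_right, sy_smul_right, sy_sub_left, sy_smul_left, h.sy, sy_comm x b]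
  ring

lemma refl_q {b : Q.V → ℤ} (h : RT b) (x : Q.V → ℤ) :
    euler Q (reflV Q b x) (reflV Q b x) = euler Q x x := by
  have := refl_sy h x x
  rw [sy_self, sy_self] at this
  linarith

lemma RT.refl {a b : Q.V → ℤ} (ha : RT a) (hb : RT b) : RT (reflV Q b a) := by
  refine ⟨by rw [refl_q hb, ha.q], ?_⟩
  obtain ⟨c, hc⟩ := ha.sup
  obtain ⟨d, hd⟩ := hb.sup
  refine ⟨c, ?_⟩
  by_cases h : d = c
  · subst h
    exact Submodule.sub_mem _ hc (Submodule.smul_mem _ _ hd)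
  · rw [refl_apply, sy_Vc h hd hc]; simpa using hc

lemma refl_conj {a b : Q.V → ℤ} (hb : RT b) :
    reflV Q (reflV Q b a) = reflV Q b ∘ reflV Q a ∘ reflV Q b := by
  funext x
  have : symEuler Q (reflV Q b a) x = symEuler Q a (reflV Q b x) := by
    rw [← refl_sy hb a, refl_refl hb]
  rw [refl_apply, this]
  change _ = reflV Q b (reflV Q b x - symEuler Q a (reflV Q b x) • a)
  conv_lhs => rw [← refl_refl hb x]
  rw [refl_refl hb x]
  generalize symEuler Q a (reflV Q b x) = m
  generalize hz : reflV Q b x = z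
  have hx : x = reflV Q b z := by rw [← hz, refl_refl hb]
  rw [hx, refl_apply b (z - m • a), sy_sub_right, sy_smul_right, refl_apply b z, refl_apply b a]
  module

lemma RT_simRoot (hno : ∀ v : Q.V, euler Q (simRoot Q v) (simRoot Q v) = 1) (v : Q.V) : RT (simRoot Q v) :=
  ⟨hno v, _, simRoot_Vc v⟩

lemma euler_simRoot_self {ord : Fin (Fintype.card Q.V) ≃ Q.V} (hord : OrdCompatible Q ord) (v : Q.V) :
    euler Q (simRoot Q v) (simRoot Q v) = 1 :=
  (sroots_eexc hord).1 _ ((List.mem_ofFn' _ _).2 ⟨ord.symm v, by simp⟩)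

/-- product of the reflections in a list of vectors -/
def rfs (Q : FinQuiver) (l : List (Q.V → ℤ)) : (Q.V → ℤ) → (Q.V → ℤ) :=
  (l.map (reflV Q)).foldr (· ∘ ·) id

lemma rfs_nil : rfs Q [] = id := rfl
lemma rfs_cons (b : Q.V → ℤ) (l) : rfs Q (b :: l) = reflV Q b ∘ rfs Q l := rfl
lemma rfs_append (l l' : List (Q.V → ℤ)) : rfs Q (l ++ l') = rfs Q l ∘ rfs Q l' := by
  induction l with
  | nil => rfl
  | cons b l ih => rw [List.cons_append, rfs_cons, ih, rfs_cons]; rfl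

lemma word_append (l l' : List Q.V) : wordProd Q (l ++ l') = wordProd Q l ∘ wordProd Q l' := by
  induction l with
  | nil => rfl
  | cons b l ih =>
    change sref Q b ∘ wordProd Q (l ++ l') = _
    rw [ih]; rfl

lemma comps_eq {m : ℕ} (g : Fin m → (Q.V → ℤ)) : comps Q (fun i => reflV Q (g i)) = rfs Q (List.ofFn g) := by
  rw [comps, rfs, List.map_ofFn]; rfl


lemma isRefl_conj {t : (Q.V → ℤ) → (Q.V → ℤ)} (i : Q.V) (h : IsRefl Q t) : IsRefl Q (sref Q i ∘ t ∘ sref Q i) := by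
  obtain ⟨l, j, rfl⟩ := h
  refine ⟨i :: l, j, ?_⟩
  rw [List.reverse_cons, word_append]
  rfl

lemma RT_of_isRefl (hno : ∀ v : Q.V, euler Q (simRoot Q v) (simRoot Q v) = 1) {t : (Q.V → ℤ) → (Q.V → ℤ)} (h : IsRefl Q t) : ∃ b, RT b ∧ t = reflV Q b := by
  obtain ⟨l, j, rfl⟩ := h
  induction l with
  | nil => exact ⟨simRoot Q j, RT_simRoot hno j, rfl⟩
  | cons i l ih =>
    obtain ⟨b, hb, e⟩ := ih
    refine ⟨reflV Q (simRoot Q i) b, hb.refl (RT_simRoot hno i), ?_⟩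
    rw [refl_conj (RT_simRoot hno i), ← e, List.reverse_cons, word_append]
    rfl

lemma isRefl_of_nonneg (hno : ∀ v : Q.V, euler Q (simRoot Q v) (simRoot Q v) = 1) (hp : PSD Q) : ∀ (m : ℕ) (b : Q.V → ℤ), RT b → (∀ v, 0 ≤ b v) → ∑ v, b v = m →
    IsRefl Q (reflV Q b) := by
  intro m
  induction m using Nat.strong_induction_on with
  | _ m ih =>
    intro b hb h0 hm
    have h2 := hb.sy
    rw [sy_sum] at h2
    obtain ⟨i, -, hi⟩ := Finset.exists_lt_of_sum_lt (s := Finset.univ) (f := fun _ : Q.V => (0:ℤ))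
      (g := fun v => b v * symEuler Q b (simRoot Q v)) (by rw [h2]; simp)
    have hbi : 0 < b i := lt_of_le_of_ne (h0 i) (fun h => by rw [← h] at hi; simp at hi)
    have hsi : 0 < symEuler Q b (simRoot Q i) := by
      exact (pos_iff_pos_of_mul_pos hi).1 hbi
    have hri := RT_simRoot hno i
    have hr := hb.refl hri
    have hr' : reflV Q (simRoot Q i) b = b - symEuler Q b (simRoot Q i) • simRoot Q i := by
      rw [refl_apply, sy_comm]
    obtain ⟨c, hc⟩ := hr.sup
    rcases coherent hp hc hr.q.le with h | h
    · have hsum : ∑ v, reflV Q (simRoot Q i) b v = m - symEuler Q b (simRoot Q i) := by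
        classical
        rw [hr']
        simp [Finset.sum_sub_distrib, hm, simRoot]
      have hnn : 0 ≤ ∑ v, reflV Q (simRoot Q i) b v := Finset.sum_nonneg (fun v _ => h v)
      have := ih (∑ v, reflV Q (simRoot Q i) b v).toNat (by omega) _ hr h (by omega)
      have := isRefl_conj i this
      rw [sref, ← refl_conj hri, refl_refl hri] at this
      exact this
    · have hz : ∀ v, v ≠ i → b v = 0 := by
        intro v hv
        have := h v
        rw [hr'] at this
        simp [simRoot, hv] at this
        exact le_antisymm this (h0 v)
      have hb' : b = b i • simRoot Q i := by
        funext v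
        by_cases hv : v = i
        · subst hv; simp [simRoot]
        · simp [simRoot, hv, hz v hv]
      have hq := hb.q
      rw [hb', q_smul, hno] at hq
      have : b i = 1 := by
        rcases mul_self_eq_one_iff.1 (by linarith : b i * b i = 1) with h | h <;> omega
      rw [hb', this, one_smul]
      exact ⟨[], i, rfl⟩

lemma isRefl_of_RT (hno : ∀ v : Q.V, euler Q (simRoot Q v) (simRoot Q v) = 1) (hp : PSD Q) {b : Q.V → ℤ} (hb : RT b) : IsRefl Q (reflV Q b) := by
  obtain ⟨c, hc⟩ := hb.sup
  rcases coherent hp hc hb.q.le with h | h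
  · exact isRefl_of_nonneg hno hp _ b hb h (Int.toNat_of_nonneg (Finset.sum_nonneg fun v _ => h v)).symm
  · rw [← refl_neg]
    have h' : ∀ v, 0 ≤ (-b) v := fun v => by have := h v; simp; omega
    exact isRefl_of_nonneg hno hp _ _ hb.neg h' (Int.toNat_of_nonneg (Finset.sum_nonneg fun v _ => h' v)).symm

lemma inW_rfs (hno : ∀ v : Q.V, euler Q (simRoot Q v) (simRoot Q v) = 1) (hp : PSD Q) {l : List (Q.V → ℤ)} (hl : ∀ b ∈ l, RT b) : InW Q (rfs Q l) := by
  induction l with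
  | nil => exact ⟨[], rfl⟩
  | cons b l ih =>
    obtain ⟨w, hw⟩ := ih (fun a ha => hl a (by simp [ha]))
    obtain ⟨u, i, hu⟩ := isRefl_of_RT hno hp (hl b (by simp))
    refine ⟨u ++ [i] ++ u.reverse ++ w, ?_⟩
    rw [rfs_cons, hu, hw, word_append, word_append, word_append]
    rfl

lemma euler_spn_right {b y : Q.V → ℤ} {l : List (Q.V → ℤ)} (h : ∀ a ∈ l, euler Q b a = 0)
    (hy : y ∈ spn l) : euler Q b y = 0 := by
  induction hy using Submodule.span_induction with
  | mem x hx => exact h x hx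
  | zero => exact euler_zero_right _
  | add x y _ _ hx hy => rw [euler_add_right, hx, hy, add_zero]
  | smul c x _ hx => rw [euler_smul_right, hx, mul_zero]

lemma EExc.nondeg' {l : List (Q.V → ℤ)} (h : EExc Q l) {x : Q.V → ℤ} (hx : x ∈ spn l)
    (h0 : ∀ y ∈ l, euler Q y x = 0) : x = 0 := by
  induction l generalizing x with
  | nil => simpa [spn] using hx
  | cons b l ih =>
    rw [EExc.cons_iff] at h
    obtain ⟨c, y, hy, rfl⟩ := spn_cons_mem.1 hx
    have hy0 : y = 0 := by
      apply ih h.2.2 hy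
      intro a ha
      have := h0 a (by simp [ha])
      rw [euler_add_right, euler_smul_right, h.2.1 a ha] at this
      linarith
    subst hy0
    have := h0 b (by simp)
    rw [euler_add_right, euler_smul_right, h.1, euler_zero_right] at this
    have hc : c = 0 := by linarith
    simp [hc]

lemma EExc.chr {l : List (Q.V → ℤ)} (h : EExc Q l) (x : Q.V → ℤ) :
    rfs Q l x - x ∈ spn l ∧ ∀ y ∈ l, euler Q y (rfs Q l x) = - euler Q x y := by
  induction l with
  | nil => simp [rfs]
  | cons b l ih =>
    rw [EExc.cons_iff] at h
    obtain ⟨h1, h2⟩ := ih h.2.2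
    set x1 := rfs Q l x with hx1
    have e : rfs Q (b :: l) x = x1 - symEuler Q b x1 • b := rfl
    have h3 := euler_spn_left h.2.1 h1
    rw [euler_sub_left] at h3
    refine ⟨?_, ?_⟩
    · rw [spn_cons_mem]
      exact ⟨-symEuler Q b x1, x1 - x, h1, by rw [e]; module⟩
    · intro y hy
      rw [e, euler_sub_right, euler_smul_right]
      rcases List.mem_cons.1 hy with rfl | hy
      · rw [h.1, symEuler]; linarith
      · rw [h.2.1 y hy, h2 y hy]; ring

lemma rfs_unique {l l' : List (Q.V → ℤ)} (h : EExc Q l) (h' : EExc Q l') (e : spn l = spn l') :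
    rfs Q l = rfs Q l' := by
  funext x
  obtain ⟨a1, a2⟩ := h.chr x
  obtain ⟨b1, b2⟩ := h'.chr x
  have key : ∀ y ∈ spn l, euler Q y (rfs Q l' x) = - euler Q x y := by
    intro y hy
    rw [e] at hy
    induction hy using Submodule.span_induction with
    | mem y hy => exact b2 y hy
    | zero => rw [euler_zero_left, euler_zero_right]; rfl
    | add y z _ _ h1 h2 => rw [euler_add_left, euler_add_right, h1, h2]; ring
    | smul c y _ h1 => rw [euler_smul_left, euler_smul_right, h1]; ring
  rw [← sub_eq_zero]
  apply h.nondeg'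
  · rw [← e] at b1
    have := Submodule.sub_mem _ a1 b1
    simpa using this
  · intro y hy
    rw [euler_sub_right, a2 y hy, key y (Submodule.subset_span hy)]; ring

lemma EExc.proj {l : List (Q.V → ℤ)} (h : EExc Q l) (x : Q.V → ℤ) :
    ∃ u ∈ spn l, ∀ b ∈ l, euler Q (x - u) b = 0 := by
  induction l generalizing x with
  | nil => exact ⟨0, Submodule.zero_mem _, by simp⟩
  | cons b l ih =>
    rw [EExc.cons_iff] at h
    obtain ⟨u, hu, hu'⟩ := ih h.2.2 (x - euler Q x b • b)
    refine ⟨euler Q x b • b + u, spn_cons_mem.2 ⟨_, u, hu, rfl⟩, ?_⟩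
    have e : x - (euler Q x b • b + u) = x - euler Q x b • b - u := by abel
    intro a ha
    rw [e]
    rcases List.mem_cons.1 ha with rfl | ha
    · rw [euler_sub_left, euler_sub_left, euler_smul_left, h.1, euler_spn_left h.2.1 hu]; ring
    · exact hu' a ha

lemma coxeter_eq (ord : Fin (Fintype.card Q.V) ≃ Q.V) : coxeter Q ord = rfs Q (sroots ord) :=
  comps_eq _

lemma cox_chr {ord : Fin (Fintype.card Q.V) ≃ Q.V} (hord : OrdCompatible Q ord) (x y : Q.V → ℤ) :
    euler Q y (coxeter Q ord x) = - euler Q x y := by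
  rw [coxeter_eq]
  have hy : y ∈ spn (sroots ord) := by rw [spn_sroots]; trivial
  induction hy using Submodule.span_induction with
  | mem y hy => exact ((sroots_eexc hord).chr x).2 y hy
  | zero => rw [euler_zero_left, euler_zero_right]; rfl
  | add y z _ _ h1 h2 => rw [euler_add_left, euler_add_right, h1, h2]; ring
  | smul c y _ h1 => rw [euler_smul_left, euler_smul_right, h1]; ring

lemma finrank_le_fns {L : Submodule ℤ (Q.V → ℤ)} (F : List ((Q.V → ℤ) →ₗ[ℤ] ℤ))
    (h : ∀ x ∈ L, (∀ f ∈ F, f x = 0) → x = 0) : Module.finrank ℤ L ≤ F.length := by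
  let g : L →ₗ[ℤ] (Fin F.length → ℤ) := LinearMap.pi (fun i => (F.get i) ∘ₗ L.subtype)
  have hg : Function.Injective g := by
    rw [← LinearMap.ker_eq_bot, LinearMap.ker_eq_bot']
    intro x hx
    apply Subtype.ext
    apply h x x.2
    intro f hf
    obtain ⟨i, rfl⟩ := List.mem_iff_get.1 hf
    exact congrFun hx i
  have := LinearMap.finrank_le_finrank_of_injective hg
  simpa using this

lemma exists_not_pairwise {α : Type*} {R : α → α → Prop} {l : List α} (h : ¬ l.Pairwise R) :
    ∃ s1 a s2 b s3, l = s1 ++ a :: (s2 ++ b :: s3) ∧ ¬ R a b := by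
  induction l with
  | nil => simp at h
  | cons x l ih =>
    rw [List.pairwise_cons, not_and_or] at h
    rcases h with h | h
    · push Not at h
      obtain ⟨b, hb, hR⟩ := h
      obtain ⟨s2, s3, rfl⟩ := List.append_of_mem hb
      exact ⟨[], x, s2, b, s3, rfl, hR⟩
    · obtain ⟨s1, a, s2, b, s3, rfl, hR⟩ := ih h
      exact ⟨x :: s1, a, s2, b, s3, rfl, hR⟩

lemma rfs_triv {l : List (Q.V → ℤ)} {x : Q.V → ℤ} (h : ∀ b ∈ l, symEuler Q b x = 0) : rfs Q l x = x := by
  induction l with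
  | nil => rfl
  | cons b l ih =>
    change reflV Q b (rfs Q l x) = x
    rw [ih (fun a ha => h a (by simp [ha])), refl_apply, h b (by simp)]
    simp

lemma sy_refl_left {b : Q.V → ℤ} (hb : RT b) (a x : Q.V → ℤ) :
    symEuler Q (reflV Q b a) x = symEuler Q a (reflV Q b x) := by
  rw [← refl_sy hb a, refl_refl hb]

section L3
variable {ord : Fin (Fintype.card Q.V) ≃ Q.V}

lemma fix_q (hord : OrdCompatible Q ord) {x : Q.V → ℤ} (h : coxeter Q ord x = x) : euler Q x x = 0 := by
  have := cox_chr hord x x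
  rw [h] at this
  linarith

lemma L3c (hord : OrdCompatible Q ord) (hp : PSD Q) (c : Cmp Q) {l : List (Q.V → ℤ)}
    (hl : ∀ b ∈ l, RT b) (hc : ∀ b ∈ l, b ∈ Vc c) (h : ∀ x ∈ Vc c, coxeter Q ord x = rfs Q l x) :
    Module.finrank ℤ (Vc c) ≤ l.length ∧ (l.length ≤ Module.finrank ℤ (Vc c) → EExc Q l) := by
  obtain ⟨w, rfl⟩ : ∃ w, cl w = c := Quot.exists_rep c
  by_cases hE : EExc Q l
  · refine ⟨?_, fun _ => hE⟩
    have rad : ∀ y ∈ Vc (cl w), (∀ b ∈ l, euler Q y b = 0) → euler Q y y = 0 := by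
      intro y hy h0
      have h1 := cox_chr hord y y
      have h2 : euler Q y (rfs Q l y - y) = 0 := euler_spn_right h0 (hE.chr y).1
      rw [h y hy] at h1
      rw [euler_sub_right, h1] at h2
      linarith
    have spl : spn l ≤ Vc (cl w) := Submodule.span_le.2 hc
    have zero : ∀ y ∈ Vc (cl w), (∀ b ∈ l, euler Q y b = 0) → y = 0 := by
      intro y hy h0
      by_contra hne
      have hyw : y w ≠ 0 := fun h => hne (rad_zero hp hy (rad y hy h0) rfl h)
      apply hne
      apply nondeg_top hord y trivial
      intro x _
      -- only the component of x in c matters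
      have hE2 : ∀ x ∈ Vc (cl w), euler Q y x = 0 := by
        intro x hx
        obtain ⟨u, hu, hu'⟩ := hE.proj x
        have hx' : x - u ∈ Vc (cl w) := Submodule.sub_mem _ hx (spl hu)
        have h3 : y w • (x - u) - (x - u) w • y = 0 := by
          apply rad_zero hp (Submodule.sub_mem _ (Submodule.smul_mem _ _ hx') (Submodule.smul_mem _ _ hy)) _ rfl
            (w := w)
          · simp; ring
          · rw [q_sub, q_smul, q_smul, rad y hy h0, rad _ hx' hu', sy_smul_left,
              rad_of_q hp (rad _ hx' hu')]; ring
        have h4 := congrArg (euler Q y) h3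
        rw [euler_sub_right, euler_smul_right, euler_smul_right, rad y hy h0, euler_zero_right] at h4
        have h5 : euler Q y (x - u) = 0 := by
          have : y w * euler Q y (x - u) = 0 := by linarith
          exact (mul_eq_zero.1 this).resolve_left hyw
        have h6 : euler Q y u = 0 := euler_spn_right h0 hu
        rw [euler_sub_right, h6] at h5
        linarith
      have : x ∈ Submodule.span ℤ (Set.range (simRoot Q)) := by rw [simRoot_span]; trivial
      induction this using Submodule.span_induction with
      | mem x hx =>
        obtain ⟨v, rfl⟩ := hx
        by_cases hv : cl v = cl w
        · exact hE2 _ (hv ▸ simRoot_Vc v)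
        · exact euler_Vc (fun h => hv h.symm) hy (simRoot_Vc v)
      | zero => exact euler_zero_right _
      | add y z _ _ h1 h2 => rw [euler_add_right, h1 trivial, h2 trivial]; ring
      | smul c y _ h1 => rw [euler_smul_right, h1 trivial]; ring
    have := finrank_le_fns (L := Vc (cl w)) (l.map (eR Q)) (fun x hx h0 => zero x hx (fun b hb =>
      h0 _ (List.mem_map_of_mem hb)))
    simpa using this
  · have hE' : ¬ l.Pairwise (fun a b => euler Q b a = 0) := fun hP => hE ⟨fun b hb => (hl b hb).q, hP⟩
    obtain ⟨s1, a, s2, b, s3, rfl, hR⟩ := exists_not_pairwise hE'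
    have ha := hl a (by simp)
    have hb := hl b (by simp)
    have := finrank_le_fns (L := Vc (cl w)) ((s3 ++ s2.map (reflV Q b) ++
      (s1.map (reflV Q a)).map (reflV Q b)).map (syL Q) ++ [LinearMap.proj w]) (by
        intro x hx h0
        have h1 : ∀ y ∈ s3, symEuler Q y x = 0 := fun y hy => h0 (syL Q y) (by
          simp only [List.map_append, List.mem_append]
          exact Or.inl (Or.inl (Or.inl (List.mem_map_of_mem hy))))
        have h2 : ∀ y ∈ s2, symEuler Q y (reflV Q b x) = 0 := fun y hy => by
          rw [← sy_refl_left hb]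
          refine h0 (syL Q (reflV Q b y)) ?_
          simp only [List.map_append, List.mem_append]
          exact Or.inl (Or.inl (Or.inr (List.mem_map_of_mem (List.mem_map_of_mem hy))))
        have h3 : ∀ y ∈ s1, symEuler Q y (reflV Q a (reflV Q b x)) = 0 := fun y hy => by
          rw [← sy_refl_left ha, ← sy_refl_left hb]
          refine h0 (syL Q (reflV Q b (reflV Q a y))) ?_
          simp only [List.map_append, List.mem_append]
          exact Or.inl (Or.inr (List.mem_map_of_mem (List.mem_map_of_mem (List.mem_map_of_mem hy))))
        have h4 : x w = 0 := h0 (LinearMap.proj w) (by simp)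
        have h5 : coxeter Q ord x = reflV Q a (reflV Q b x) := by
          rw [h x hx, rfs_append, rfs_cons, rfs_append, rfs_cons]
          simp only [Function.comp_apply]
          rw [rfs_triv h1, rfs_triv h2, rfs_triv h3]
        apply rad_zero hp hx _ rfl h4
        have ca := cox_chr hord x a
        have cb := cox_chr hord x b
        rw [h5] at ca cb
        set m := symEuler Q b x with hm
        set n := symEuler Q a (reflV Q b x) with hn
        have e1 : reflV Q b x = x - m • b := rfl
        have e2 : reflV Q a (reflV Q b x) = x - m • b - n • a := by rw [refl_apply, ← hn, e1]
        rw [e2, euler_sub_right, euler_sub_right, euler_smul_right, euler_smul_right] at ca cb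
        rw [e1, sy_sub_right, sy_smul_right] at hn
        rw [ha.q] at ca
        rw [hb.q] at cb
        unfold symEuler at hm hn
        have hm0 : euler Q b a * m = 0 := by linarith
        have hn0 : euler Q b a * n = 0 := by linarith
        have hm1 := (mul_eq_zero.1 hm0).resolve_left hR
        have hn1 := (mul_eq_zero.1 hn0).resolve_left hR
        apply fix_q hord
        rw [h5, e2, hm1, hn1]; simp)
    simp at this ⊢
    constructor <;> intros <;> omega

lemma RT.ne_zero {b : Q.V → ℤ} (h : RT b) : b ≠ 0 := fun h0 => by
  have := h.q
  rw [h0, euler_zero_left] at this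
  simp at this

lemma RT.unique {b : Q.V → ℤ} (h : RT b) {c d : Cmp Q} (hc : b ∈ Vc c) (hd : b ∈ Vc d) : c = d := by
  by_contra hne
  apply h.ne_zero
  funext v
  by_cases hv : cl v = c
  · exact hd v (by rw [hv]; exact hne)
  · exact hc v hv

instance : Finite (Cmp Q) := inferInstanceAs (Finite (Quot _))

open scoped Classical in
def lc (c : Cmp Q) (l : List (Q.V → ℤ)) := l.filter (fun b => b ∈ Vc c)

open scoped Classical in
lemma sum_lc [Fintype (Cmp Q)] {l : List (Q.V → ℤ)} (hl : ∀ b ∈ l, RT b) : ∑ c : Cmp Q, (lc c l).length = l.length := by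
  induction l with
  | nil => simp [lc]
  | cons b l ih =>
    obtain ⟨d, hd⟩ := (hl b (by simp)).sup
    have : ∀ c, (lc c (b :: l)).length = (lc c l).length + if c = d then 1 else 0 := by
      intro c
      rw [lc, List.filter_cons]
      by_cases hb : b ∈ Vc c
      · have := (hl b (by simp)).unique hb hd
        simp [hb, this, lc]
        simp [← this, hb]
      · have : c ≠ d := fun h => hb (h ▸ hd)
        simp [hb, this, lc]
    simp only [this, Finset.sum_add_distrib]
    rw [ih (fun a ha => hl a (by simp [ha]))]
    simp

lemma rfs_lc (c : Cmp Q) {l : List (Q.V → ℤ)} (hl : ∀ b ∈ l, RT b) {x : Q.V → ℤ} (hx : x ∈ Vc c) :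
    rfs Q l x = rfs Q (lc c l) x ∧ rfs Q l x ∈ Vc c := by
  classical
  induction l with
  | nil => exact ⟨rfl, hx⟩
  | cons b l ih =>
    obtain ⟨h1, h2⟩ := ih (fun a ha => hl a (by simp [ha]))
    obtain ⟨d, hd⟩ := (hl b (by simp)).sup
    rw [lc, List.filter_cons]
    by_cases hb : b ∈ Vc c
    · simp only [hb, decide_true, if_true]
      rw [rfs_cons, rfs_cons]
      exact ⟨congrArg (reflV Q b) h1, Submodule.sub_mem _ h2 (Submodule.smul_mem _ _ hb)⟩
    · have hdc : d ≠ c := fun h => hb (h ▸ hd)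
      have e : rfs Q (b :: l) x = rfs Q l x := by
        change reflV Q b (rfs Q l x) = _
        rw [refl_apply, sy_Vc hdc hd h2]; simp
      rw [e]
      simp only [hb, decide_false]
      exact ⟨h1, h2⟩

lemma EExc.sublist {l l' : List (Q.V → ℤ)} (h : EExc Q l) (hs : l'.Sublist l) : EExc Q l' :=
  ⟨fun b hb => h.1 b (hs.subset hb), h.2.sublist hs⟩

lemma sroots_RT (hord : OrdCompatible Q ord) : ∀ b ∈ sroots ord, RT b := by
  intro b hb
  obtain ⟨i, rfl⟩ := (List.mem_ofFn' _ _).1 hb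
  exact RT_simRoot (euler_simRoot_self hord) _

theorem L3 (hord : OrdCompatible Q ord) (hp : PSD Q) {l : List (Q.V → ℤ)}
    (hl : ∀ b ∈ l, RT b) (h : coxeter Q ord = rfs Q l) :
    Fintype.card Q.V ≤ l.length ∧ (l.length = Fintype.card Q.V → EExc Q l) := by
  classical
  have : Fintype (Cmp Q) := Fintype.ofFinite _
  have hsl : ∀ c, (lc c l).Sublist l := fun c => List.filter_sublist
  have mem : ∀ c, ∀ (l : List (Q.V → ℤ)), ∀ b ∈ lc c l, b ∈ Vc c := fun c l b hb => by
    have := (List.mem_filter.1 hb).2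
    simpa using this
  have key : ∀ c, _ := fun c => L3c hord hp c (l := lc c l) (fun b hb => hl b ((hsl c).subset hb))
    (mem c l) (fun x hx => by rw [h]; exact (rfs_lc c hl hx).1)
  have hn : Fintype.card Q.V ≤ ∑ c : Cmp Q, Module.finrank ℤ (Vc c) := by
    have h1 := sum_lc (sroots_RT hord)
    have h2 : (sroots ord).length = Fintype.card Q.V := by simp [sroots]
    rw [← h2, ← h1]
    apply Finset.sum_le_sum
    intro c _
    rw [← ((sroots_eexc hord).sublist (l' := lc c (sroots ord)) List.filter_sublist).finrank]
    exact Submodule.finrank_mono (Submodule.span_le.2 (mem c _))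
  have hs := sum_lc hl
  have hle : ∑ c : Cmp Q, Module.finrank ℤ (Vc c) ≤ ∑ c : Cmp Q, (lc c l).length :=
    Finset.sum_le_sum (fun c _ => (key c).1)
  refine ⟨by omega, fun hlen => ⟨fun b hb => (hl b hb).q, ?_⟩⟩
  have heq : ∑ c : Cmp Q, Module.finrank ℤ (Vc c) = ∑ c : Cmp Q, (lc c l).length := by omega
  have heq' := (Finset.sum_eq_sum_iff_of_le (fun c _ => (key c).1)).1 heq
  have hP : ∀ c, (lc c l).Pairwise (fun a b => euler Q b a = 0) := fun c =>
    ((key c).2 (heq' c (Finset.mem_univ c)).ge).2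
  have hP' : ∀ c, l.Pairwise (fun a b => a ∈ Vc c → b ∈ Vc c → euler Q b a = 0) := by
    intro c
    have := hP c
    rw [lc, List.pairwise_filter] at this
    simpa using this
  by_contra hcon
  obtain ⟨s1, a, s2, b, s3, e, hR⟩ := exists_not_pairwise hcon
  obtain ⟨c, hc⟩ := (hl a (by simp [e])).sup
  obtain ⟨d, hd⟩ := (hl b (by simp [e])).sup
  by_cases hcd : d = c
  · subst hcd
    have := hP' d
    rw [e, List.pairwise_append, List.pairwise_cons] at this
    exact hR (this.2.1.1 b (by simp) hc hd)
  · exact hR (euler_Vc hcd hd hc)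

end L3


lemma tors {M : Type*} [AddCommGroup M] [Module.Free ℤ M] [Module.Finite ℤ M]
    (L : Submodule ℤ M) (h : Module.finrank ℤ M ≤ Module.finrank ℤ L) (x : M) :
    ∃ a : ℤ, a ≠ 0 ∧ a • x ∈ L := by
  have h1 := Submodule.finrank_quotient_add_finrank L
  have h2 : Module.finrank ℤ (M ⧸ L) = 0 := by omega
  rw [Module.finrank_eq_zero_iff] at h2
  obtain ⟨a, ha, hx⟩ := h2 (Submodule.Quotient.mk x)
  refine ⟨a, ha, ?_⟩
  rw [← Submodule.Quotient.mk_smul] at hx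
  exact (Submodule.Quotient.mk_eq_zero L).1 hx

lemma exists_u (hp : PSD Q) (v : Q.V) :
    ∃ u : Q.V → ℤ, ∀ i, cl i = cl v → i ≠ v → 0 < symEuler Q u (simRoot Q i) := by
  classical
  let I := {i : Q.V // cl i = cl v ∧ i ≠ v}
  let ι : (I → ℤ) →ₗ[ℤ] (Q.V → ℤ) := ∑ i : I, (LinearMap.proj i).smulRight (simRoot Q i.1)
  have hι : ∀ f, ι f = ∑ i : I, f i • simRoot Q i.1 := fun f => by simp [ι]
  let G : (I → ℤ) →ₗ[ℤ] (I → ℤ) := LinearMap.pi (fun i => syL Q (simRoot Q i.1) ∘ₗ ι)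
  have hG : ∀ f i, G f i = symEuler Q (simRoot Q i.1) (ι f) := fun f i => rfl
  have hιv : ∀ f, ι f v = 0 := by
    intro f
    rw [hι, Finset.sum_apply]
    apply Finset.sum_eq_zero
    intro i _
    have : v ≠ i.1 := i.2.2.symm
    simp [simRoot, this]
  have hιi : ∀ f (i : I), ι f i.1 = f i := by
    intro f i
    rw [hι, Finset.sum_apply, Finset.sum_eq_single i]
    · simp [simRoot_same]
    · intro j _ hj
      have : i.1 ≠ j.1 := fun h => hj (Subtype.ext h.symm)
      simp [simRoot, this]
    · simp
  have hιc : ∀ f, ι f ∈ Vc (cl v) := by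
    intro f
    rw [hι]
    exact Submodule.sum_mem _ (fun i _ => Submodule.smul_mem _ _ (by
      have := simRoot_Vc i.1
      rwa [i.2.1] at this))
  have inj : Function.Injective G := by
    rw [← LinearMap.ker_eq_bot, LinearMap.ker_eq_bot']
    intro f hf
    have h1 : symEuler Q (ι f) (ι f) = 0 := by
      have e : symEuler Q (ι f) (ι f) = syL Q (ι f) (∑ i : I, f i • simRoot Q i.1) := by
        rw [← hι f]; rfl
      rw [e, map_sum]
      apply Finset.sum_eq_zero
      intro i _
      rw [map_smul]
      change _ • symEuler Q (ι f) (simRoot Q i.1) = 0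
      rw [sy_comm, ← hG, hf]; simp
    rw [sy_self] at h1
    have h2 := rad_zero hp (hιc f) (by linarith) rfl (hιv f)
    funext i
    rw [← hιi f i, h2]; rfl
  obtain ⟨a, ha, f, hf⟩ := tors (LinearMap.range G) (by
    rw [LinearMap.finrank_range_of_inj inj]) (fun _ => (1 : ℤ))
  have key : ∀ i : I, symEuler Q (ι f) (simRoot Q i.1) = a := fun i => by
    rw [sy_comm, ← hG, hf]; simp
  rcases lt_or_gt_of_ne ha with h | h
  · refine ⟨-ι f, fun i hi hv => ?_⟩
    rw [sy_neg_left, key ⟨i, hi, hv⟩]; omega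
  · exact ⟨ι f, fun i hi hv => by rw [key ⟨i, hi, hv⟩]; exact h⟩

lemma exists_lam (hp : PSD Q) (v : Q.V) :
    ∃ (lam : (Q.V → ℤ) →ₗ[ℤ] ℤ) (C : ℤ), (∀ x ∈ Vc (cl v), (∀ w, 0 ≤ x w) → x ≠ 0 → 0 < lam x) ∧
      ∀ z, euler Q z z = z v → -C ≤ lam z := by
  classical
  obtain ⟨u, hu⟩ := exists_u hp v
  set K := 1 + |symEuler Q u (simRoot Q v)| with hK
  refine ⟨syL Q u + K • LinearMap.proj v, euler Q u u, ?_, ?_⟩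
  · intro x hx h0 hne
    have e : (syL Q u + K • (LinearMap.proj v : (Q.V → ℤ) →ₗ[ℤ] ℤ)) x =
        ∑ w, x w * (symEuler Q u (simRoot Q w) + if w = v then K else 0) := by
      simp only [mul_add, Finset.sum_add_distrib, ← sy_sum]
      simp [mul_comm]
      rfl
    rw [e]
    have pos : ∀ w, cl w = cl v → 0 < symEuler Q u (simRoot Q w) + if w = v then K else 0 := by
      intro w hw
      by_cases hwv : w = v
      · subst hwv
        simp only [if_true]
        have := neg_abs_le (symEuler Q u (simRoot Q w))
        omega
      · simp only [hwv, if_false, add_zero]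
        exact hu w hw hwv
    obtain ⟨w, hw⟩ := Function.ne_iff.1 hne
    apply Finset.sum_pos'
    · intro w _
      by_cases hwc : cl w = cl v
      · exact mul_nonneg (h0 w) (pos w hwc).le
      · rw [hx w hwc]; simp
    · refine ⟨w, Finset.mem_univ _, ?_⟩
      have hwc : cl w = cl v := by
        by_contra h
        exact hw (hx w h)
      exact mul_pos (lt_of_le_of_ne (h0 w) (Ne.symm hw)) (pos w hwc)
  · intro z hz
    change - _ ≤ symEuler Q u z + K • z v
    have h1 := hp (u + z)
    rw [q_add, hz] at h1
    have h2 := hp z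
    rw [hz] at h2
    have h3 : z v ≤ K * z v := by
      have : 0 ≤ |symEuler Q u (simRoot Q v)| * z v := mul_nonneg (abs_nonneg _) h2
      rw [hK]; linarith
    rw [smul_eq_mul]
    linarith

def dl (v : Q.V) (z b : Q.V → ℤ) : Q.V → ℤ := (b v - symEuler Q z b) • b
def stp (v : Q.V) (z b : Q.V → ℤ) : Q.V → ℤ := z + dl v z b
def stps (v : Q.V) (z : Q.V → ℤ) (l : List (Q.V → ℤ)) : Q.V → ℤ := l.foldl (stp v) z

lemma stps_append (v : Q.V) (z : Q.V → ℤ) (l l') : stps v z (l ++ l') = stps v (stps v z l) l' :=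
  List.foldl_append
lemma stps_cons (v : Q.V) (z b : Q.V → ℤ) (l) : stps v z (b :: l) = stps v (stp v z b) l := rfl

lemma stp_neg (v : Q.V) (z b : Q.V → ℤ) : stp v z (-b) = stp v z b := by
  rw [stp, stp, dl, dl, sy_neg_right, Pi.neg_apply]; module

lemma g_zero {v : Q.V} {z b : Q.V → ℤ} (hz : z ∈ Vc (cl v)) (hb : RT b) (h : b ∉ Vc (cl v)) :
    b v = 0 ∧ symEuler Q z b = 0 := by
  obtain ⟨c, hc⟩ := hb.sup
  have hne : cl v ≠ c := fun e => h (e ▸ hc)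
  exact ⟨hc v hne, sy_Vc hne hz hc⟩

lemma stp_inv {v : Q.V} {z b : Q.V → ℤ} (hz : z ∈ Vc (cl v)) (hq : euler Q z z = z v) (hb : RT b) :
    stp v z b ∈ Vc (cl v) ∧ euler Q (stp v z b) (stp v z b) = stp v z b v := by
  constructor
  · by_cases h : b ∈ Vc (cl v)
    · exact Submodule.add_mem _ hz (Submodule.smul_mem _ _ h)
    · obtain ⟨h1, h2⟩ := g_zero hz hb h
      rw [stp, dl, h1, h2]; simpa using hz
  · rw [stp, q_add, dl, q_smul, sy_smul_right, hb.q, hq]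
    simp only [Pi.add_apply, Pi.smul_apply, smul_eq_mul]; ring

lemma stps_inv {v : Q.V} {z : Q.V → ℤ} {l : List (Q.V → ℤ)} (hz : z ∈ Vc (cl v))
    (hq : euler Q z z = z v) (hl : ∀ b ∈ l, RT b) :
    stps v z l ∈ Vc (cl v) ∧ euler Q (stps v z l) (stps v z l) = stps v z l v := by
  induction l generalizing z with
  | nil => exact ⟨hz, hq⟩
  | cons b l ih =>
    have := stp_inv hz hq (hl b (by simp))
    exact ih this.1 this.2 (fun a ha => hl a (by simp [ha]))

/-- the final vector is determined -/
lemma stps_chr {v : Q.V} {l : List (Q.V → ℤ)} (h : EExc Q l) :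
    stps v 0 l ∈ spn l ∧ ∀ b ∈ l, euler Q (stps v 0 l) b = b v := by
  induction l using List.reverseRecOn with
  | nil => simp [stps]
  | append_singleton l b ih =>
    obtain ⟨h1, h2⟩ := ih (h.sublist (List.sublist_append_left _ _))
    have h3 : ∀ a ∈ l, euler Q b a = 0 := fun a ha => (List.pairwise_append.1 h.2).2.2 a ha b (by simp)
    have h4 : euler Q b b = 1 := h.1 b (by simp)
    have h5 := euler_spn_right h3 h1
    rw [stps_append]
    change stp v (stps v 0 l) b ∈ _ ∧ ∀ a ∈ _, euler Q (stp v (stps v 0 l) b) a = a v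
    set z := stps v 0 l
    constructor
    · exact Submodule.add_mem _ (spn_mono (by simp +contextual) h1)
        (Submodule.smul_mem _ _ (Submodule.subset_span (by simp)))
    · intro a ha
      rw [stp, dl, euler_add_left, euler_smul_left, symEuler, h5]
      rcases List.mem_append.1 ha with ha | ha
      · rw [h2 a ha, h3 a ha]; ring
      · obtain rfl : a = b := by simpa using ha
        rw [h4]; ring

section Desc
variable {v : Q.V} {lam : (Q.V → ℤ) →ₗ[ℤ] ℤ} {C : ℤ}

def Peak (v : Q.V) (lam : (Q.V → ℤ) →ₗ[ℤ] ℤ) (z : Q.V → ℤ) (l : List (Q.V → ℤ)) : Prop :=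
  ∃ p a b s, l = p ++ a :: b :: s ∧ 0 < lam (dl v (stps v z p) a) ∧
    lam (dl v (stp v (stps v z p) a) b) ≤ 0

lemma Peak.cons {z a : Q.V → ℤ} {l} (h : Peak v lam (stp v z a) l) : Peak v lam z (a :: l) := by
  obtain ⟨p, x, y, s, rfl, h1, h2⟩ := h
  exact ⟨a :: p, x, y, s, rfl, h1, h2⟩

lemma dl_pos (hlam : ∀ x ∈ Vc (cl v), (∀ w, 0 ≤ x w) → x ≠ 0 → 0 < lam x) {z a : Q.V → ℤ}
    (hz : z ∈ Vc (cl v)) (ha : RT a) (ha0 : ∀ w, 0 ≤ a w) :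
    0 < lam (dl v z a) ↔ 0 < a v - symEuler Q z a := by
  rw [dl, map_smul, smul_eq_mul]
  by_cases h : a ∈ Vc (cl v)
  · have := hlam a h ha0 ha.ne_zero
    rw [mul_pos_iff_of_pos_right this]
  · obtain ⟨h1, h2⟩ := g_zero hz ha h
    rw [h1, h2]; simp

lemma up1 (hlam : ∀ x ∈ Vc (cl v), (∀ w, 0 ≤ x w) → x ≠ 0 → 0 < lam x) {z a : Q.V → ℤ} {l}
    (hz : z ∈ Vc (cl v)) (hq : euler Q z z = z v)
    (hl : ∀ b ∈ a :: l, RT b ∧ ∀ w, 0 ≤ b w) (h : 0 < lam (dl v z a)) (hn : ¬ Peak v lam z (a :: l)) :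
    (∀ w, stp v z a w ≤ stps v z (a :: l) w) ∧ (l ≠ [] → lam (stp v z a) < lam (stps v z (a :: l))) := by
  induction l generalizing z a with
  | nil => exact ⟨fun w => le_rfl, fun h => absurd rfl h⟩
  | cons b l ih =>
    obtain ⟨i1, i2⟩ := stp_inv hz hq (hl a (by simp)).1
    have hb : 0 < lam (dl v (stp v z a) b) := by
      by_contra hb
      exact hn ⟨[], a, b, l, rfl, h, not_lt.1 hb⟩
    obtain ⟨j1, j2⟩ := ih i1 i2 (fun x hx => hl x (by simp only [List.mem_cons] at hx ⊢; tauto)) hb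
      (fun hp => hn hp.cons)
    have hg := (dl_pos hlam i1 (hl b (by simp)).1 (hl b (by simp)).2).1 hb
    have k2 : lam (stp v z a) < lam (stp v (stp v z a) b) := by
      rw [stp.eq_1 v (stp v z a) b, map_add]; linarith
    refine ⟨fun w => le_trans ?_ (j1 w), fun _ => ?_⟩
    · have := mul_nonneg hg.le ((hl b (by simp)).2 w)
      rw [stp.eq_1 v (stp v z a) b, dl]
      simp only [Pi.add_apply, Pi.smul_apply, smul_eq_mul]
      linarith
    · rw [stps_cons]
      by_cases hne : l = []
      · subst hne; exact k2
      · exact k2.trans (j2 hne)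

lemma up0 (hlam : ∀ x ∈ Vc (cl v), (∀ w, 0 ≤ x w) → x ≠ 0 → 0 < lam x) {l}
    (hl : ∀ b ∈ l, RT b ∧ ∀ w, 0 ≤ b w) (hn : ¬ Peak v lam 0 l) (he : stps v 0 l = simRoot Q v) :
    ∃ p, l = p ++ [simRoot Q v] ∧ ∀ b ∈ p, b v = 0 := by
  induction l with
  | nil =>
    have := congrFun he v
    rw [simRoot_same] at this
    exact absurd this (by simp [stps])
  | cons a l ih =>
    by_cases h : a v = 0
    · have e : stp v 0 a = 0 := by rw [stp, dl, sy_zero_left, h]; simp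
      rw [stps_cons, e] at he
      obtain ⟨p, rfl, h2⟩ := ih (fun x hx => hl x (by simp [hx])) (fun hp => hn (Peak.cons (by rw [e]; exact hp))) he
      exact ⟨a :: p, rfl, by simpa using ⟨h, h2⟩⟩
    · have hz : (0 : Q.V → ℤ) ∈ Vc (cl v) := Submodule.zero_mem _
      have hq : euler Q (0 : Q.V → ℤ) 0 = (0 : Q.V → ℤ) v := by rw [euler_zero_left]; rfl
      obtain ⟨ha, ha0⟩ := hl a (by simp)
      have hav : 0 < a v := lt_of_le_of_ne (ha0 v) (Ne.symm h)
      obtain ⟨j1, j2⟩ := up1 hlam hz hq hl ((dl_pos hlam hz ha ha0).2 (by rw [sy_zero_left]; simpa using hav)) hn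
      have e : stp v 0 a = a v • a := by rw [stp, dl, sy_zero_left]; simp
      rw [he, e] at j1 j2
      have hae : a = simRoot Q v := by
        have j3 := j1 v
        rw [simRoot_same, Pi.smul_apply, smul_eq_mul] at j3
        have j4 : a v = 1 := by nlinarith
        funext w
        by_cases hw : w = v
        · subst hw; rw [j4, simRoot_same]
        · have := j1 w
          rw [j4, one_smul] at this
          have h0 : simRoot Q v w = 0 := by simp [simRoot, hw]
          rw [h0] at this ⊢
          exact le_antisymm this (ha0 w)
      refine ⟨[], ?_, by simp⟩
      by_cases hne : l = []
      · subst hne; rw [hae]; rfl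
      · have := j2 hne
        rw [hae, simRoot_same, one_smul] at this
        exact absurd this (lt_irrefl _)

def mu (v : Q.V) (lam : (Q.V → ℤ) →ₗ[ℤ] ℤ) (C : ℤ) : (Q.V → ℤ) → List (Q.V → ℤ) → ℕ
  | _, [] => 0
  | z, b :: l => (lam (stp v z b) + C).toNat + mu v lam C (stp v z b) l

lemma mu_lt (hC : ∀ z, euler Q z z = z v → -C ≤ lam z) {z : Q.V → ℤ} {p s} {a b a' b' : Q.V → ℤ}
    (hq : euler Q (stp v (stps v z p) a') (stp v (stps v z p) a') = stp v (stps v z p) a' v)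
    (h1 : stp v (stp v (stps v z p) a') b' = stp v (stp v (stps v z p) a) b)
    (h2 : lam (dl v (stps v z p) a') < lam (dl v (stps v z p) a)) :
    mu v lam C z (p ++ a' :: b' :: s) < mu v lam C z (p ++ a :: b :: s) := by
  induction p generalizing z with
  | nil =>
    simp only [stps, List.foldl_nil] at hq h1 h2
    simp only [List.nil_append, mu, h1]
    have := hC _ hq
    simp only [stp.eq_1 v z, map_add] at this ⊢
    omega
  | cons x p ih =>
    simp only [List.cons_append, mu]
    have := ih (z := stp v z x) hq h1 h2
    omega

end Desc


section Move
variable {v : Q.V} {lam : (Q.V → ℤ) →ₗ[ℤ] ℤ} {C : ℤ}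

lemma stp_opt1 {z a b : Q.V → ℤ} (hb : RT b) :
    stp v (stp v z b) (reflV Q b a) = stp v (stp v z a) b := by
  simp only [stp, dl, refl_apply, sy_add_left, sy_smul_left, sy_sub_right, sy_smul_right, hb.sy,
    Pi.sub_apply, Pi.smul_apply, smul_eq_mul, sy_comm a b]
  module

lemma stp_opt2 {z a b : Q.V → ℤ} (ha : RT a) :
    stp v (stp v z (reflV Q a b)) a = stp v (stp v z a) b := by
  simp only [stp, dl, refl_apply, sy_add_left, sy_smul_left, sy_sub_right, sy_sub_left, sy_smul_right, ha.sy,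
    Pi.sub_apply, Pi.smul_apply, smul_eq_mul, sy_comm b a]
  module

lemma peak_move (hp : PSD Q) (hlam : ∀ x ∈ Vc (cl v), (∀ w, 0 ≤ x w) → x ≠ 0 → 0 < lam x) {z a b : Q.V → ℤ}
    (hz : z ∈ Vc (cl v)) (ha : RT a) (ha0 : ∀ w, 0 ≤ a w) (hb : RT b) (hb0 : ∀ w, 0 ≤ b w)
    (hE : euler Q b a = 0) (h1 : 0 < lam (dl v z a)) (h2 : lam (dl v (stp v z a) b) ≤ 0)
    (hz' : stp v z a ∈ Vc (cl v)) :
    lam (dl v z b) < lam (dl v z a) ∨ lam (dl v z (reflV Q a b)) < lam (dl v z a) := by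
  have hA := (dl_pos hlam hz ha ha0).1 h1
  have hB : b v - symEuler Q (stp v z a) b ≤ 0 := by
    by_contra h
    exact absurd ((dl_pos hlam hz' hb hb0).2 (not_le.1 h)) (not_lt.2 h2)
  have hac : a ∈ Vc (cl v) := by
    by_contra h
    obtain ⟨e1, e2⟩ := g_zero hz ha h
    omega
  have hla := hlam a hac ha0 ha.ne_zero
  set A := a v - symEuler Q z a with hAd
  set B := b v - symEuler Q z b with hBd
  set K := symEuler Q a b with hK
  have e1 : b v - symEuler Q (stp v z a) b = B - K * A := by
    rw [stp, dl, sy_add_left, sy_smul_left]; ring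
  rw [e1] at hB
  have e2 : lam (dl v z a) = A * lam a := by rw [dl, map_smul, smul_eq_mul]
  have e3 : lam (dl v z b) = B * lam b := by rw [dl, map_smul, smul_eq_mul]
  have e4 : lam (dl v z (reflV Q a b)) = (B - K * A) * (lam b - K * lam a) := by
    rw [dl, map_smul, refl_apply, map_sub, map_smul, smul_eq_mul, smul_eq_mul, sy_sub_right, sy_smul_right]
    simp only [Pi.sub_apply, Pi.smul_apply, smul_eq_mul]
    rw [hBd, hAd]; ring
  rw [e2, e3, e4]
  by_cases hbc : b ∈ Vc (cl v)
  swap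
  · obtain ⟨e5, e6⟩ := g_zero hz hb hbc
    left
    have : B = 0 := by omega
    rw [this, zero_mul]
    exact mul_pos hA hla
  have hlb := hlam b hbc hb0 hb.ne_zero
  by_cases hB0 : B ≤ 0
  · left
    nlinarith [mul_pos hA hla]
  push Not at hB0
  have hK2 : K ≤ 2 := by
    have := hp (a - b)
    rw [q_sub, ha.q, hb.q] at this
    omega
  have hK0 : 0 < K := by
    by_contra h
    nlinarith
  have hK' : K = 1 ∨ K = 2 := by omega
  rcases hK' with hK1 | hK1
  · right
    rw [hK1] at hB ⊢
    nlinarith [mul_pos hB0 hla, mul_nonneg (by linarith : 0 ≤ A - B) hlb.le]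
  · have hq : euler Q (a - b) (a - b) = 0 := by
      rw [q_sub, ha.q, hb.q, ← hK, hK1]; rfl
    have hne : a - b ≠ 0 := fun h => by
      rw [sub_eq_zero.1 h, hb.q] at hE
      simp at hE
    have hc : a - b ∈ Vc (cl v) := Submodule.sub_mem _ hac hbc
    have hv : (a - b) v = A - B := by
      have := rad_of_q hp hq z
      rw [sy_comm, sy_sub_right] at this
      rw [Pi.sub_apply]; linarith
    rw [hK1] at hB ⊢
    rcases coherent hp hc (by rw [hq]; norm_num) with h | h
    · left
      have h3 := hlam _ hc h hne
      have h4 := h v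
      rw [hv] at h4
      rw [map_sub] at h3
      nlinarith [mul_nonneg h4 hlb.le, mul_pos hA h3]
    · right
      have h3 := hlam (-(a - b)) (Submodule.neg_mem _ hc) (fun w => by have := h w; simp at this ⊢; linarith)
        (neg_ne_zero.2 hne)
      have h4 := h v
      rw [hv] at h4
      rw [map_neg, map_sub] at h3
      obtain ⟨r, hr⟩ : ∃ r, r = lam b - lam a := ⟨_, rfl⟩
      obtain ⟨s, hs⟩ : ∃ s, s = B - A := ⟨_, rfl⟩
      have hlb' : lam b = lam a + r := by linarith
      have hB' : B = A + s := by linarith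
      rw [hlb', hB'] at *
      have hr0 : 0 < r := by linarith
      have hs0 : 0 ≤ s := by linarith
      have hsa : s ≤ A := by linarith
      rcases hs0.eq_or_lt with h0 | h0
      · subst s
        nlinarith [mul_pos hA hr0]
      · nlinarith [mul_pos h0 hla, mul_nonneg (by linarith : 0 ≤ A - s) hr0.le]

end Move

lemma EExc_append {p s : List (Q.V → ℤ)} : EExc Q (p ++ s) ↔ EExc Q p ∧ EExc Q s ∧
    ∀ a ∈ p, ∀ b ∈ s, euler Q b a = 0 := by
  simp only [EExc, List.mem_append, List.pairwise_append]
  constructor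
  · rintro ⟨h1, h2, h3, h4⟩
    exact ⟨⟨fun M h => h1 M (Or.inl h), h2⟩, ⟨fun M h => h1 M (Or.inr h), h3⟩, h4⟩
  · rintro ⟨⟨h1, h2⟩, ⟨h3, h4⟩, h5⟩
    exact ⟨fun M h => h.elim (h1 M) (h3 M), h2, h4, h5⟩

lemma EExc_pair {p s : List (Q.V → ℤ)} {a b : Q.V → ℤ} : EExc Q (p ++ a :: b :: s) ↔
    EExc Q p ∧ EExc Q s ∧ (∀ x ∈ p, ∀ y ∈ s, euler Q y x = 0) ∧ euler Q a a = 1 ∧ euler Q b b = 1 ∧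
    euler Q b a = 0 ∧ (∀ x ∈ p, euler Q a x = 0 ∧ euler Q b x = 0) ∧
      (∀ y ∈ s, euler Q y a = 0 ∧ euler Q y b = 0) := by
  rw [EExc_append, EExc.cons_iff, EExc.cons_iff]
  simp only [List.mem_cons, forall_eq_or_imp]
  constructor
  · rintro ⟨h1, ⟨h2, ⟨h3, h4⟩, h5, h6, h7⟩, h8⟩
    exact ⟨h1, h7, fun x hx => (h8 x hx).2.2, h2, h5, h3, fun x hx => ⟨(h8 x hx).1, (h8 x hx).2.1⟩,
      fun y hy => ⟨h4 y hy, h6 y hy⟩⟩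
  · rintro ⟨h1, h2, h3, h4, h5, h6, h7, h8⟩
    exact ⟨h1, ⟨h4, ⟨h6, fun y hy => (h8 y hy).1⟩, h5, fun y hy => (h8 y hy).2, h2⟩,
      fun x hx => ⟨(h7 x hx).1, (h7 x hx).2, h3 x hx⟩⟩

open scoped Classical in
def pos (b : Q.V → ℤ) : Q.V → ℤ := if ∀ v, 0 ≤ b v then b else -b

lemma pos_cases (b : Q.V → ℤ) : pos b = b ∨ pos b = -b := by
  unfold pos; split_ifs <;> simp

lemma pos_nonneg (hp : PSD Q) {b : Q.V → ℤ} (hb : RT b) (v : Q.V) : 0 ≤ pos b v := by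
  obtain ⟨c, hc⟩ := hb.sup
  unfold pos
  split_ifs with h
  · exact h v
  · have := (coherent hp hc hb.q.le).resolve_left h v
    simpa using this

lemma RT.pos {b : Q.V → ℤ} (hb : RT b) : RT (pos b) := by
  rcases pos_cases b with h | h <;> rw [h]
  exacts [hb, hb.neg]

lemma refl_pos (b : Q.V → ℤ) : reflV Q (pos b) = reflV Q b := by
  rcases pos_cases b with h | h <;> rw [h]
  exact refl_neg b

lemma euler_pos_left {b x : Q.V → ℤ} : euler Q (pos b) x = 0 ↔ euler Q b x = 0 := by
  rcases pos_cases b with h | h <;> rw [h]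
  rw [euler_neg_left, neg_eq_zero]
lemma euler_pos_right {b x : Q.V → ℤ} : euler Q x (pos b) = 0 ↔ euler Q x b = 0 := by
  rcases pos_cases b with h | h <;> rw [h]
  rw [euler_neg_right, neg_eq_zero]

lemma EExc.pos {l : List (Q.V → ℤ)} (h : EExc Q l) : EExc Q (l.map pos) := by
  constructor
  · intro b hb
    obtain ⟨a, ha, rfl⟩ := List.mem_map.1 hb
    rcases pos_cases a with e | e <;> rw [e]
    · exact h.1 a ha
    · rw [q_neg]; exact h.1 a ha
  · rw [List.pairwise_map]
    exact h.2.imp (fun {a b} e => by rwa [euler_pos_left, euler_pos_right])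

lemma EExc.opt1 {p s : List (Q.V → ℤ)} {a b : Q.V → ℤ} (ha : RT a) (hb : RT b) (h : EExc Q (p ++ a :: b :: s)) :
    EExc Q (p ++ b :: NCPaper.pos (reflV Q b a) :: s) := by
  rw [EExc_pair] at h ⊢
  obtain ⟨h1, h2, h3, h4, h5, h6, h7, h8⟩ := h
  refine ⟨h1, h2, h3, h5, (ha.refl hb).pos.q, ?_, ?_, ?_⟩
  · rw [euler_pos_left, refl_apply, euler_sub_left, euler_smul_left, h5, symEuler, h6]; ring
  · intro x hx
    refine ⟨(h7 x hx).2, ?_⟩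
    rw [euler_pos_left, refl_apply, euler_sub_left, euler_smul_left, (h7 x hx).1, (h7 x hx).2]; ring
  · intro x hx
    refine ⟨(h8 x hx).2, ?_⟩
    rw [euler_pos_right, refl_apply, euler_sub_right, euler_smul_right, (h8 x hx).1, (h8 x hx).2]; ring

lemma EExc.opt2 {p s : List (Q.V → ℤ)} {a b : Q.V → ℤ} (ha : RT a) (hb : RT b) (h : EExc Q (p ++ a :: b :: s)) :
    EExc Q (p ++ NCPaper.pos (reflV Q a b) :: a :: s) := by
  rw [EExc_pair] at h ⊢
  obtain ⟨h1, h2, h3, h4, h5, h6, h7, h8⟩ := h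
  refine ⟨h1, h2, h3, (hb.refl ha).pos.q, h4, ?_, ?_, ?_⟩
  · rw [euler_pos_right, refl_apply, euler_sub_right, euler_smul_right, h4, symEuler, h6]; ring
  · intro x hx
    refine ⟨?_, (h7 x hx).1⟩
    rw [euler_pos_left, refl_apply, euler_sub_left, euler_smul_left, (h7 x hx).1, (h7 x hx).2]; ring
  · intro x hx
    refine ⟨?_, (h8 x hx).1⟩
    rw [euler_pos_right, refl_apply, euler_sub_right, euler_smul_right, (h8 x hx).1, (h8 x hx).2]; ring

lemma stp_pos (v : Q.V) (z b : Q.V → ℤ) : stp v z (pos b) = stp v z b := by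
  rcases pos_cases b with h | h <;> rw [h]
  exact stp_neg v z b
lemma dl_pos' (v : Q.V) (z b : Q.V → ℤ) : dl v z (pos b) = dl v z b := by
  have := stp_pos v z b
  exact add_left_cancel this

def Real (k : Type) [Field k] (L : List (Q.V → ℤ)) : Prop :=
  ∃ Ms : List (RepC k Q), ExcList Ms ∧ Ms.map dimVec = L

lemma ExcList.sublist {l l' : List (RepC k Q)} (h : ExcList l) (hs : l'.Sublist l) : ExcList l' :=
  ⟨fun b hb => h.1 b (hs.subset hb), h.2.sublist hs⟩

lemma Real.del {p s : List (Q.V → ℤ)} {x : Q.V → ℤ} (h : Real k (p ++ x :: s)) : Real k (p ++ s) := by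
  obtain ⟨Ms, h1, h2⟩ := h
  obtain ⟨P, S', rfl, rfl, h3⟩ := List.map_eq_append_iff.1 h2
  obtain ⟨X, S, rfl, rfl, rfl⟩ := List.map_eq_cons_iff.1 h3
  exact ⟨P ++ S, h1.sublist (List.Sublist.append_left (List.sublist_cons_self _ _) _), by simp⟩

lemma Real.ins [IsAlgClosed k] {ord : Fin (Fintype.card Q.V) ≃ Q.V} (hord : OrdCompatible Q ord)
    (hp : PSD Q) {p s : List (Q.V → ℤ)} {a : Q.V → ℤ} (ha : ∀ v, 0 ≤ a v)
    (hE : EExc Q (p ++ a :: s)) (hn : (p ++ a :: s).length = Fintype.card Q.V) (h : Real k (p ++ s)) :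
    Real k (p ++ a :: s) := by
  obtain ⟨Ms, h1, h2⟩ := h
  obtain ⟨P, S, rfl, rfl, rfl⟩ := List.map_eq_append_iff.1 h2
  rw [EExc_append, EExc.cons_iff] at hE
  obtain ⟨-, ⟨hq, e1, -⟩, e2⟩ := hE
  obtain ⟨Z, hZ, hd⟩ := exc_insert hord hp h1 (v := a) (by simp at hn; omega) hq
    (fun M hM => e1 _ (List.mem_map_of_mem hM)) (fun M hM => e2 _ (List.mem_map_of_mem hM) a (by simp))
  refine ⟨_, hZ, ?_⟩
  have : dimVec Z = a := by
    rcases hd with h | h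
    · exact h
    · funext v
      have h3 := dimVec_nonneg Z v
      have h4 := ha v
      have h5 := congrFun h v
      rw [Pi.neg_apply] at h5
      omega
  simp [this]


section HK
variable {ord : Fin (Fintype.card Q.V) ≃ Q.V}

def Sp (ord : Fin (Fintype.card Q.V) ≃ Q.V) (m : ℕ) : Submodule ℤ (Q.V → ℤ) where
  carrier := {x | ∀ j, m ≤ j.1 → x (ord j) = 0}
  add_mem' := fun ha hb v hv => by simp [ha v hv, hb v hv]
  zero_mem' := fun v _ => rfl
  smul_mem' := fun r x hx v hv => by simp [hx v hv]

lemma euler_ord (hord : OrdCompatible Q ord) {i j : Fin (Fintype.card Q.V)} (h : i < j) :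
    euler Q (simRoot Q (ord j)) (simRoot Q (ord i)) = 0 := by
  have := (sroots_eexc hord).2
  rw [sroots, List.pairwise_ofFn] at this
  exact this h

lemma euler_sum_right (x y : Q.V → ℤ) : euler Q x y = ∑ v, y v * euler Q x (simRoot Q v) := by
  conv_lhs => rw [sum_simRoot y]
  change eL Q x _ = _
  rw [map_sum]
  simp only [map_smul]
  rfl

lemma euler_late (hord : OrdCompatible Q ord) {j : Fin (Fintype.card Q.V)} {x : Q.V → ℤ} (hx : x ∈ Sp ord (j.1 + 1)) :
    euler Q (simRoot Q (ord j)) x = x (ord j) := by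
  rw [euler_sum_right, Finset.sum_eq_single (ord j)]
  · rw [euler_simRoot_self hord, mul_one]
  · intro w _ hw
    obtain ⟨i, rfl⟩ := ord.surjective w
    have hij : i ≠ j := fun h => hw (by rw [h])
    rcases lt_or_gt_of_ne hij with h | h
    · rw [euler_ord hord h, mul_zero]
    · rw [hx i h, zero_mul]
  · simp

lemma mem_drop_sroots {m : ℕ} {b : Q.V → ℤ} (h : b ∈ (sroots ord).drop m) :
    ∃ j : Fin (Fintype.card Q.V), m ≤ j.1 ∧ b = simRoot Q (ord j) := by
  obtain ⟨i, hi, rfl⟩ := List.mem_drop_iff_getElem.1 h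
  have : i + m < Fintype.card Q.V := by simpa [sroots] using hi
  exact ⟨⟨m + i, by omega⟩, by simp, by simp [sroots]⟩

lemma EExc.drop (hord : OrdCompatible Q ord) {m : ℕ} {l : List (Q.V → ℤ)} (h : EExc Q l)
    (hl : ∀ b ∈ l, b ∈ Sp ord m) : EExc Q (l ++ (sroots ord).drop m) := by
  rw [EExc_append]
  refine ⟨h, (sroots_eexc hord).sublist (List.drop_sublist _ _), ?_⟩
  intro a ha b hb
  obtain ⟨j, hj, rfl⟩ := mem_drop_sroots hb
  rw [euler_late hord (fun i hi => hl a ha i (by omega)), hl a ha j hj]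

lemma finrank_Sp {m : ℕ} (hm : m ≤ Fintype.card Q.V) : Module.finrank ℤ (Sp ord m) ≤ m := by
  have := finrank_le_fns (L := Sp ord m) (List.ofFn (fun i : Fin m => (LinearMap.proj (ord ⟨i.1, by omega⟩) : (Q.V → ℤ) →ₗ[ℤ] ℤ))) (by
    intro x hx h0
    funext w
    obtain ⟨i, rfl⟩ := ord.surjective w
    by_cases hi : m ≤ i.1
    · exact hx i hi
    · exact h0 (LinearMap.proj (ord i)) ((List.mem_ofFn' _ _).2 ⟨⟨i.1, by omega⟩, rfl⟩))
  simpa using this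

lemma stps_final (hord : OrdCompatible Q ord) {m : ℕ} (hm : m < Fintype.card Q.V) {l : List (Q.V → ℤ)} (h : EExc Q l)
    (hl : ∀ b ∈ l, b ∈ Sp ord (m + 1)) (hlen : l.length = m + 1) :
    stps (ord ⟨m, hm⟩) 0 l = simRoot Q (ord ⟨m, hm⟩) := by
  set v := ord ⟨m, hm⟩ with hv
  obtain ⟨h1, h2⟩ := stps_chr (v := v) h
  have hle : spn l ≤ Sp ord (m + 1) := Submodule.span_le.2 hl
  have hev : simRoot Q v ∈ Sp ord (m + 1) := by
    intro j hj
    have : ord j ≠ v := fun e => by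
      have := ord.injective e
      rw [this] at hj
      simp at hj
    simp [simRoot, this]
  set d := stps v 0 l - simRoot Q v with hd
  have hdS : d ∈ Sp ord (m + 1) := Submodule.sub_mem _ (hle h1) hev
  have hd0 : ∀ b ∈ l, euler Q d b = 0 := by
    intro b hb
    rw [hd, euler_sub_left, h2 b hb, hv, euler_late hord (hl b hb), sub_self]
  obtain ⟨a, ha, hx⟩ := tors ((spn l).comap (Sp ord (m + 1)).subtype) (by
    rw [(Submodule.comapSubtypeEquivOfLe hle).finrank_eq, h.finrank, hlen]
    exact finrank_Sp hm) ⟨d, hdS⟩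
  have hx' : a • d ∈ spn l := hx
  have := h.nondeg _ hx' (fun y hy => by
    rw [euler_smul_left, euler_spn_right hd0 hy, mul_zero])
  exact sub_eq_zero.1 ((smul_eq_zero.1 this).resolve_left ha)

lemma Sp_refl {m : ℕ} {a b : Q.V → ℤ} (ha : a ∈ Sp ord m) (hb : b ∈ Sp ord m) : pos (reflV Q b a) ∈ Sp ord m := by
  have : reflV Q b a ∈ Sp ord m := Submodule.sub_mem _ ha (Submodule.smul_mem _ _ hb)
  rcases pos_cases (reflV Q b a) with h | h <;> rw [h]
  exacts [this, Submodule.neg_mem _ this]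

theorem real_step [IsAlgClosed k] (hord : OrdCompatible Q ord) (hp : PSD Q) {m : ℕ} (hm : m < Fintype.card Q.V)
    (IH : ∀ l : List (Q.V → ℤ), EExc Q l → (∀ b ∈ l, RT b ∧ ∀ w, 0 ≤ b w) → (∀ b ∈ l, b ∈ Sp ord m) →
      l.length = m → Real k (l ++ (sroots ord).drop m))
    (l : List (Q.V → ℤ)) (hE : EExc Q l) (hl : ∀ b ∈ l, RT b ∧ ∀ w, 0 ≤ b w) (hs : ∀ b ∈ l, b ∈ Sp ord (m + 1))
    (hlen : l.length = m + 1) : Real k (l ++ (sroots ord).drop (m + 1)) := by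
  set v := ord ⟨m, hm⟩ with hv
  obtain ⟨lam, C, hlam, hC⟩ := exists_lam hp v
  induction hN : mu v lam C 0 l using Nat.strong_induction_on generalizing l with
  | _ N ih =>
    subst hN
    have hz : (0 : Q.V → ℤ) ∈ Vc (cl v) := Submodule.zero_mem _
    have hq : euler Q (0 : Q.V → ℤ) 0 = (0 : Q.V → ℤ) v := by rw [euler_zero_left]; rfl
    have hslen : (sroots ord).length = Fintype.card Q.V := by simp [sroots]
    by_cases hpk : Peak v lam 0 l
    · obtain ⟨p, a, b, s, rfl, h1, h2⟩ := hpk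
      have hED := hE.drop hord hs
      have hlenD : ((p ++ a :: b :: s) ++ (sroots ord).drop (m + 1)).length = Fintype.card Q.V := by
        rw [List.length_append, hlen, List.length_drop, hslen]; omega
      obtain ⟨ha, ha0⟩ := hl a (by simp)
      obtain ⟨hb, hb0⟩ := hl b (by simp)
      have hsa := hs a (by simp)
      have hsb := hs b (by simp)
      obtain ⟨i1, i2⟩ := stps_inv (l := p) hz hq (fun b hb => (hl b (by simp [hb])).1)
      rcases peak_move hp hlam i1 ha ha0 hb hb0 (EExc_pair.1 hE).2.2.2.2.2.1 h1 h2 (stp_inv i1 i2 ha).1 with h3 | h3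
      · have key := ih _ (mu_lt hC (s := s) (b' := pos (reflV Q b a)) (stp_inv i1 i2 hb).2
          (by rw [stp_pos, stp_opt1 hb]) h3) _ (hE.opt1 ha hb)
          (by
            intro x hx
            simp only [List.mem_append, List.mem_cons] at hx
            rcases hx with hx | rfl | rfl | hx
            · exact hl x (by simp [hx])
            · exact ⟨hb, hb0⟩
            · exact ⟨(ha.refl hb).pos, pos_nonneg hp (ha.refl hb)⟩
            · exact hl x (by simp [hx]))
          (by
            intro x hx
            simp only [List.mem_append, List.mem_cons] at hx
            rcases hx with hx | rfl | rfl | hx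
            · exact hs x (by simp [hx])
            · exact hsb
            · exact Sp_refl hsa hsb
            · exact hs x (by simp [hx]))
          (by simpa using hlen) rfl
        have k1 : Real k (p ++ b :: (s ++ (sroots ord).drop (m + 1))) := by
          have : Real k ((p ++ [b]) ++ pos (reflV Q b a) :: (s ++ (sroots ord).drop (m + 1))) := by simpa using key
          simpa using this.del
        have k2 := Real.ins hord hp (p := p) (a := a) (s := b :: (s ++ (sroots ord).drop (m + 1))) ha0
          (by simpa using hED) (by simpa using hlenD) k1
        simpa using k2
      · have key := ih _ (mu_lt hC (s := s) (a' := pos (reflV Q a b)) (b' := a) (stp_inv i1 i2 (hb.refl ha).pos).2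
          (by rw [stp_pos, stp_opt2 ha]) (by rw [dl_pos']; exact h3)) _ (hE.opt2 ha hb)
          (by
            intro x hx
            simp only [List.mem_append, List.mem_cons] at hx
            rcases hx with hx | rfl | rfl | hx
            · exact hl x (by simp [hx])
            · exact ⟨(hb.refl ha).pos, pos_nonneg hp (hb.refl ha)⟩
            · exact ⟨ha, ha0⟩
            · exact hl x (by simp [hx]))
          (by
            intro x hx
            simp only [List.mem_append, List.mem_cons] at hx
            rcases hx with hx | rfl | rfl | hx
            · exact hs x (by simp [hx])
            · exact Sp_refl hsb hsa
            · exact hsa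
            · exact hs x (by simp [hx]))
          (by simpa using hlen) rfl
        have k1 : Real k ((p ++ [a]) ++ (s ++ (sroots ord).drop (m + 1))) := by
          have : Real k (p ++ pos (reflV Q a b) :: (a :: s ++ (sroots ord).drop (m + 1))) := by simpa using key
          simpa using this.del
        have k2 := Real.ins hord hp (p := p ++ [a]) (a := b) (s := s ++ (sroots ord).drop (m + 1)) hb0
          (by simpa using hED) (by simpa using hlenD) k1
        simpa using k2
    · obtain ⟨p, rfl, hpv⟩ := up0 hlam hl hpk (stps_final hord hm hE hs hlen)
      have := IH p (hE.sublist (List.sublist_append_left _ _)) (fun b hb => hl b (by simp [hb])) (by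
        intro b hb j hj
        by_cases hjm : m = j.1
        · have : j = ⟨m, hm⟩ := Fin.ext hjm.symm
          rw [this]; exact hpv b hb
        · exact hs b (by simp [hb]) j (by omega)) (by simpa using hlen)
      rw [List.drop_eq_getElem_cons (by omega)] at this
      simpa [sroots] using this

theorem real_all [IsAlgClosed k] (hord : OrdCompatible Q ord) (hp : PSD Q) (m : ℕ) (hm : m ≤ Fintype.card Q.V) :
    ∀ l : List (Q.V → ℤ), EExc Q l → (∀ b ∈ l, RT b ∧ ∀ w, 0 ≤ b w) → (∀ b ∈ l, b ∈ Sp ord m) →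
      l.length = m → Real k (l ++ (sroots ord).drop m) := by
  induction m with
  | zero =>
    intro l _ _ _ h
    obtain rfl := List.length_eq_zero_iff.1 h
    exact ⟨smps k ord, smps_exc hord, by simpa using map_smps ord⟩
  | succ m ih => exact real_step hord hp hm (ih (by omega))

theorem real_thm [IsAlgClosed k] (hord : OrdCompatible Q ord) (hp : PSD Q) {l : List (Q.V → ℤ)}
    (hE : EExc Q l) (hl : ∀ b ∈ l, RT b) (hlen : l.length = Fintype.card Q.V) : Real k (l.map pos) := by
  have := real_all (k := k) hord hp _ le_rfl (l.map pos) hE.pos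
    (fun b hb => by
      obtain ⟨a, ha, rfl⟩ := List.mem_map.1 hb
      exact ⟨(hl a ha).pos, pos_nonneg hp (hl a ha)⟩)
    (fun b _ j hj => absurd j.2 (by omega)) (by simpa using hlen)
  rwa [List.drop_eq_nil_of_le (by simp [sroots]), List.append_nil] at this

end HK

lemma Exc.RT {M : RepC k Q} (h : Exc M) : RT (dimVec M) := by
  classical
  refine ⟨h.q, ?_⟩
  have hex : ∃ v, dimVec M v ≠ 0 := by
    by_contra hc
    push Not at hc
    apply h.not_isZero
    apply isZero_of_tdim h.fd
    zify
    rw [tdim_eq]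
    exact Finset.sum_eq_zero fun v _ => hc v
  obtain ⟨v, hv⟩ := hex
  refine ⟨cl v, fun w hw => ?_⟩
  let f : C0 M M := fun w => if cl w = cl v then LinearMap.id else 0
  have hf : ∀ x y (a : x ⟶ y), f y ∘ₗ mp M a = mp M a ∘ₗ f x := by
    intro x y a
    simp only [f, cl_arr a]
    split_ifs <;> simp
  obtain ⟨c, hc⟩ := h.scalar (toHom f hf)
  have key : ∀ u (x : ob M u), f u x = c • x := by
    intro u x
    have := congrArg (fun g => cm g u x) hc
    exact this
  have hc1 : c = 1 := by
    have hne : Module.finrank k (ob M v) ≠ 0 := fun h0 => hv (by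
      change ((Module.finrank k (ob M v) : ℕ) : ℤ) = 0
      rw [h0]; rfl)
    have : Nontrivial (ob M v) := Module.nontrivial_of_finrank_pos (Nat.pos_of_ne_zero hne)
    obtain ⟨x, hx⟩ := exists_ne (0 : ob M v)
    have h1 := key v x
    simp only [f, if_true, LinearMap.id_apply] at h1
    have h2 : (c - 1) • x = 0 := by rw [sub_smul, one_smul, ← h1, sub_self]
    rcases smul_eq_zero.1 h2 with h3 | h3
    · exact sub_eq_zero.1 h3
    · exact absurd h3 hx
  have hs : Subsingleton (ob M w) := by
    refine ⟨fun x y => ?_⟩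
    have h1 := key w x
    have h2 := key w y
    simp only [f, if_neg hw, hc1, one_smul, LinearMap.zero_apply] at h1 h2
    rw [← h1, ← h2]
  change ((Module.finrank k (ob M w) : ℕ) : ℤ) = 0
  rw [Module.finrank_zero_of_subsingleton]; rfl

lemma Exc.pos_dim {M : RepC k Q} : pos (dimVec M) = dimVec M := by
  rw [pos, if_pos (fun v => dimVec_nonneg M v)]

lemma ExcList.RT {l : List (RepC k Q)} (h : ExcList l) : ∀ b ∈ l.map dimVec, RT b := by
  intro b hb
  obtain ⟨M, hM, rfl⟩ := List.mem_map.1 hb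
  exact (h.1 M hM).RT

lemma rfs_map_pos (l : List (Q.V → ℤ)) : rfs Q (l.map pos) = rfs Q l := by
  induction l with
  | nil => rfl
  | cons b l ih => rw [List.map_cons, rfs_cons, rfs_cons, ih, refl_pos]

lemma rfs_surj {l : List (Q.V → ℤ)} (hl : ∀ b ∈ l, NCPaper.RT b) : Function.Surjective (rfs Q l) := by
  induction l with
  | nil => exact Function.surjective_id
  | cons b l ih =>
    rw [rfs_cons]
    exact Function.Surjective.comp (fun x => ⟨_, refl_refl (hl b (by simp)) x⟩)
      (ih fun a ha => hl a (by simp [ha]))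

lemma conj_one {a : Q.V → ℤ} (ha : NCPaper.RT a) (l : List (Q.V → ℤ)) :
    rfs Q l ∘ reflV Q a = reflV Q a ∘ rfs Q (l.map (reflV Q a)) := by
  induction l with
  | nil => rfl
  | cons b l ih =>
    rw [rfs_cons, Function.comp_assoc, ih, List.map_cons, rfs_cons, refl_conj ha]
    funext x
    simp only [Function.comp_apply, refl_refl ha]

lemma conj_list {s : List (Q.V → ℤ)} (hs : ∀ b ∈ s, NCPaper.RT b) : ∀ {l : List (Q.V → ℤ)}
    (_ : ∀ b ∈ l, NCPaper.RT b), ∃ l' : List (Q.V → ℤ), (∀ b ∈ l', NCPaper.RT b) ∧ l'.length = l.length ∧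
      rfs Q l ∘ rfs Q s = rfs Q s ∘ rfs Q l' := by
  induction s with
  | nil => exact fun {l} hl => ⟨l, hl, rfl, rfl⟩
  | cons a s ih =>
    intro l hl
    have ha := hs a (by simp)
    obtain ⟨l', h1, h2, h3⟩ := ih (fun b hb => hs b (by simp [hb])) (l := l.map (reflV Q a)) (by
      intro b hb
      obtain ⟨b', hb', rfl⟩ := List.mem_map.1 hb
      exact (hl b' hb').refl ha)
    refine ⟨l', h1, by simpa using h2, ?_⟩
    rw [rfs_cons, ← Function.comp_assoc, conj_one ha, Function.comp_assoc, h3, Function.comp_assoc]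

section EllT
variable {ord : Fin (Fintype.card Q.V) ≃ Q.V}

lemma mem_ell (hord : OrdCompatible Q ord) (hp : PSD Q) {w : (Q.V → ℤ) → (Q.V → ℤ)} {m : ℕ} :
    (∃ f : Fin m → ((Q.V → ℤ) → (Q.V → ℤ)), (∀ i, IsRefl Q (f i)) ∧ w = comps Q f) ↔
    ∃ l : List (Q.V → ℤ), (∀ b ∈ l, NCPaper.RT b) ∧ l.length = m ∧ w = rfs Q l := by
  have hno := euler_simRoot_self hord
  constructor
  · rintro ⟨f, hf, rfl⟩
    choose g hg he using fun i => RT_of_isRefl hno (hf i)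
    refine ⟨List.ofFn g, ?_, by simp, ?_⟩
    · intro b hb
      obtain ⟨i, rfl⟩ := (List.mem_ofFn' _ _).1 hb
      exact hg i
    · rw [← comps_eq]
      congr 1
      funext i
      exact he i
  · rintro ⟨l, hl, rfl, rfl⟩
    refine ⟨fun i => reflV Q (l.get i), fun i => isRefl_of_RT hno hp (hl _ (List.get_mem _ _)), ?_⟩
    rw [comps_eq, List.ofFn_get]

lemma ell_le (hord : OrdCompatible Q ord) (hp : PSD Q) {l : List (Q.V → ℤ)}
    (hl : ∀ b ∈ l, NCPaper.RT b) : ellT Q (rfs Q l) ≤ l.length :=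
  Nat.sInf_le ((mem_ell hord hp).2 ⟨l, hl, rfl, rfl⟩)

lemma ell_min (hord : OrdCompatible Q ord) (hp : PSD Q) {l : List (Q.V → ℤ)}
    (hl : ∀ b ∈ l, NCPaper.RT b) : ∃ m : List (Q.V → ℤ), (∀ b ∈ m, NCPaper.RT b) ∧
      m.length = ellT Q (rfs Q l) ∧ rfs Q l = rfs Q m :=
  (mem_ell hord hp).1 (Nat.sInf_mem (s := { m | ∃ f : Fin m → ((Q.V → ℤ) → (Q.V → ℤ)),
    (∀ i, IsRefl Q (f i)) ∧ rfs Q l = comps Q f }) ⟨_, (mem_ell hord hp).2 ⟨l, hl, rfl, rfl⟩⟩)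

lemma ell_prefix (hord : OrdCompatible Q ord) (hp : PSD Q) {l l' : List (Q.V → ℤ)}
    (hl : ∀ b ∈ l ++ l', NCPaper.RT b) (hc : coxeter Q ord = rfs Q (l ++ l'))
    (hlen : (l ++ l').length = Fintype.card Q.V) : ellT Q (rfs Q l) = l.length := by
  have h1 : ∀ b ∈ l, NCPaper.RT b := fun b hb => hl b (by simp [hb])
  apply le_antisymm (ell_le hord hp h1)
  obtain ⟨m, hm, hml, he⟩ := ell_min hord hp h1
  rw [rfs_append, he, ← rfs_append] at hc
  have := (L3 hord hp (by
    intro b hb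
    rcases List.mem_append.1 hb with h | h
    exacts [hm b h, hl b (by simp [h])]) hc).1
  simp only [List.length_append] at this hlen
  omega

lemma chain (hord : OrdCompatible Q ord) (hp : PSD Q) {l3 : List (Q.V → ℤ)} : ∀ (l2 l1 : List (Q.V → ℤ)),
    (∀ b ∈ l1 ++ l2 ++ l3, NCPaper.RT b) → coxeter Q ord = rfs Q (l1 ++ l2 ++ l3) →
    (l1 ++ l2 ++ l3).length = Fintype.card Q.V → absLe Q (rfs Q l1) (rfs Q (l1 ++ l2)) := by
  intro l2
  induction l2 with
  | nil => intro l1 _ _ _; rw [List.append_nil]; exact Relation.ReflTransGen.refl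
  | cons b l2 ih =>
    intro l1 h1 h2 h3
    have e : l1 ++ b :: l2 = (l1 ++ [b]) ++ l2 := by simp
    rw [e] at h1 h2 h3 ⊢
    refine Relation.ReflTransGen.head ?_ (ih _ h1 h2 h3)
    refine ⟨reflV Q b, isRefl_of_RT (euler_simRoot_self hord) hp (h1 b (by simp)), ?_, ?_⟩
    · rw [rfs_append]; rfl
    · have e1 := ell_prefix hord hp (l := l1) (l' := b :: (l2 ++ l3)) (by simpa using h1) (by simpa using h2)
        (by simpa using h3)
      have e2 := ell_prefix hord hp (l := l1 ++ [b]) (l' := l2 ++ l3) (by simpa using h1) (by simpa using h2)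
        (by simpa using h3)
      rw [e1, e2]; simp

lemma absLe_fac (hord : OrdCompatible Q ord) {u v : (Q.V → ℤ) → (Q.V → ℤ)} (h : absLe Q u v) :
    ∃ l : List (Q.V → ℤ), (∀ b ∈ l, NCPaper.RT b) ∧ v = u ∘ rfs Q l ∧ ellT Q v = ellT Q u + l.length := by
  induction h with
  | refl => exact ⟨[], by simp, rfl, rfl⟩
  | tail _ h ih =>
    obtain ⟨l, h1, h2, h3⟩ := ih
    obtain ⟨t, ht, h4, h5⟩ := h
    obtain ⟨b, hb, rfl⟩ := RT_of_isRefl (euler_simRoot_self hord) ht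
    refine ⟨l ++ [b], ?_, ?_, ?_⟩
    · intro a ha
      rcases List.mem_append.1 ha with h | h
      · exact h1 a h
      · rw [List.mem_singleton.1 h]; exact hb
    · rw [h4, h2, rfs_append]; rfl
    · rw [h5, h3, List.length_append, List.length_singleton, add_assoc]

lemma ell_cox (hord : OrdCompatible Q ord) (hp : PSD Q) : ellT Q (coxeter Q ord) = Fintype.card Q.V := by
  rw [coxeter_eq, ell_prefix hord hp (l' := [])]
  · simp [sroots]
  · simpa using sroots_RT hord
  · simp [coxeter_eq]
  · simp [sroots]

lemma nc_fac (hord : OrdCompatible Q ord) (hp : PSD Q) {l : List (Q.V → ℤ)} (hl : ∀ b ∈ l, NCPaper.RT b)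
    (h : absLe Q (rfs Q l) (coxeter Q ord)) (hlen : l.length = ellT Q (rfs Q l)) :
    ∃ l' : List (Q.V → ℤ), (∀ b ∈ l ++ l', NCPaper.RT b) ∧ coxeter Q ord = rfs Q (l ++ l') ∧
      (l ++ l').length = Fintype.card Q.V ∧ EExc Q (l ++ l') := by
  obtain ⟨l', h1, h2, h3⟩ := absLe_fac hord h
  have hr : ∀ b ∈ l ++ l', NCPaper.RT b := by
    intro a ha
    rcases List.mem_append.1 ha with h | h
    exacts [hl a h, h1 a h]
  rw [← rfs_append] at h2
  have h4 : (l ++ l').length = Fintype.card Q.V := by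
    rw [List.length_append, hlen, ← h3, ell_cox hord hp]
  exact ⟨l', hr, h2, h4, (L3 hord hp hr h2).2 h4⟩

end EllT

structure Simp (A : Set (RepC k Q)) (l : List (RepC k Q)) : Prop where
  simple : ∀ S ∈ l, SimpleIn A S
  exc : ExcList l
  all : ∀ X, SimpleIn A X → ∃ S ∈ l, Nonempty (X ≅ S)

lemma exists_simp [IsAlgClosed k] {A : Set (RepC k Q)} (hA : WF A) (hfg : IsFinGen A) :
    ∃ l, Simp A l := by
  obtain ⟨l, h1, h2, h3⟩ := exists_excList hA hfg
  exact ⟨l, h1, h2, h3⟩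

lemma Simp.cls_eq {A : Set (RepC k Q)} {l : List (RepC k Q)} (h : Simp A l) (hA : WF A) :
    cls A = spn (l.map dimVec) := by
  apply le_antisymm
  · refine Submodule.span_le.2 ?_
    rintro _ ⟨X, hX, rfl⟩
    refine hA.induct (fun X => dimVec X ∈ spn (l.map dimVec)) ?_ ?_ X hX
    · intro X hz
      rw [dimVec_zero hz]; exact Submodule.zero_mem _
    · intro S X Y i p hS hX hY hs hP
      obtain ⟨T, hT, ⟨e⟩⟩ := h.all S hS
      change dimVec X ∈ _
      rw [hs.dim (hA.fd X hX), dimVec_of_iso e]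
      exact Submodule.add_mem _ (Submodule.subset_span (List.mem_map_of_mem hT)) hP
  · refine Submodule.span_le.2 ?_
    intro b hb
    obtain ⟨M, hM, rfl⟩ := List.mem_map.1 hb
    exact mem_cls (h.simple M hM).1

lemma Simp.sub {A D : Set (RepC k Q)} {l : List (RepC k Q)} (h : Simp A l) (hA : WF A) (hD : WF D)
    (hl : ∀ S ∈ l, S ∈ D) : A ⊆ D := by
  refine hA.induct (fun X => X ∈ D) (fun X hX => hD.zero hX) ?_
  intro S X Y i p hS hX hY hs hP
  obtain ⟨T, hT, ⟨e⟩⟩ := h.all S hS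
  exact hD.mid hs (hD.iso (hl T hT) e.symm) hP

lemma cox_list [IsAlgClosed k] {A : Set (RepC k Q)} (hA : WF A) (hfg : IsFinGen A)
    {w : (Q.V → ℤ) → (Q.V → ℤ)} (hw : IsCoxOf A w) :
    ∃ l, Simp A l ∧ w = rfs Q (l.map dimVec) := by
  obtain ⟨r, S, h1, h2, h3, h4, rfl⟩ := hw
  obtain ⟨l0, hl0⟩ := exists_simp hA hfg
  refine ⟨List.ofFn S, ⟨?_, ⟨?_, ?_⟩, ?_⟩, ?_⟩
  · intro X hX
    obtain ⟨i, rfl⟩ := (List.mem_ofFn' _ _).1 hX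
    exact h1 i
  · intro X hX
    obtain ⟨i, rfl⟩ := (List.mem_ofFn' _ _).1 hX
    obtain ⟨T, hT, ⟨e⟩⟩ := hl0.all _ (h1 i)
    exact (hl0.exc.1 T hT).iso e.symm
  · rw [List.pairwise_ofFn]
    intro i j hij
    have hi := hA.fd _ (h1 i).1
    have hj := hA.fd _ (h1 j).1
    exact ⟨(homZero_iff hj hi).1 (h4 i j hij).1, (ext1Zero_iff hj hi).1 (h4 i j hij).2⟩
  · intro X hX
    obtain ⟨i, hi⟩ := h3 X hX
    exact ⟨S i, (List.mem_ofFn' _ _).2 ⟨i, rfl⟩, hi⟩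
  · rw [List.map_ofFn]
    exact comps_eq _

lemma Simp.cox {A : Set (RepC k Q)} {l : List (RepC k Q)} (h : Simp A l) (hA : WF A) :
    IsCoxOf A (rfs Q (l.map dimVec)) := by
  have hlt : ∀ i j : Fin l.length, i < j → hom (l.get j) (l.get i) = 0 ∧ ext (l.get j) (l.get i) = 0 :=
    fun i j hij => List.pairwise_iff_get.1 h.exc.2 i j hij
  have hfd : ∀ i : Fin l.length, FinDim (l.get i) := fun i => (h.exc.1 _ (List.get_mem _ _)).fd
  have hni : ∀ i j : Fin l.length, i < j → ∀ e : l.get i ≅ l.get j, False := by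
    intro i j hij e
    have h1 := (hlt i j hij).1
    rw [hom_iso_right e, (h.exc.1 _ (List.get_mem l j)).hom1] at h1
    omega
  refine ⟨l.length, fun i => l.get i, fun i => h.simple _ (List.get_mem _ _), ?_, ?_, ?_, ?_⟩
  · rintro i j ⟨e⟩
    rcases lt_trichotomy i j with hij | hij | hij
    · exact (hni i j hij e).elim
    · exact hij
    · exact (hni j i hij e.symm).elim
  · intro X hX
    obtain ⟨S, hS, e⟩ := h.all X hX
    obtain ⟨i, rfl⟩ := List.get_of_mem hS
    exact ⟨i, e⟩
  · intro i j hij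
    exact ⟨(homZero_iff (hfd j) (hfd i)).2 (hlt i j hij).1, (ext1Zero_iff (hfd j) (hfd i)).2 (hlt i j hij).2⟩
  · rw [comps_eq (fun i => dimVec (l.get i))]
    congr 1
    conv_lhs => rw [← List.ofFn_get l, List.map_ofFn]
    rfl

lemma split_gen {D : Set (RepC k Q)} (hD : WF D) {s t : List (RepC k Q)} (hs : ExcList s)
    (hsD : ∀ M ∈ s, M ∈ D) (ht : Simp (rp s D) t) :
    ExcList (t ++ s) ∧ spn ((t ++ s).map dimVec) = cls D := by
  obtain ⟨r1, -, -, r4⟩ := rp_RP hD hs hsD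
  have ht' := ht.cls_eq r1.wf
  refine ⟨excList_append.2 ⟨ht.exc, hs, fun X hX Y hY => (mem_rp.1 (ht.simple X hX).1).2 Y hY⟩, ?_⟩
  apply le_antisymm
  · refine Submodule.span_le.2 ?_
    intro b hb
    obtain ⟨M, hM, rfl⟩ := List.mem_map.1 hb
    rcases List.mem_append.1 hM with h | h
    · exact mem_cls (mem_rp.1 (ht.simple M h).1).1
    · exact mem_cls (hsD M h)
  · refine Submodule.span_le.2 ?_
    rintro _ ⟨X, hX, rfl⟩
    refine r4 (fun X => dimVec X ∈ spn ((t ++ s).map dimVec)) (twoThree_cls hD _) ?_ ?_ X hX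
    · intro M hM
      exact Submodule.subset_span (List.mem_map_of_mem (by simp [hM]))
    · intro X hX
      have := mem_cls hX
      rw [ht'] at this
      refine spn_mono ?_ this
      intro x hx
      rw [List.map_append]
      exact List.mem_append_left _ hx

lemma split [IsAlgClosed k] {D : Set (RepC k Q)} (hD : WF D) (hfg : IsFinGen D) {s : List (RepC k Q)}
    (hs : ExcList s) (hsD : ∀ M ∈ s, M ∈ D) {m : List (Q.V → ℤ)} (hm : EExc Q m) (he : spn m = cls D) :
    ∃ y : List (Q.V → ℤ), (∀ b ∈ y, RT b) ∧ rfs Q m = rfs Q (s.map dimVec ++ y) ∧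
      (s.map dimVec ++ y).length = m.length := by
  obtain ⟨r1, r2, -, -⟩ := rp_RP hD hs hsD
  obtain ⟨t, ht⟩ := exists_simp r1.wf (r2 hfg)
  obtain ⟨h1, h2⟩ := split_gen hD hs hsD ht
  obtain ⟨y, y1, y2, y3⟩ := conj_list hs.RT ht.exc.RT
  refine ⟨y, y1, ?_, ?_⟩
  · rw [rfs_append, ← y3, ← rfs_append, ← List.map_append]
    exact rfs_unique hm h1.eexc (he.trans h2.symm)
  · have e1 := hm.finrank
    have e2 := h1.eexc.finrank
    rw [h2, ← he, e1] at e2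
    rw [e2]
    simp only [List.length_append, List.length_map] at y2 ⊢
    omega

section Fin16
variable {ord : Fin (Fintype.card Q.V) ≃ Q.V}

lemma split_all [IsAlgClosed k] (hord : OrdCompatible Q ord) {s : List (RepC k Q)} (hs : ExcList s) :
    ∃ y : List (Q.V → ℤ), (∀ b ∈ s.map dimVec ++ y, RT b) ∧ coxeter Q ord = rfs Q (s.map dimVec ++ y) ∧
      (s.map dimVec ++ y).length = Fintype.card Q.V := by
  obtain ⟨y, h1, h2, h3⟩ := split (allF_wf (k := k)) (allF_fg hord) hs (fun M hM => (hs.1 M hM).fd)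
    (sroots_eexc hord) ((spn_sroots ord).trans cls_allF.symm)
  refine ⟨y, ?_, by rw [coxeter_eq, h2], by rw [h3]; simp [sroots]⟩
  intro b hb
  rcases List.mem_append.1 hb with h | h
  exacts [hs.RT b h, h1 b h]

lemma part1 [IsAlgClosed k] (hord : OrdCompatible Q ord) (hp : PSD Q) {s : List (RepC k Q)} (hs : ExcList s) :
    absLe Q (rfs Q (s.map dimVec)) (coxeter Q ord) ∧ ellT Q (rfs Q (s.map dimVec)) = (s.map dimVec).length := by
  obtain ⟨y, h1, h2, h3⟩ := split_all hord hs
  refine ⟨?_, ell_prefix hord hp h1 h2 h3⟩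
  rw [h2]
  exact chain hord hp (l3 := []) _ _ (by simpa using h1) (by simpa using h2) (by simpa using h3)

lemma part2 [IsAlgClosed k] (hord : OrdCompatible Q ord) (hp : PSD Q) {A B : Set (RepC k Q)}
    (hB : WF B) (hfg : IsFinGen B) {a b : List (RepC k Q)} (ha : Simp A a)
    (hb : Simp B b) (h : A ⊆ B) : absLe Q (rfs Q (a.map dimVec)) (rfs Q (b.map dimVec)) := by
  obtain ⟨x, x1, x2, x3⟩ := split hB hfg ha.exc (fun M hM => h (ha.simple M hM).1) hb.exc.eexc
    (hb.cls_eq hB).symm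
  obtain ⟨y, y1, y2, y3⟩ := split_all hord hb.exc
  rw [x2]
  refine chain hord hp (l3 := y) _ _ ?_ ?_ ?_
  · intro c hc
    rcases List.mem_append.1 hc with h | h
    · rcases List.mem_append.1 h with h | h
      exacts [ha.exc.RT c h, x1 c h]
    · exact y1 c (List.mem_append_right _ h)
  · rw [rfs_append, ← x2, ← rfs_append, y2]
  · rw [List.length_append, x3, ← List.length_append, y3]

lemma real_perp [IsAlgClosed k] (hord : OrdCompatible Q ord) (hp : PSD Q) {l1 l2 : List (Q.V → ℤ)}
    (hE : EExc Q (l1 ++ l2)) (hl : ∀ b ∈ l1 ++ l2, RT b) (hlen : (l1 ++ l2).length = Fintype.card Q.V)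
    {X Y : RepC k Q} (hX : Exc X) (hY : Exc Y) (hX1 : dimVec X ∈ l1) (hY2 : dimVec Y ∈ l2.map pos) :
    hom Y X = 0 ∧ ext Y X = 0 := by
  obtain ⟨Ms, hMs, hd⟩ := real_thm (k := k) hord hp hE hl hlen
  rw [List.map_append, List.map_eq_append_iff] at hd
  obtain ⟨M1, M2, rfl, e1, e2⟩ := hd
  have hX1' : dimVec X ∈ M1.map dimVec := by
    rw [e1, List.mem_map]
    exact ⟨_, hX1, Exc.pos_dim⟩
  rw [← e2] at hY2
  obtain ⟨X', hX', dX⟩ := List.mem_map.1 hX1'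
  obtain ⟨Y', hY', dY⟩ := List.mem_map.1 hY2
  obtain ⟨p1, p2, p3⟩ := excList_append.1 hMs
  have eX' := p1.1 X' hX'
  have eY' := p2.1 Y' hY'
  obtain ⟨eX⟩ := eX'.ext_q hX dX
  obtain ⟨eY⟩ := eY'.ext_q hY dY
  obtain ⟨q1, q2⟩ := p3 X' hX' Y' hY'
  exact ⟨by rw [← hom_iso_left eY, ← hom_iso_right eX, q1],
    by rw [← ext_iso_left eY eY'.fd hX.fd, ← ext_iso_right eX eX'.fd eY'.fd, q2]⟩

lemma part3 [IsAlgClosed k] (hord : OrdCompatible Q ord) (hp : PSD Q) {A B : Set (RepC k Q)}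
    (hA : WF A) (hB : WF B) {a b : List (RepC k Q)} (ha : Simp A a)
    (hb : Simp B b) (h : absLe Q (rfs Q (a.map dimVec)) (rfs Q (b.map dimVec))) : A ⊆ B := by
  obtain ⟨b1, b2⟩ := part1 hord hp hb.exc
  obtain ⟨a1, a2⟩ := part1 hord hp ha.exc
  obtain ⟨l3, c1, c2, c3, c4⟩ := nc_fac hord hp hb.exc.RT b1 b2.symm
  obtain ⟨l2, d1, d2, d3⟩ := absLe_fac hord h
  rw [a2, b2] at d3
  have f1 : ∀ x ∈ a.map dimVec ++ (l2 ++ l3), RT x := by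
    intro x hx
    rcases List.mem_append.1 hx with h | h
    · exact ha.exc.RT x h
    · rcases List.mem_append.1 h with h | h
      exacts [d1 x h, c1 x (List.mem_append_right _ h)]
  have f2 : coxeter Q ord = rfs Q (a.map dimVec ++ (l2 ++ l3)) := by
    rw [c2, rfs_append, d2, ← rfs_append, ← rfs_append, List.append_assoc]
  have f3 : (a.map dimVec ++ (l2 ++ l3)).length = Fintype.card Q.V := by
    rw [← c3]
    simp only [List.length_append] at d3 ⊢
    omega
  have f4 := (L3 hord hp f1 f2).2 f3
  obtain ⟨Ms, hMs, hd⟩ := real_thm (k := k) hord hp c4 c1 c3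
  rw [List.map_append, List.map_eq_append_iff] at hd
  obtain ⟨M1, M3, rfl, e1, e2⟩ := hd
  have hM3 := (excList_append.1 hMs).2.1
  have hM3' : ∀ M ∈ M3, dimVec M ∈ l3.map pos := fun M hM => by
    rw [← e2]; exact List.mem_map_of_mem hM
  obtain ⟨r1, r2, r3, r4⟩ := rp_RP (allF_wf (k := k)) hM3 (fun M hM => (hM3.1 M hM).fd)
  have hbD : ∀ X ∈ b, X ∈ rp M3 (allF k Q) := fun X hX => mem_rp.2 ⟨(hb.exc.1 X hX).fd, fun Y hY =>
    real_perp hord hp c4 c1 c3 (hb.exc.1 X hX) (hM3.1 Y hY) (List.mem_map_of_mem hX) (hM3' Y hY)⟩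
  have haD : ∀ X ∈ a, X ∈ rp M3 (allF k Q) := fun X hX => mem_rp.2 ⟨(ha.exc.1 X hX).fd, fun Y hY =>
    real_perp hord hp f4 f1 f3 (ha.exc.1 X hX) (hM3.1 Y hY) (List.mem_map_of_mem hX) (by
      rw [List.map_append]; exact List.mem_append_right _ (hM3' Y hY))⟩
  obtain ⟨s1, s2, s3, s4⟩ := rp_RP r1.wf hb.exc hbD
  have hDB : ∀ X ∈ rp M3 (allF k Q), X ∈ B := by
    refine s4 (fun X => X ∈ B) ⟨?_, ?_, ?_⟩ (fun M hM => (hb.simple M hM).1) ?_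
    · exact fun hs _ _ _ h1 h2 => hB.left hs h1 h2
    · exact fun hs _ _ _ h1 h2 => hB.mid hs h1 h2
    · exact fun hs _ _ _ h1 h2 => hB.right hs h1 h2
    · intro X hX
      have hz : Module.finrank ℤ (cls (rp b (rp M3 (allF k Q)))) = 0 := by
        have g1 := r1.rank
        have g2 := s1.rank
        rw [finrank_allF] at g1
        have g3 : M3.length = l3.length := by
          have := congrArg List.length e2
          simpa using this
        simp only [List.length_append, List.length_map] at c3
        omega
      have hx := mem_cls hX
      rw [finrank_zero_eq hz, Submodule.mem_bot] at hx
      apply hB.zero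
      apply isZero_of_tdim (s1.wf.fd X hX)
      zify
      rw [tdim_eq, hx]
      simp
  exact ha.sub hA hB fun S hS => hDB S (haD S hS)

lemma part4 [IsAlgClosed k] (hord : OrdCompatible Q ord) (hp : PSD Q) {w : (Q.V → ℤ) → (Q.V → ℤ)}
    (hw : w ∈ NCSet Q ord) : ∃ A : Set (RepC k Q), WF A ∧ IsFinGen A ∧ IsCoxOf A w := by
  obtain ⟨⟨v, rfl⟩, h⟩ := hw
  have hv : wordProd Q v = rfs Q (v.map (simRoot Q)) := by
    rw [wordProd, rfs, List.map_map]; rfl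
  rw [hv] at h ⊢
  obtain ⟨m, m1, m2, m3⟩ := ell_min hord hp (l := v.map (simRoot Q)) (by
    intro b hb
    obtain ⟨i, _, rfl⟩ := List.mem_map.1 hb
    exact RT_simRoot (euler_simRoot_self hord) i)
  rw [m3] at h m2 ⊢
  obtain ⟨l3, c1, c2, c3, c4⟩ := nc_fac hord hp m1 h m2
  obtain ⟨Ms, hMs, hd⟩ := real_thm (k := k) hord hp c4 c1 c3
  rw [List.map_append, List.map_eq_append_iff] at hd
  obtain ⟨M1, M3, rfl, e1, e2⟩ := hd
  have hM3 := (excList_append.1 hMs).2.1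
  have hF : ∀ M ∈ M3, M ∈ allF k Q := fun M hM => (hM3.1 M hM).fd
  obtain ⟨r1, r2, r3, r4⟩ := rp_RP (allF_wf (k := k)) hM3 hF
  have hfg := r2 (allF_fg hord)
  obtain ⟨t, ht⟩ := exists_simp r1.wf hfg
  obtain ⟨g1, g2⟩ := split_gen allF_wf hM3 hF ht
  refine ⟨_, r1.wf, hfg, ?_⟩
  have key : rfs Q (t.map dimVec) ∘ rfs Q l3 = rfs Q m ∘ rfs Q l3 := by
    rw [← rfs_append m, ← c2, ← rfs_map_pos l3, ← e2, ← rfs_append, ← List.map_append, coxeter_eq]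
    exact rfs_unique g1.eexc (sroots_eexc hord) (by rw [g2, spn_sroots, cls_allF])
  have := (rfs_surj (fun b hb => c1 b (List.mem_append_right _ hb))).injective_comp_right key
  rw [← this]
  exact ht.cox r1.wf

end Fin16

/-- Let `Q` be of finite or affine type.  The map sending a finitely
generated wide subcategory `A` of `rep Q` to `cox(A)` is a well-defined
order-preserving bijection from the poset `W_Q` of finitely generated wide
subcategories (ordered by inclusion) onto the poset `NC_Q` of noncrossing partitions
(ordered by absolute order); in fact it is a poset isomorphism. -/
theorem statement16 (k : Type) [Field k] [IsAlgClosed k] (Q : FinQuiver)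
    (htype : FiniteType Q ∨ AffineType Q)
    (ord : Fin (Fintype.card Q.V) ≃ Q.V) (hord : OrdCompatible Q ord) :
    (∀ A : Set (RepC k Q), IsWide A → (∀ X ∈ A, FinDim X) → IsFinGen A →
      (∃ w, IsCoxOf A w) ∧ ∀ w, IsCoxOf A w → w ∈ NCSet Q ord) ∧
    (∀ A B : Set (RepC k Q), ∀ wA wB : (Q.V → ℤ) → (Q.V → ℤ),
      IsWide A → (∀ X ∈ A, FinDim X) → IsFinGen A →
      IsWide B → (∀ X ∈ B, FinDim X) → IsFinGen B →
      IsCoxOf A wA → IsCoxOf B wB →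
      ((A ⊆ B → absLe Q wA wB) ∧ (absLe Q wA wB → A ⊆ B))) ∧
    (∀ w ∈ NCSet Q ord, ∃ A : Set (RepC k Q),
      IsWide A ∧ (∀ X ∈ A, FinDim X) ∧ IsFinGen A ∧ IsCoxOf A w) := by
  have hp := psd_of_type htype
  refine ⟨?_, ?_, ?_⟩
  · intro A hA hA' hfg
    have hW : WF A := ⟨hA, hA'⟩
    constructor
    · obtain ⟨l, hl⟩ := exists_simp hW hfg
      exact ⟨_, hl.cox hW⟩
    · intro w hw
      obtain ⟨l, hl, rfl⟩ := cox_list hW hfg hw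
      exact ⟨inW_rfs (euler_simRoot_self hord) hp hl.exc.RT, (part1 hord hp hl.exc).1⟩
  · intro A B wA wB hA hA' hAf hB hB' hBf cA cB
    obtain ⟨a, ha, rfl⟩ := cox_list ⟨hA, hA'⟩ hAf cA
    obtain ⟨b, hb, rfl⟩ := cox_list ⟨hB, hB'⟩ hBf cB
    exact ⟨part2 hord hp ⟨hB, hB'⟩ hBf ha hb, part3 hord hp ⟨hA, hA'⟩ ⟨hB, hB'⟩ ha hb⟩
  · intro w hw
    obtain ⟨A, h1, h2, h3⟩ := part4 (k := k) hord hp hw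
    exact ⟨A, h1.wide, h1.fd, h2, h3⟩


end Statement16
end NCPaper
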